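/- Let q be a prime power and let C ⊆ L_{n,q} be an exceptional r-dimensional F_{q^n}-linear MRD code (for infinitely many m, every nonzero element of the F_{q^{nm}}-span of a generating set of C, viewed as an F_q-linear map on F_{q^{nm}}, has kernel of F_q-dimension at most r−1) containing a separable q-polynomial f(x) (i.e. with nonzero coefficient of X) and a monomial; if r > 3, assume also q > 5. Let t be the minimum integer such that x^{q^t} ∈ C. If t > 0 and C = ⟨x^{q^t}, f(x), g_3(x), …, g_r(x)⟩_{F_{q^n}} with deg(g_i(x)) > max{q^t, deg(f(x))} for each i = 3, …, r, then f(x) is exceptional scattered of index t, i.e. there are infinitely many m such that dim_{F_q} ker( f(x) − m'x^{q^t} : F_{q^{nm}} → F_{q^{nm}} ) ≤ 1 for every m' ∈ F_{q^{nm}}. -/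

import Mathlib

section part1
set_option autoImplicit false

theorem pow_mono_of_one {k B : Type*} [Field k] [CommRing B] [Algebra k B]
    (U : Submodule k B) (hU1 : (1:B) ∈ U) {a b : ℕ} (hab : a ≤ b) : U^a ≤ U^b := by
  have h1 : (1 : Submodule k B) ≤ U := by
    rw [Submodule.one_le]; exact hU1
  exact pow_le_pow_right₀ h1 hab

theorem stepZ {k B ι : Type*} [Field k] [CommRing B] [IsDomain B] [Algebra k B]
    (U : Submodule k B) (hU1 : (1:B) ∈ U) (hfg : U.FG) [Fintype ι]
    (P : ι → B →ₐ[k] k) (hP : ∀ i j, i ≠ j → ∃ u ∈ U, P i u ≠ P j u)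
    (f : B) (hf0 : f ≠ 0) (D : ℕ) (hf : f ∈ U^D) (hfP : ∀ i, P i f = 0) :
    Fintype.card ι + Module.finrank k (U^(Fintype.card ι) : Submodule k B) ≤
      Module.finrank k (U^(Fintype.card ι + D) : Submodule k B) := by
  classical
  set c := Fintype.card ι with hc
  have hfin : ∀ n, Module.Finite k (U^n : Submodule k B) := fun n =>
    Module.Finite.iff_fg.mpr (hfg.pow n)
  have := hfin c
  have := hfin (c+D)
  let ev : (U^(c+D) : Submodule k B) →ₗ[k] (ι → k) :=
    (LinearMap.pi fun i => (P i).toLinearMap) ∘ₗ (U^(c+D)).subtype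
  have hev : ∀ x i, ev x i = P i x := fun x i => rfl
  have hsurj : Function.Surjective ev := by
    choose! u hu hne using hP
    have key : ∀ i, ∃ x : (U^(c+D) : Submodule k B), P i x ≠ 0 ∧ ∀ j, j ≠ i → P j x = 0 := by
      intro i
      have hmem : ∀ s : Finset ι, i ∉ s → (∏ j ∈ s, (u i j - algebraMap k B (P j (u i j)))) ∈ U^s.card := by
        intro s
        induction s using Finset.induction_on with
        | empty => intro _; simp
        | insert a s ha ih =>
          intro h
          simp only [Finset.mem_insert, not_or] at h
          rw [Finset.prod_insert ha, Finset.card_insert_of_notMem ha, pow_succ']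
          refine Submodule.mul_mem_mul ?_ (ih h.2)
          refine Submodule.sub_mem _ (hu i a h.1) ?_
          rw [Algebra.algebraMap_eq_smul_one]
          exact Submodule.smul_mem _ _ hU1
      refine ⟨⟨_, pow_mono_of_one U hU1 ?_ (hmem (Finset.univ.erase i) (by simp))⟩, ?_, ?_⟩
      · have := Finset.card_erase_le (s := (Finset.univ : Finset ι)) (a := i)
        rw [Finset.card_univ] at this
        omega
      · simp only [map_prod, map_sub, AlgHom.commutes]
        rw [Finset.prod_ne_zero_iff]
        intro j hj
        have : i ≠ j := (Finset.ne_of_mem_erase hj).symm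
        simpa [sub_ne_zero] using hne i j this
      · intro j hj
        simp only [map_prod, map_sub, AlgHom.commutes]
        refine Finset.prod_eq_zero (i := j) (by simp [hj]) (by simp)
    choose x hx0 hx1 using key
    intro w
    refine ⟨∑ i, (w i / P i (x i)) • x i, ?_⟩
    ext j
    rw [map_sum, Finset.sum_apply, Finset.sum_eq_single j]
    · simp [hev, hx0 j]
    · intro b _ hb
      simp [hev, hx1 b j hb.symm]
    · simp
  have h1 := LinearMap.finrank_range_add_finrank_ker ev
  rw [LinearMap.range_eq_top.mpr hsurj, finrank_top, Module.finrank_pi] at h1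
  let m : (U^c : Submodule k B) →ₗ[k] LinearMap.ker ev :=
    LinearMap.codRestrict _ (LinearMap.codRestrict _ ((LinearMap.mulRight k f) ∘ₗ (U^c).subtype)
      (fun x => by
        rw [pow_add]; exact Submodule.mul_mem_mul x.2 hf))
      (fun x => by
        rw [LinearMap.mem_ker]; ext i; rw [hev]; simp [hfP])
  have hm : Function.Injective m := by
    intro x y hxy
    have := congrArg (fun z : LinearMap.ker ev => (z.1.1 : B)) hxy
    apply Subtype.ext
    exact mul_right_cancel₀ hf0 this
  have h2 := LinearMap.finrank_le_finrank_of_injective hm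
  omega

theorem map_pow_mem {k B : Type*} [Field k] [CommRing B] [Algebra k B]
    (U : Submodule k B) (A : B →+* B) (hAk : ∀ t : k, ∃ t' : k, A (algebraMap k B t) = algebraMap k B t')
    (hAU : ∀ u ∈ U, A u ∈ U) (n : ℕ) : ∀ b ∈ U^n, A b ∈ U^n := by
  intro b hb
  induction hb using Submodule.pow_induction_on_left' with
  | algebraMap r =>
    obtain ⟨t', ht'⟩ := hAk r
    rw [ht', pow_zero]; exact Submodule.algebraMap_mem t'
  | add x y i hx hy h1 h2 => rw [map_add]; exact add_mem h1 h2
  | mem_mul m hm i x hx ih => rw [map_mul, pow_succ']; exact Submodule.mul_mem_mul (hAU m hm) ih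

theorem stepS {k B : Type*} [Field k] [IsAlgClosed k] [CommRing B] [IsDomain B] [Algebra k B]
    (p : ℕ) [Fact p.Prime] [CharP k p]
    (U : Submodule k B) (hfg : U.FG) (A : B →+* B) (s μ : ℕ) (hμ : μ ≤ s)
    (hA : ∀ t : k, A (algebraMap k B t) = algebraMap k B (t^(p^s)))
    (hAU : ∀ u ∈ U, A u ∈ U) (l κ d : ℕ) (r : Fin d → B) (hr : ∀ j, r j ∈ U^κ)
    (hdim : Module.finrank k (U^(p^μ*l+κ) : Submodule k B) <
       Module.finrank k (U^l : Submodule k B) * d)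
    (hind : ∀ S : Fin d → B, (∀ j, S j ∈ U^l) → ∑ j, S j * (r j)^(p^(s-μ)) = 0 → ∀ j, S j = 0) :
    ∃ f : B, f ≠ 0 ∧ f ∈ U^(l+κ*p^(s-μ)) ∧
      ∀ P : B →ₐ[k] k, (∀ b, P (A b) = (P b)^(p^s)) → P f = 0 := by
  classical
  have hfin : ∀ n, Module.Finite k (U^n : Submodule k B) := fun n =>
    Module.Finite.iff_fg.mpr (hfg.pow n)
  have := hfin l
  have := hfin (p^μ*l+κ)
  have : CharP B p := charP_of_injective_algebraMap (algebraMap k B).injective p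
  let bs := Module.finBasis k (U^l : Submodule k B)
  have hmem : ∀ i j, ((bs i : B))^(p^μ) * A (r j) ∈ U^(p^μ*l+κ) := by
    intro i j
    rw [pow_add, mul_comm (p^μ) l, pow_mul]
    refine Submodule.mul_mem_mul (Submodule.pow_mem_pow _ (bs i).2 _) ?_
    exact map_pow_mem U A (fun t => ⟨_, hA t⟩) hAU _ _ (hr j)
  let Φ : (Fin (Module.finrank k (U^l : Submodule k B)) × Fin d → k) →ₗ[k] (U^(p^μ*l+κ) : Submodule k B) :=
    Fintype.linearCombination k (fun ij => ⟨_, hmem ij.1 ij.2⟩)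
  have hker : LinearMap.ker Φ ≠ ⊥ := by
    apply LinearMap.ker_ne_bot_of_finrank_lt
    simpa using hdim
  obtain ⟨y, hy, hy0⟩ := Submodule.exists_mem_ne_zero_of_ne_bot hker
  have hpm : 0 < p^μ := pow_pos (Fact.out : p.Prime).pos _
  have hz : ∀ ij, ∃ z, z^(p^μ) = y ij := fun ij => IsAlgClosed.exists_pow_nat_eq _ hpm
  choose z hz using hz
  let S : Fin d → B := fun j => ∑ i, z (i,j) • (bs i : B)
  have hS : ∀ j, S j ∈ U^l := fun j =>
    Submodule.sum_mem _ fun i _ => Submodule.smul_mem _ _ (bs i).2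
  have hps : (p^(s-μ)) * p^μ = p^s := by rw [← pow_add]; congr 1; omega
  refine ⟨∑ j, S j * (r j)^(p^(s-μ)), ?_, ?_, ?_⟩
  · intro h0
    have h1 := hind S hS h0
    apply hy0
    ext ⟨i, j⟩
    have h2 : ∑ i, z (i,j) • bs i = 0 := by
      apply Subtype.ext
      have := h1 j
      simpa [S] using this
    have := Fintype.linearIndependent_iff.mp bs.linearIndependent (fun i => z (i,j)) h2 i
    rw [← hz, this, zero_pow hpm.ne']; rfl
  · refine Submodule.sum_mem _ fun j _ => ?_
    rw [pow_add, pow_mul]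
    exact Submodule.mul_mem_mul (hS j) (Submodule.pow_mem_pow _ (hr j) _)
  · intro P hP
    have h0 : P (∑ j, S j * (r j)^(p^(s-μ))) ^ (p^μ) = 0 := by
      rw [← map_pow, sum_pow_char_pow p μ]
      have hy' : (Φ y : B) = 0 := by rw [LinearMap.mem_ker.mp hy]; rfl
      have h3 : (Φ y : B) = ∑ j, ∑ i, y (i,j) • ((bs i : B)^(p^μ) * A (r j)) := by
        simp only [Φ, Fintype.linearCombination_apply]
        rw [Fintype.sum_prod_type_right]
        simp
      have h4 : P (Φ y : B) = P (∑ j, (S j * (r j)^(p^(s-μ)))^(p^μ)) := by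
        rw [h3]
        simp only [map_sum]
        refine Finset.sum_congr rfl fun j _ => ?_
        rw [mul_pow, ← pow_mul, hps]
        simp only [S]
        rw [sum_pow_char_pow p μ]
        rw [map_mul, map_sum, Finset.sum_mul]
        refine Finset.sum_congr rfl fun i _ => ?_
        rw [smul_pow, hz]
        simp [hP, mul_assoc]
      rw [← h4, hy', map_zero]
    exact pow_eq_zero_iff hpm.ne' |>.mp h0
end part1

section part2
set_option autoImplicit false
open Polynomial

section val
variable {k M Γ₀ : Type*} [Field k] [Field M] [Algebra k[X] M] [Algebra k M] [IsScalarTower k k[X] M]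
  [LinearOrderedCommGroupWithZero Γ₀] (v : Valuation M Γ₀)

theorem exists_val (k M : Type*) [Field k] [Field M] [Algebra k[X] M] [Algebra k M] [IsScalarTower k k[X] M]
    (hinj : Function.Injective (algebraMap k[X] M)) :
    ∃ V : ValuationSubring M, (∀ t : k, t ≠ 0 → V.valuation (algebraMap k M t) = 1) ∧
      1 < V.valuation (algebraMap k[X] M X) := by
  set x := algebraMap k[X] M X with hx
  have hae : ∀ f : k[X], aeval x f = algebraMap k[X] M f := by
    intro f
    rw [hx, aeval_algebraMap_apply, aeval_X_left_apply]
  have htr : Transcendental k x := by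
    rw [transcendental_iff_injective]
    intro f g hfg
    rw [hae, hae] at hfg
    exact hinj hfg
  have hx0 : x ≠ 0 := fun h => htr (h ▸ isAlgebraic_zero)
  have htr' : Transcendental k x⁻¹ := by
    intro h; exact htr (by simpa using h.inv)
  let A : Subring M := (Algebra.adjoin k {x⁻¹}).toSubring
  have hxA : x⁻¹ ∈ A := Algebra.subset_adjoin (by simp)
  let I : Ideal A := Ideal.span {⟨x⁻¹, hxA⟩}
  have hI : I ≠ ⊤ := by
    rw [Ne, Ideal.eq_top_iff_one, Ideal.mem_span_singleton']
    rintro ⟨⟨a, ha⟩, h⟩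
    have ha' : a ∈ Algebra.adjoin k {x⁻¹} := ha
    rw [Algebra.adjoin_singleton_eq_range_aeval] at ha'
    obtain ⟨g, rfl⟩ := ha'
    have h1 : (aeval x⁻¹ g) * x⁻¹ = 1 := congrArg Subtype.val h
    have h2 : aeval x⁻¹ (g * X) = aeval x⁻¹ (1 : k[X]) := by simpa using h1
    have h3 := transcendental_iff_injective.mp htr' h2
    have := congrArg (eval 0) h3
    simp at this
  obtain ⟨V, hAV, hIV⟩ := Ideal.image_subset_nonunits_valuationSubring I hI
  have hle : ∀ t : k, V.valuation (algebraMap k M t) ≤ 1 := fun t => by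
    rw [V.valuation_le_one_iff]
    exact hAV ((Algebra.adjoin k {x⁻¹}).algebraMap_mem t)
  refine ⟨V, ?_, ?_⟩
  · intro t ht
    refine le_antisymm (hle t) ?_
    have h1 := hle t⁻¹
    rw [map_inv₀, map_inv₀] at h1
    have h0 : V.valuation (algebraMap k M t) ≠ 0 := by simpa using ht
    exact (one_le_inv₀ (inv_pos.mpr (zero_lt_iff.mpr h0))).mpr h1 |>.trans_eq (inv_inv _)
  · have : x⁻¹ ∈ V.nonunits := hIV ⟨⟨x⁻¹, hxA⟩, Ideal.subset_span rfl, rfl⟩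
    rw [ValuationSubring.mem_nonunits_iff] at this
    rw [map_inv₀] at this
    exact (inv_lt_one₀ (zero_lt_iff.mpr (by simpa using hx0))).mp this

variable (hk : ∀ t : k, t ≠ 0 → v (algebraMap k M t) = 1) (hx : 1 < v (algebraMap k[X] M X))
include hk hx

theorem val_le (f : k[X]) (d : ℕ) (hd : f.natDegree ≤ d) :
    v (algebraMap k[X] M f) ≤ v (algebraMap k[X] M X) ^ d := by
  rw [f.as_sum_range_C_mul_X_pow, map_sum]
  refine Valuation.map_sum_le _ fun i hi => ?_
  rw [map_mul, map_mul, map_pow, map_pow]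
  have hc : algebraMap k[X] M (C (f.coeff i)) = algebraMap k M (f.coeff i) := by
    rw [IsScalarTower.algebraMap_apply k k[X] M]; rfl
  rw [hc]
  by_cases h0 : f.coeff i = 0
  · rw [h0]; simp
  · rw [hk _ h0, one_mul]
    refine pow_le_pow_right₀ hx.le ?_
    have := Finset.mem_range.mp hi
    omega

theorem val_eq (f : k[X]) (hf : f ≠ 0) :
    v (algebraMap k[X] M f) = v (algebraMap k[X] M X) ^ f.natDegree := by
  have hc : ∀ a, algebraMap k[X] M (C a) = algebraMap k M a := fun a => by
    rw [IsScalarTower.algebraMap_apply k k[X] M]; rfl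
  have hl : v (algebraMap k[X] M (C f.leadingCoeff * X ^ f.natDegree)) = v (algebraMap k[X] M X) ^ f.natDegree := by
    rw [map_mul, map_mul, map_pow, map_pow, hc, hk _ (by simpa using hf), one_mul]
  by_cases hd : f.natDegree = 0
  · obtain ⟨a, rfl⟩ := natDegree_eq_zero.mp hd
    rw [hc, natDegree_C, pow_zero, hk]
    rintro rfl; simp at hf
  · have h1 : v (algebraMap k[X] M f.eraseLead) < v (algebraMap k[X] M X) ^ f.natDegree := by
      refine (val_le v hk hx f.eraseLead (f.natDegree - 1) f.eraseLead_natDegree_le).trans_lt ?_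
      exact pow_lt_pow_right₀ hx (by omega)
    conv_lhs => rw [← f.eraseLead_add_C_mul_X_pow, map_add]
    rw [Valuation.map_add_eq_of_lt_right v (by rw [hl]; exact h1), hl]

omit hk hx in
theorem exists_eq_val {ι : Type*} (s : Finset ι) (a : ι → M) (hs : ∑ i ∈ s, a i = 0) (i₀ : ι) (hi : i₀ ∈ s)
    (ha : a i₀ ≠ 0) : ∃ i ∈ s, ∃ j ∈ s, i ≠ j ∧ a i ≠ 0 ∧ a j ≠ 0 ∧ v (a i) = v (a j) := by
  classical
  by_contra! hcon
  obtain ⟨j, hj, hmax⟩ := s.exists_max_image (fun i => v (a i)) ⟨i₀, hi⟩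
  have hj0 : a j ≠ 0 := by
    intro h
    have := hmax i₀ hi
    rw [h, map_zero] at this
    exact ha (by simpa using this)
  have h1 : v (∑ i ∈ s.erase j, a i) < v (a j) := by
    refine Valuation.map_sum_lt v (by simpa using hj0) fun i hi => ?_
    obtain ⟨hne, his⟩ := Finset.mem_erase.mp hi
    by_cases hi0 : a i = 0
    · rw [hi0, map_zero]; exact zero_lt_iff.mpr (by simpa using hj0)
    · exact lt_of_le_of_ne (hmax i his) (hcon i his j hj hne hi0 hj0)
  have h2 := Finset.add_sum_erase s a hj
  rw [hs] at h2
  have h3 : ∑ i ∈ s.erase j, a i = - a j := by linear_combination h2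
  rw [h3, Valuation.map_neg] at h1
  exact lt_irrefl _ h1

theorem exists_res [IsAlgClosed k] [Algebra.IsAlgebraic k[X] M] (a : M) (ha : v a ≤ 1) :
    ∃ t : k, v (a - algebraMap k M t) < 1 := by
  obtain ⟨P, hP0, hP⟩ := Algebra.IsAlgebraic.isAlgebraic (R := k[X]) a
  have hc : ∀ a, algebraMap k[X] M (C a) = algebraMap k M a := fun a => by
    rw [IsScalarTower.algebraMap_apply k k[X] M]; rfl
  set x := algebraMap k[X] M X with hxd
  obtain ⟨i₁, hi₁, hmax⟩ := P.support.exists_max_image (fun i => (P.coeff i).natDegree) (by simpa using hP0)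
  set d := (P.coeff i₁).natDegree with hd
  have hmax' : ∀ i, (P.coeff i).natDegree ≤ d := fun i => by
    by_cases hi : i ∈ P.support
    · exact hmax i hi
    · rw [notMem_support_iff.mp hi]; simp
  let c : k[X] := ∑ i ∈ Finset.range (P.natDegree+1), C ((P.coeff i).coeff d) * X ^ i
  have hc0 : c ≠ 0 := by
    intro h
    have h1 : c.coeff i₁ = 0 := by rw [h]; simp
    simp only [c, finsetSum_coeff, coeff_C_mul, coeff_X_pow] at h1
    rw [Finset.sum_eq_single i₁] at h1
    · have : (P.coeff i₁).leadingCoeff = 0 := by rw [leadingCoeff, ← hd]; simpa using h1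
      rw [leadingCoeff_eq_zero] at this
      exact mem_support_iff.mp hi₁ this
    · intro b _ hb; simp [hb.symm]
    · intro h; exact absurd (Finset.mem_range.mpr (Nat.lt_succ_of_le (le_natDegree_of_mem_supp _ hi₁))) h
  have hlt : v (aeval a c) < 1 := by
    have hxd0 : 0 < v x ^ d := pow_pos (zero_lt_one.trans hx) _
    have h1 : v (aeval a c * x ^ d) < v x ^ d := by
      have h2 : aeval a c * x^d = ∑ i ∈ Finset.range (P.natDegree+1),
          algebraMap k[X] M (C ((P.coeff i).coeff d) * X^d - P.coeff i) * a ^ i := by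
        have h3 : ∑ i ∈ Finset.range (P.natDegree+1), algebraMap k[X] M (P.coeff i) * a ^ i = 0 := by
          rw [← hP, aeval_eq_sum_range]; simp [Algebra.smul_def]
        simp only [map_sub, sub_mul, Finset.sum_sub_distrib]
        rw [h3, sub_zero]
        simp only [c, map_sum, map_mul, Finset.sum_mul, map_pow, aeval_C, aeval_X, hc]
        exact Finset.sum_congr rfl fun i _ => by ring
      rw [h2]
      refine Valuation.map_sum_lt v hxd0.ne' fun i _ => ?_
      rw [map_mul, map_pow]
      refine (mul_le_of_le_one_right' (pow_le_one' ha i)).trans_lt ?_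
      set g := C ((P.coeff i).coeff d) * X^d - P.coeff i with hg
      have hgc : ∀ j, d ≤ j → g.coeff j = 0 := by
        intro j hj
        rw [hg, coeff_sub, coeff_C_mul, coeff_X_pow]
        rcases hj.eq_or_lt with rfl | hj
        · simp
        · rw [if_neg hj.ne', coeff_eq_zero_of_natDegree_lt ((hmax' i).trans_lt hj)]; simp
      by_cases hg0 : g = 0
      · rw [hg0]; simpa using hxd0
      · rw [val_eq v hk hx g hg0]
        refine pow_lt_pow_right₀ hx ?_
        by_contra! hge
        exact hg0 (leadingCoeff_eq_zero.mp (hgc _ hge))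
    rw [map_mul, map_pow] at h1
    exact (mul_lt_iff_lt_one_left hxd0).mp h1
  have hsp := IsAlgClosed.splits c
  by_contra! hcon
  have hm : ∀ s : Multiset k, 1 ≤ v (aeval a (s.map fun t => X - C t).prod) := by
    intro s
    induction s using Multiset.induction with
    | empty => simp
    | cons t s ih =>
      rw [Multiset.map_cons, Multiset.prod_cons, map_mul, map_mul]
      refine one_le_mul ?_ ih
      simpa using hcon t
  rw [hsp.eq_prod_roots, map_mul, map_mul, aeval_C, hk _ (by simpa using hc0), one_mul] at hlt
  exact absurd hlt (not_lt.mpr (hm _))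

theorem exists_distinct [IsAlgClosed k] [Algebra.IsAlgebraic k[X] M] (n : ℕ) :
    ∀ (W : Submodule k M) [FiniteDimensional k W], n ≤ Module.finrank k W →
    ∃ r : Fin n → M, (∀ j, r j ∈ W) ∧ (∀ j, r j ≠ 0) ∧ Function.Injective (fun j => v (r j)) := by
  induction n with
  | zero => intro W _ _; exact ⟨Fin.elim0, fun j => j.elim0, fun j => j.elim0, fun j => j.elim0⟩
  | succ n ih =>
    intro W _ hW
    let b := Module.finBasis k W
    have : Nonempty (Fin (Module.finrank k W)) := ⟨⟨0, by omega⟩⟩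
    obtain ⟨i₀, hi₀⟩ := Finite.exists_max (fun i => v (b i : M))
    obtain ⟨a, ha⟩ : ∃ a : M, a = (b i₀ : M) := ⟨_, rfl⟩
    have ha0 : a ≠ 0 := by
      have := b.ne_zero i₀
      simpa [ha] using this
    have hva : 0 < v a := zero_lt_iff.mpr (by simpa using ha0)
    have hk' : ∀ t : k, v (algebraMap k M t) ≤ 1 := fun t => by
      by_cases h : t = 0
      · rw [h]; simp
      · exact (hk t h).le
    have hle : ∀ w ∈ W, v w ≤ v a := by
      intro w hw
      have h1 := b.sum_repr ⟨w, hw⟩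
      have h2 : w = ∑ i, b.repr ⟨w, hw⟩ i • (b i : M) := by
        have := congrArg W.subtype h1
        rw [map_sum] at this
        exact this.symm
      rw [h2]
      refine Valuation.map_sum_le _ fun i _ => ?_
      rw [Algebra.smul_def, map_mul]
      exact (mul_le_of_le_one_left' (hk' _)).trans (ha ▸ hi₀ i)
    let W' : Submodule k M :=
      { carrier := {w | w ∈ W ∧ v w < v a}
        add_mem' := fun {x y} hx hy => ⟨W.add_mem hx.1 hy.1, v.map_add_lt hx.2 hy.2⟩
        zero_mem' := ⟨W.zero_mem, by simpa using hva⟩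
        smul_mem' := fun t w hw => ⟨W.smul_mem t hw.1, by
          rw [Algebra.smul_def, map_mul]
          exact (mul_le_of_le_one_left' (hk' _)).trans_lt hw.2⟩ }
    have hW'W : W' ≤ W := fun w hw => hw.1
    have : FiniteDimensional k W' := Submodule.finiteDimensional_of_le hW'W
    have hsup : W ≤ W' ⊔ Submodule.span k {a} := by
      intro w hw
      obtain ⟨t, ht⟩ := exists_res v hk hx (w / a) (by
        rw [map_div₀]; exact div_le_one_of_le₀ (hle w hw) hva.le)
      rw [Submodule.mem_sup]
      refine ⟨w - t • a, ⟨W.sub_mem hw (W.smul_mem _ (ha ▸ (b i₀).2)), ?_⟩, t • a,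
        Submodule.smul_mem _ _ (Submodule.mem_span_singleton_self a), by abel⟩
      have : w - t • a = (w / a - algebraMap k M t) * a := by
        rw [Algebra.smul_def]; field_simp
      rw [this, map_mul]
      exact (mul_lt_iff_lt_one_left hva).mpr ht
    have h3 := Submodule.finrank_mono hsup
    have h4 := Submodule.finrank_add_le_finrank_add_finrank W' (Submodule.span k {a})
    have h5 := finrank_span_singleton (K := k) ha0
    obtain ⟨r, hr1, hr2, hr3⟩ := ih W' (by omega)
    refine ⟨Fin.cons a r, ?_, ?_, ?_⟩
    · intro j
      refine Fin.cases ?_ (fun j => ?_) j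
      · exact ha ▸ (b i₀).2
      · exact hW'W (hr1 j)
    · intro j
      refine Fin.cases ?_ (fun j => ?_) j
      · exact ha0
      · exact hr2 j
    · intro i j
      refine Fin.cases ?_ (fun i => ?_) i <;> refine Fin.cases ?_ (fun j => ?_) j
      · simp
      · intro h; exact absurd h.symm (hr1 j).2.ne
      · intro h; exact absurd h (hr1 i).2.ne
      · intro h; exact congrArg Fin.succ (hr3 h)

theorem val_gap {F : Type*} [Field F] [Algebra k[X] F] [IsFractionRing k[X] F] [Algebra F M]
    [IsScalarTower k[X] F M] [FiniteDimensional F M] (ρ : M) (hρ : 1 < v ρ) :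
    v (algebraMap k[X] M X) ≤ v ρ ^ (Module.finrank F M) := by
  set ν := Module.finrank F M
  have hinj : Function.Injective (algebraMap k[X] M) := by
    rw [IsScalarTower.algebraMap_eq k[X] F M]
    exact (algebraMap F M).injective.comp (IsFractionRing.injective k[X] F)
  have hdep : ¬ LinearIndependent k[X] (fun i : Fin (ν+1) => ρ^(i:ℕ)) := by
    intro h
    have h1 := (LinearIndependent.iff_fractionRing k[X] F).mp h
    have := h1.fintype_card_le_finrank
    simp [ν] at this
  rw [Fintype.linearIndependent_iff] at hdep
  push Not at hdep
  obtain ⟨g, hg, i₀, hi₀⟩ := hdep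
  have hρ0 : ρ ≠ 0 := by rintro rfl; simp at hρ
  obtain ⟨i, -, j, -, hij, hi, hj, hv⟩ := exists_eq_val v Finset.univ _ hg i₀ (Finset.mem_univ _)
    (by
      rw [Algebra.smul_def]
      exact mul_ne_zero (by rwa [Ne, map_eq_zero_iff _ hinj]) (pow_ne_zero _ hρ0))
  have key : ∀ i j : Fin (ν+1), i < j → g i • ρ^(i:ℕ) ≠ 0 → g j • ρ^(j:ℕ) ≠ 0 →
      v (g i • ρ^(i:ℕ)) = v (g j • ρ^(j:ℕ)) → v (algebraMap k[X] M X) ≤ v ρ ^ ν := by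
    intro i j hij hi hj hv
    have hgi : g i ≠ 0 := fun h => hi (by rw [h, zero_smul])
    have hgj : g j ≠ 0 := fun h => hj (by rw [h, zero_smul])
    rw [Algebra.smul_def, Algebra.smul_def, map_mul, map_mul, val_eq v hk hx _ hgi, val_eq v hk hx _ hgj,
      map_pow, map_pow] at hv
    have hij' : (j:ℕ) = i + (j - i : ℕ) := by have : (i:ℕ) < j := hij; omega
    rw [hij', pow_add, mul_comm (v ρ ^ (i:ℕ)), ← mul_assoc] at hv
    have hvi : v ρ ^ (i:ℕ) ≠ 0 := pow_ne_zero _ (by simpa using hρ0)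
    have hv' := mul_right_cancel₀ hvi hv
    have hpos : (0:Γ₀) < v (algebraMap k[X] M X) ^ (g j).natDegree := pow_pos (zero_lt_one.trans hx) _
    have h1 : (g j).natDegree < (g i).natDegree := by
      rw [← pow_lt_pow_iff_right₀ hx, hv']
      exact lt_mul_of_one_lt_right hpos (one_lt_pow₀ hρ (by have : (i:ℕ) < j := hij; omega))
    obtain ⟨c, hc⟩ := Nat.exists_eq_add_of_lt h1
    rw [hc, add_assoc, pow_add] at hv'
    have hv'' := mul_left_cancel₀ hpos.ne' hv'
    calc v (algebraMap k[X] M X) ≤ v (algebraMap k[X] M X) ^ (c+1) := le_self_pow₀ hx.le (by omega)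
      _ = _ := hv''
      _ ≤ _ := pow_le_pow_right₀ hρ.le (by omega)
  rcases lt_or_gt_of_ne hij with h | h
  · exact key i j h hi hj hv
  · exact key j i h hj hi hv.symm

theorem val_ind {F : Type*} [Field F] [Algebra k[X] F] [IsFractionRing k[X] F] [Algebra F M]
    [IsScalarTower k[X] F M] [FiniteDimensional F M] {d a b Q' : ℕ} (r : Fin d → M)
    (hr0 : ∀ j, r j ≠ 0) (hr : Function.Injective (fun j => v (r j))) (S : Fin d → M)
    (hS1 : ∀ j, v (S j) ≤ v (algebraMap k[X] M X) ^ a)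
    (hS2 : ∀ j, S j ≠ 0 → 1 ≤ v (S j) * v (algebraMap k[X] M X) ^ b)
    (hQ' : Module.finrank F M * (a + b) < Q')
    (hsum : ∑ j, S j * (r j)^Q' = 0) : ∀ j, S j = 0 := by
  by_contra! hcon
  obtain ⟨j₀, hj₀⟩ := hcon
  obtain ⟨i, -, j, -, hij, hi, hj, hv⟩ := exists_eq_val v Finset.univ _ hsum j₀ (Finset.mem_univ _)
    (mul_ne_zero hj₀ (pow_ne_zero _ (hr0 _)))
  have key : ∀ i j, S i * (r i)^Q' ≠ 0 → S j * (r j)^Q' ≠ 0 → v (S i * (r i)^Q') = v (S j * (r j)^Q') →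
      v (r i) < v (r j) → False := by
    intro i j hi hj hv hlt
    have hSj : S j ≠ 0 := left_ne_zero_of_mul hj
    have hri : 0 < v (r i) := zero_lt_iff.mpr (by simpa using hr0 i)
    set ρ := r j / r i with hρ
    have hvρ : 1 < v ρ := by rw [hρ, map_div₀]; exact (one_lt_div₀ hri).mpr hlt
    have hrj : r j = ρ * r i := by rw [hρ, div_mul_cancel₀ _ (hr0 i)]
    rw [hrj, mul_pow, ← mul_assoc, map_mul, map_mul _ _ (r i ^ Q')] at hv
    have hv' := mul_right_cancel₀ (by rw [map_pow]; exact pow_ne_zero _ hri.ne') hv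
    rw [map_mul, map_pow] at hv'
    have hpos : (0:Γ₀) < v (algebraMap k[X] M X) := zero_lt_one.trans hx
    have h1 : v ρ ^ Q' ≤ v (algebraMap k[X] M X) ^ (a+b) := by
      calc v ρ ^ Q' = 1 * v ρ ^ Q' := (one_mul _).symm
        _ ≤ (v (S j) * v (algebraMap k[X] M X) ^ b) * v ρ ^ Q' := mul_le_mul_left (hS2 j hSj) _
        _ = (v (S j) * v ρ ^ Q') * v (algebraMap k[X] M X) ^ b := mul_right_comm _ _ _
        _ = v (S i) * v (algebraMap k[X] M X) ^ b := by rw [hv']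
        _ ≤ v (algebraMap k[X] M X) ^ a * v (algebraMap k[X] M X) ^ b := mul_le_mul_left (hS1 i) _
        _ = _ := (pow_add _ _ _).symm
    have h2 := val_gap v hk hx (F := F) ρ hvρ
    have h3 : v ρ ^ Q' ≤ v ρ ^ (Module.finrank F M * (a+b)) := by
      rw [pow_mul]; exact h1.trans (pow_le_pow_left₀ hpos.le h2 _)
    exact absurd h3 (not_le.mpr (pow_lt_pow_right₀ hvρ hQ'))
  rcases lt_or_gt_of_ne (fun h => hij (hr h)) with h | h
  · exact key i j hi hj hv h
  · exact key j i hj hi hv.symm h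
end val
end part2

section part3
set_option autoImplicit false
set_option linter.unusedSectionVars false
open Polynomial

section core
variable {k F M B G Γ₀ : Type*} [Field k] [Field M] [Field F] [CommRing B] [IsDomain B]
  [Algebra k B] [Algebra k[X] B] [IsScalarTower k k[X] B] [Algebra B M]
  [Algebra k[X] M] [Algebra k M] [IsScalarTower k k[X] M] [IsScalarTower k[X] B M] [IsScalarTower k B M]
  [Algebra k[X] F] [IsFractionRing k[X] F] [Algebra F M] [IsScalarTower k[X] F M] [FiniteDimensional F M]
  [Group G] [Fintype G] [MulSemiringAction G B] [SMulCommClass G k[X] B] [Algebra.IsInvariant k[X] B G]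
  [LinearOrderedCommGroupWithZero Γ₀] (v : Valuation M Γ₀)
  (hk : ∀ t : k, t ≠ 0 → v (algebraMap k M t) = 1) (hx : 1 < v (algebraMap k[X] M X))
  (hBM : Function.Injective (algebraMap B M))
  (hXB : Function.Injective (algebraMap k[X] B))
  (U : Submodule k B) (hU1 : (1:B) ∈ U) (hfg : U.FG) (ω Λ : ℕ) (hω : 1 ≤ ω)
  (hUx : ∀ i ≤ ω, (algebraMap k[X] B X)^i ∈ U)
  (hUG : ∀ (g : G), ∀ u ∈ U, g • u ∈ U)
  (hUv : ∀ u ∈ U, v (algebraMap B M u) ≤ v (algebraMap k[X] M X)^ω)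
  {ν : ℕ} (hν : ν = Fintype.card G) (hνF : ν = Module.finrank F M) (hν0 : 0 < ν)
  (β : Fin ν → B) (hβU : ∀ j, β j ∈ U^Λ) (hβ : LinearIndependent k[X] β)
  (htr : ∀ r : B, (∀ j, ∑ g : G, g • (r * β j) = 0) → r = 0)

include hk in
theorem valk (t : k) : v (algebraMap k M t) ≤ 1 := by
  by_cases h : t = 0
  · rw [h]; simp
  · exact (hk t h).le

include hk hUv in
theorem valU (D : ℕ) (u : B) (hu : u ∈ U^D) :
    v (algebraMap B M u) ≤ v (algebraMap k[X] M X)^(ω*D) := by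
  induction hu using Submodule.pow_induction_on_left' with
  | algebraMap r =>
    rw [← IsScalarTower.algebraMap_apply]; simpa using valk v hk r
  | add x y i hx hy h1 h2 => rw [map_add]; exact (v.map_add _ _).trans (max_le h1 h2)
  | mem_mul m hm i x hx ih =>
    rw [map_mul, map_mul, Nat.mul_succ, add_comm, pow_add]
    exact mul_le_mul' (hUv m hm) ih

include hUx in
theorem powxU (D : ℕ) : ∀ i ≤ ω*D, (algebraMap k[X] B X)^i ∈ U^D := by
  induction D with
  | zero => intro i hi; obtain rfl : i = 0 := by omega
            simp
  | succ D ih =>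
    intro i hi
    rw [Nat.mul_succ] at hi
    obtain ⟨a, b, ha, hb, rfl⟩ : ∃ a b, a ≤ ω ∧ b ≤ ω*D ∧ i = a + b :=
      ⟨min i ω, i - min i ω, by omega, by omega, by omega⟩
    rw [pow_add _ a b, pow_succ' U D]
    exact Submodule.mul_mem_mul (hUx _ ha) (ih _ hb)

include hUx hβU hβ hfg in
theorem lowerU (D : ℕ) : ν * (ω*(D-Λ)) ≤ Module.finrank k (U^D : Submodule k B) := by
  rcases Nat.lt_or_ge D Λ with h | h
  · rw [Nat.sub_eq_zero_of_le h.le]; simp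
  have : Module.Finite k (U^D : Submodule k B) := Module.Finite.iff_fg.mpr (hfg.pow D)
  have h1 : LinearIndependent k (fun i : Fin (ω*(D-Λ)) => (X:k[X])^(i:ℕ)) := by
    have := (Polynomial.basisMonomials k).linearIndependent.comp (fun i : Fin (ω*(D-Λ)) => (i:ℕ)) Fin.val_injective
    convert this using 2 with i
    simp [Polynomial.X_pow_eq_monomial]
  have h2 := linearIndependent_smul h1 hβ
  have hmem : ∀ p : Fin (ω*(D-Λ)) × Fin ν, ((X:k[X])^(p.1:ℕ)) • β p.2 ∈ U^D := by
    intro p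
    rw [Algebra.smul_def, map_pow]
    have : U^D = U^(D - Λ) * U^Λ := by rw [← pow_add]; congr 1; omega
    rw [this]
    refine Submodule.mul_mem_mul (powxU U ω hUx _ _ ?_) (hβU _)
    have := p.1.2
    omega
  have h3 : LinearIndependent k (fun p : Fin (ω*(D-Λ)) × Fin ν => (⟨_, hmem p⟩ : (U^D : Submodule k B))) :=
    LinearIndependent.of_comp (U^D).subtype h2
  have := h3.fintype_card_le_finrank
  simp at this
  linarith [mul_comm ν (ω * (D-Λ))]

include hUG in
theorem powG (D : ℕ) (g : G) : ∀ u ∈ U^D, g • u ∈ U^D := by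
  intro u hu
  have := map_pow_mem U (MulSemiringAction.toRingHom G B g) (fun t => ⟨t, by
    simp only [MulSemiringAction.toRingHom_apply]
    rw [IsScalarTower.algebraMap_apply k k[X] B, smul_algebraMap]⟩) (fun u hu => hUG g u hu) D u hu
  exact this

include hk hx hBM hUv in
theorem degU (D : ℕ) (f : k[X]) (hf : algebraMap k[X] B f ∈ U^D) : f.natDegree ≤ ω*D := by
  by_cases h0 : f = 0
  · rw [h0]; simp
  have h1 := valU v hk U ω hUv D _ hf
  rw [← IsScalarTower.algebraMap_apply, val_eq v hk hx f h0] at h1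
  exact (pow_le_pow_iff_right₀ hx).mp h1

include hk hx hBM hXB hUv hUG hβU htr in
theorem upperU (D : ℕ) : Module.finrank k (U^D : Submodule k B) ≤ ν*(ω*(D+Λ)+1) := by
  have hT : ∀ b : B, ∃ a : k[X], algebraMap k[X] B a = ∑ g : G, g • b := by
    intro b
    apply Algebra.IsInvariant.isInvariant (A := k[X]) (G := G)
    intro g
    rw [Finset.smul_sum]
    simp_rw [smul_smul]
    exact Fintype.sum_bijective (fun h => g * h) (Group.mulLeft_bijective g) _ _ (fun _ => rfl)
  choose T hT using hT
  have hTadd : ∀ a b, T (a+b) = T a + T b := fun a b => hXB (by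
    rw [map_add, hT, hT, hT]; simp [smul_add, Finset.sum_add_distrib])
  have hTsmul : ∀ (t : k) b, T (t • b) = t • T b := fun t b => hXB (by
    rw [hT, ← algebraMap_smul k[X] t b, ← algebraMap_smul k[X] t (T b), smul_eq_mul, map_mul, hT, ← Algebra.smul_def,
      Finset.smul_sum]
    exact Finset.sum_congr rfl fun g _ => smul_comm _ _ _)
  let Tl : B →ₗ[k] k[X] := { toFun := T, map_add' := hTadd, map_smul' := hTsmul }
  let N := ω*(D+Λ)+1
  let Ψ : (U^D : Submodule k B) →ₗ[k] (Fin ν → Polynomial.degreeLT k N) :=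
    LinearMap.pi fun j => LinearMap.codRestrict _
      (Tl ∘ₗ (LinearMap.mulRight k (β j)) ∘ₗ (U^D).subtype) (fun u => by
        have h1 : (u:B) * β j ∈ U^(D+Λ) := by
          rw [pow_add]; exact Submodule.mul_mem_mul u.2 (hβU j)
        have h2 : algebraMap k[X] B (T (u * β j)) ∈ U^(D+Λ) := by
          rw [hT]; exact Submodule.sum_mem _ fun g _ => powG U hUG _ g _ h1
        have h3 := degU v hk hx hBM U ω hUv _ _ h2
        rw [Polynomial.mem_degreeLT]
        refine lt_of_le_of_lt Polynomial.degree_le_natDegree ?_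
        exact_mod_cast Nat.lt_succ_of_le h3)
  have hinj : Function.Injective Ψ := by
    rw [← LinearMap.ker_eq_bot, LinearMap.ker_eq_bot']
    intro u hu
    apply Subtype.ext
    refine htr _ fun j => ?_
    have h1 : T (u * β j) = 0 := congrArg Subtype.val (congrFun hu j)
    rw [← hT, h1, map_zero]
  have := LinearMap.finrank_le_finrank_of_injective hinj
  rw [Module.finrank_pi_fintype] at this
  simpa [N, (Polynomial.degreeLTEquiv k N).finrank_eq] using this

include hUG hν hXB hU1 in
theorem normU (l : ℕ) (u : B) (hu : u ∈ U^l) (hu0 : u ≠ 0) :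
    ∃ (n : k[X]) (u' : B), n ≠ 0 ∧ u' ∈ U^(ν*l) ∧ algebraMap k[X] B n = u * u' := by
  classical
  obtain ⟨n, hn⟩ : ∃ a : k[X], algebraMap k[X] B a = ∏ g : G, g • u := by
    apply Algebra.IsInvariant.isInvariant (A := k[X]) (G := G)
    intro g
    rw [Finset.smul_prod']
    simp_rw [smul_smul]
    exact Fintype.prod_bijective (fun h => g * h) (Group.mulLeft_bijective g) _ _ (fun _ => rfl)
  have hprod : ∀ s : Finset G, (∏ g ∈ s, g • u) ∈ U^(s.card*l) := by
    intro s
    induction s using Finset.induction_on with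
    | empty => simp
    | insert a s ha ih =>
      rw [Finset.prod_insert ha, Finset.card_insert_of_notMem ha, add_mul, one_mul, add_comm, pow_add]
      exact Submodule.mul_mem_mul (powG U hUG _ _ _ hu) ih
  refine ⟨n, ∏ g ∈ Finset.univ.erase (1:G), g • u, ?_, ?_, ?_⟩
  · rintro rfl
    rw [map_zero] at hn
    obtain ⟨g, -, hg⟩ := Finset.prod_eq_zero_iff.mp hn.symm
    exact hu0 ((smul_eq_zero_iff_eq g).mp hg)
  · refine pow_mono_of_one U hU1 ?_ (hprod _)
    rw [hν, ← Finset.card_univ]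
    exact Nat.mul_le_mul_right _ (Finset.card_erase_le)
  · rw [hn, ← Finset.mul_prod_erase _ _ (Finset.mem_univ (1:G)), one_smul]

include hk hx hUG hν hXB hU1 hUv in
theorem normUv (l : ℕ) (u : B) (hu : u ∈ U^l) (hu0 : u ≠ 0) :
    1 ≤ v (algebraMap B M u) * v (algebraMap k[X] M X)^(ω*(ν*l)) := by
  obtain ⟨n, u', hn, hu', h⟩ := normU (G := G) hXB U hU1 hUG hν l u hu hu0
  calc 1 ≤ v (algebraMap k[X] M X)^n.natDegree := one_le_pow₀ hx.le
    _ = v (algebraMap k[X] M n) := (val_eq v hk hx n hn).symm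
    _ = v (algebraMap B M u) * v (algebraMap B M u') := by
      rw [IsScalarTower.algebraMap_apply k[X] B M, h, map_mul, map_mul]
    _ ≤ _ := mul_le_mul_right (valU v hk U ω hUv _ _ hu') _

include hk hx hBM hXB hU1 hfg hω hUx hUG hUv hν hνF hν0 hβU hβ htr in
theorem countU [IsAlgClosed k] (p : ℕ) [Fact p.Prime] [CharP k p] (s μ : ℕ) (hμ : μ ≤ s)
    (A : B →+* B)
    (hA : ∀ t : k, A (algebraMap k B t) = algebraMap k B (t^(p^s)))
    (hAU : ∀ u ∈ U, A u ∈ U) (l κ : ℕ) (hκ : p^μ + 1 ≤ ν*(ω*(κ-Λ)))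
    (hl : l = Λ*(p^μ+1)+κ+Λ+2) (hs : ν*(ω*l+ω*(ν*l)) < p^(s-μ))
    {ι : Type*} [Fintype ι] (P : ι → B →ₐ[k] k) (hP : ∀ i j, i ≠ j → ∃ u ∈ U, P i u ≠ P j u)
    (hPA : ∀ i b, P i (A b) = (P i b)^(p^s)) :
    Fintype.card ι ≤ ν*(ω*(l+κ*p^(s-μ)+2*Λ)+1) := by
  have : Algebra.IsAlgebraic F M := Algebra.IsAlgebraic.of_finite F M
  have : Algebra.IsAlgebraic k[X] M := by
    exact (IsFractionRing.comap_isAlgebraic_iff (A := k[X]) (K := F) (C := M)).mpr inferInstance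
  have hlow := lowerU U hfg ω Λ hUx β hβU hβ
  have hup := upperU (G := G) v hk hx hBM hXB U ω Λ hUG hUv β hβU htr
  have hfinκ : Module.Finite k (U^κ : Submodule k B) := Module.Finite.iff_fg.mpr (hfg.pow κ)
  let ι' : B →ₗ[k] M := (IsScalarTower.toAlgHom k B M).toLinearMap
  have hι' : Function.Injective ι' := hBM
  have hfr : Module.finrank k ((U^κ).map ι') = Module.finrank k (U^κ : Submodule k B) :=
    (Submodule.equivMapOfInjective ι' hι' _).finrank_eq.symm
  obtain ⟨r, hrW, hr0, hrv⟩ := exists_distinct v hk hx (p^μ+1) ((U^κ).map ι') (by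
    rw [hfr]; exact hκ.trans (hlow κ))
  choose rB hrB hrBr using hrW
  obtain ⟨f, hf0, hfU, hfP⟩ := stepS p U hfg A s μ hμ hA hAU l κ (p^μ+1) rB hrB (by
    refine lt_of_le_of_lt (hup _) (lt_of_lt_of_le ?_ (Nat.mul_le_mul_right _ (hlow l)))
    have h1 : l - Λ = Λ*(p^μ+1)+κ+2 := by omega
    rw [h1, hl, mul_assoc]
    refine Nat.mul_lt_mul_of_pos_left ?_ hν0
    generalize p^μ = H
    nlinarith [Nat.zero_le (ω*κ), Nat.zero_le (ω*H), Nat.zero_le (ω*Λ), mul_le_mul hω (le_refl H)]) (by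
    intro S hS hsum j
    have := val_ind v hk hx (F := F) (a := ω*l) (b := ω*(ν*l)) (Q' := p^(s-μ)) r hr0 hrv
      (fun j => algebraMap B M (S j)) (fun j => valU v hk U ω hUv _ _ (hS j))
      (fun j hj => normUv (G := G) v hk hx hXB U hU1 ω hUG hUv hν l _ (hS j) (fun h => hj (by simp [h])))
      (by rw [← hνF]; exact hs) (by
        have := congrArg (algebraMap B M) hsum
        rw [map_sum, map_zero] at this
        rw [← this]
        refine Finset.sum_congr rfl fun j _ => ?_
        rw [map_mul, map_pow, ← hrBr]; rfl) j
    exact hBM (by simpa using this))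
  have hZ := stepZ U hU1 hfg P hP f hf0 _ hfU (fun i => hfP _ (hPA i))
  set c := Fintype.card ι
  have h1 := hlow c
  have h2 := hup (c + (l+κ*p^(s-μ)))
  have h3 : c + ν*(ω*(c-Λ)) ≤ ν*(ω*(c + (l+κ*p^(s-μ))+Λ)+1) := by linarith
  have h4 : ν*(ω*(c+(l+κ*p^(s-μ))+Λ)+1) ≤ ν*(ω*(c-Λ)) + ν*(ω*(l+κ*p^(s-μ)+2*Λ)+1) := by
    rw [← mul_add]
    refine Nat.mul_le_mul_left _ ?_
    have : ω*(c + (l+κ*p^(s-μ))+Λ) ≤ ω*((c-Λ) + (l+κ*p^(s-μ)+2*Λ)) := Nat.mul_le_mul_left _ (by omega)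
    rw [mul_add] at this
    linarith
  omega
end core
end part3

section part4
set_option autoImplicit false
set_option linter.unusedSectionVars false
open Polynomial
open scoped Pointwise

theorem root_val {k M Γ₀ : Type*} [Field k] [Field M] [Algebra k[X] M] [Algebra k M] [IsScalarTower k k[X] M]
    [LinearOrderedCommGroupWithZero Γ₀] (v : Valuation M Γ₀)
    (hk : ∀ t : k, t ≠ 0 → v (algebraMap k M t) = 1) (hx : 1 < v (algebraMap k[X] M X))
    (E : k[X][X]) (hE : E.Monic) (ω : ℕ) (hω : ∀ i, (E.coeff i).natDegree ≤ ω)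
    (b : M) (hb : aeval b E = 0) : v b ≤ v (algebraMap k[X] M X)^ω := by
  by_contra! hlt
  have hb1 : 1 < v b := lt_of_le_of_lt (one_le_pow₀ hx.le) hlt
  rw [aeval_eq_sum_range, Finset.sum_range_succ, coeff_natDegree, hE.leadingCoeff, one_smul] at hb
  have h1 : v (∑ i ∈ Finset.range E.natDegree, E.coeff i • b^i) < v b ^ E.natDegree := by
    refine Valuation.map_sum_lt v (pow_ne_zero _ (zero_lt_one.trans hb1).ne') fun i hi => ?_
    rw [Algebra.smul_def, map_mul, map_pow]
    calc _ ≤ v (algebraMap k[X] M X)^ω * v b ^ i := mul_le_mul_left (val_le v hk hx _ _ (hω i)) _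
      _ < v b * v b ^ i := (mul_lt_mul_iff_left₀ (pow_pos (zero_lt_one.trans hb1) _)).mpr hlt
      _ = v b ^ (i+1) := (pow_succ' _ _).symm
      _ ≤ _ := pow_le_pow_right₀ hb1.le (Finset.mem_range.mp hi)
  rw [eq_neg_of_add_eq_zero_left hb, Valuation.map_neg, map_pow] at h1
  exact lt_irrefl _ h1

theorem pow_top {F M : Type*} [Field F] [Field M] [Algebra F M] [FiniteDimensional F M] (s : Set M)
    (hs : Algebra.adjoin F s = ⊤) (h1 : (1:M) ∈ s) :
    (Submodule.span F s)^(Module.finrank F M) = ⊤ := by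
  set V := Submodule.span F s with hV
  have hV1 : (1:M) ∈ V := Submodule.subset_span h1
  have hstab : ∀ i, V^i = V^(i+1) → V^i = ⊤ := by
    intro i hi
    have h : ∀ a ∈ Algebra.adjoin F s, ∀ y ∈ V^i, a * y ∈ V^i := by
      intro a ha
      induction ha using Algebra.adjoin_induction with
      | mem x hx =>
        intro y hy
        rw [hi, pow_succ']
        exact Submodule.mul_mem_mul (Submodule.subset_span hx) hy
      | algebraMap r => intro y hy; rw [← Algebra.smul_def]; exact Submodule.smul_mem _ _ hy
      | add x y _ _ hx hy => intro z hz; rw [add_mul]; exact add_mem (hx z hz) (hy z hz)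
      | mul x y _ _ hx hy => intro z hz; rw [mul_assoc]; exact hx _ (hy z hz)
    rw [eq_top_iff]
    intro m _
    have := h m (hs ▸ Algebra.mem_top) 1 (by
      have := Submodule.pow_mem_pow V hV1 i
      rwa [one_pow] at this)
    rwa [mul_one] at this
  by_contra hne
  have key : ∀ i ≤ Module.finrank F M, i + 1 ≤ Module.finrank F (V^i : Submodule F M) := by
    intro i
    induction i with
    | zero => intro _; rw [pow_zero, Submodule.one_eq_span, finrank_span_singleton one_ne_zero]
    | succ i ih =>
      intro hi
      have hlt : V^i < V^(i+1) := by
        refine lt_of_le_of_ne (pow_mono_of_one V hV1 (by omega)) fun h => hne ?_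
        exact top_le_iff.mp ((hstab i h).symm.le.trans (pow_mono_of_one V hV1 (by omega)))
      have := Submodule.finrank_lt_finrank_of_lt hlt
      have := ih (by omega)
      omega
  have h2 := key _ le_rfl
  have h3 := Submodule.finrank_le (V^(Module.finrank F M))
  omega

theorem exists_basis_pow {k F M B : Type*} [Field k] [Field F] [Field M] [CommRing B] [Algebra k B] [Algebra B M]
    [Algebra F M] [FiniteDimensional F M] (U : Submodule k B) (hU1 : (1:B) ∈ U)
    (hs : Algebra.adjoin F (algebraMap B M '' U) = ⊤) :
    ∃ β : Fin (Module.finrank F M) → B, (∀ j, β j ∈ U^(Module.finrank F M)) ∧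
      LinearIndependent F (fun j => algebraMap B M (β j)) ∧
      Submodule.span F (Set.range (fun j => algebraMap B M (β j))) = ⊤ := by
  have h := pow_top (algebraMap B M '' U) hs ⟨1, hU1, by simp⟩
  rw [Submodule.span_pow] at h
  have hsub : ∀ n, (algebraMap B M '' (U:Set B))^n ⊆ algebraMap B M '' ((U^n : Submodule k B) : Set B) := by
    intro n
    induction n with
    | zero =>
      intro y hy
      rw [pow_zero, Set.mem_one] at hy
      exact ⟨1, by rw [pow_zero]; exact Submodule.one_le.mp le_rfl, by simp [hy]⟩
    | succ n ih =>
      rw [pow_succ]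
      rintro _ ⟨a, ha, b, ⟨b', hb', rfl⟩, rfl⟩
      obtain ⟨a', ha', rfl⟩ := ih ha
      exact ⟨a'*b', by rw [pow_succ]; exact Submodule.mul_mem_mul ha' hb', by simp⟩
  set s := (algebraMap B M '' (U:Set B))^(Module.finrank F M) with hsdef
  obtain ⟨b, hbs, hsp, hli⟩ := exists_linearIndependent F s
  rw [h] at hsp
  let bas := Module.Basis.mk hli (by rw [Subtype.range_coe, hsp])
  have : Finite b := Module.Finite.finite_basis bas
  have : Fintype b := Fintype.ofFinite b
  have hcard := Module.finrank_eq_card_basis bas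
  let e : Fin (Module.finrank F M) ≃ b := (Fintype.equivFinOfCardEq hcard.symm).symm
  have hmem : ∀ j, ∃ y ∈ U^(Module.finrank F M), algebraMap B M y = (e j : M) := fun j => hsub _ (hbs (e j).2)
  choose β hβ1 hβ2 using hmem
  refine ⟨β, hβ1, ?_, ?_⟩
  · simp_rw [hβ2]
    exact hli.comp e e.injective
  · simp_rw [hβ2]
    rw [← hsp]
    congr 1
    ext y
    constructor
    · rintro ⟨j, rfl⟩; exact (e j).2
    · intro hy; exact ⟨e.symm ⟨y, hy⟩, by simp⟩

theorem extend_hom {F M M' : Type*} [Field F] [Field M] [Field M'] [Algebra F M] (g : F[X])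
    [IsSplittingField F M g] (τ : F →+* M') (h : (g.map τ).Splits) :
    ∃ φ : M →+* M', ∀ a, φ (algebraMap F M a) = τ a := by
  let _ := τ.toAlgebra
  exact ⟨(IsSplittingField.lift M g (F := M') h).toRingHom, fun a => AlgHom.commutes _ a⟩

theorem exists_place {k B : Type*} [Field k] [IsAlgClosed k] [CommRing B] [IsDomain B] [Algebra k B]
    [Algebra k[X] B] [IsScalarTower k k[X] B] [Algebra.IsIntegral k[X] B]
    (hXB : Function.Injective (algebraMap k[X] B)) (x₁ : k) :
    ∃ P : B →ₐ[k] k, ∀ f : k[X], P (algebraMap k[X] B f) = f.eval x₁ := by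
  let ev : k[X] →+* k := evalRingHom x₁
  have hev : Function.Surjective ev := fun t => ⟨C t, by simp [ev]⟩
  have hmax : (RingHom.ker ev).IsMaximal := RingHom.ker_isMaximal_of_surjective ev hev
  obtain ⟨N, hN, hNc⟩ := Ideal.exists_ideal_over_maximal_of_isIntegral (S := B) (RingHom.ker ev) (by
    rw [(RingHom.injective_iff_ker_eq_bot _).mp hXB]; exact bot_le)
  let _ : Field (B ⧸ N) := Ideal.Quotient.field N
  have hint : Algebra.IsIntegral k (B ⧸ N) := by
    constructor
    intro y
    obtain ⟨b, rfl⟩ := Ideal.Quotient.mk_surjective y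
    have hb := Algebra.IsIntegral.isIntegral (R := k[X]) b
    have key : ∀ f : k[X], Ideal.Quotient.mk N (algebraMap k[X] B f) = algebraMap k (B ⧸ N) (ev f) := by
      intro f
      have h1 : f - C (ev f) ∈ RingHom.ker ev := by simp [RingHom.mem_ker, ev]
      rw [← hNc, Ideal.mem_comap, map_sub] at h1
      rw [(Ideal.Quotient.eq).mpr h1]
      rw [← Polynomial.algebraMap_eq, ← IsScalarTower.algebraMap_apply]
      rfl
    exact hb.map_of_comp_eq ev (Ideal.Quotient.mk N) (RingHom.ext fun f => (key f).symm)
  have hbij := IsAlgClosed.algebraMap_bijective_of_isIntegral (k := k) (K := B ⧸ N)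
  let e : k ≃ₐ[k] (B ⧸ N) := AlgEquiv.ofBijective (Algebra.ofId k _) hbij
  refine ⟨e.symm.toAlgHom.comp (Ideal.Quotient.mkₐ k N), fun f => ?_⟩
  have key : Ideal.Quotient.mk N (algebraMap k[X] B f) = algebraMap k (B ⧸ N) (ev f) := by
    have h1 : f - C (ev f) ∈ RingHom.ker ev := by simp [RingHom.mem_ker, ev]
    rw [← hNc, Ideal.mem_comap, map_sub] at h1
    rw [(Ideal.Quotient.eq).mpr h1]
    rw [← Polynomial.algebraMap_eq, ← IsScalarTower.algebraMap_apply]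
    rfl
  change e.symm (Ideal.Quotient.mk N (algebraMap k[X] B f)) = _
  rw [key, AlgEquiv.symm_apply_eq]
  rfl

theorem place_trans {k B G : Type*} [Field k] [CommRing B] [IsDomain B] [Algebra k B]
    [Algebra k[X] B] [IsScalarTower k k[X] B]
    [Group G] [Finite G] [MulSemiringAction G B] [SMulCommClass G k[X] B] [Algebra.IsInvariant k[X] B G]
    (P P' : B →ₐ[k] k) (h : ∀ f : k[X], P (algebraMap k[X] B f) = P' (algebraMap k[X] B f)) :
    ∃ g : G, ∀ b, P' b = P (g • b) := by
  have hp : (RingHom.ker P).IsPrime := RingHom.ker_isPrime _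
  have hp' : (RingHom.ker P').IsPrime := RingHom.ker_isPrime _
  obtain ⟨g, hg⟩ := Algebra.IsInvariant.exists_smul_of_under_eq k[X] B G (RingHom.ker P) (RingHom.ker P') (by
    ext f
    simp only [Ideal.under, Ideal.mem_comap, RingHom.mem_ker]
    rw [h])
  refine ⟨g⁻¹, fun b => ?_⟩
  have h1 : b - algebraMap k B (P' b) ∈ RingHom.ker P' := by simp [RingHom.mem_ker]
  rw [hg, Ideal.mem_pointwise_smul_iff_inv_smul_mem, RingHom.mem_ker, smul_sub, map_sub,
    IsScalarTower.algebraMap_apply k k[X] B, smul_algebraMap, ← IsScalarTower.algebraMap_apply, AlgHom.commutes] at h1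
  exact (sub_eq_zero.mp h1).symm
end part4

section part5
set_option autoImplicit false
set_option linter.unusedSectionVars false
open Polynomial

theorem numW (p : ℕ) (hp : p.Prime) (ν ω m s0 : ℕ) (hν : 0 < ν) (hω : 1 ≤ ω) :
    ∃ Q0, ∀ s, Q0 ≤ p^s → ∃ μ κ l, μ ≤ s ∧ p^μ+1 ≤ ν*(ω*(κ-ν)) ∧ l = ν*(p^μ+1)+κ+ν+2 ∧
      ν*(ω*l+ω*(ν*l)) < p^(s-μ) ∧
      (ν-1)*(ν*(ω*(l+κ*p^(s-μ)+2*ν)+1)) + ν*(s0+ω*(m+ν*m)) < ν*p^s := by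
  set a := ν*ω with ha
  have ha0 : 0 < a := Nat.mul_pos hν hω
  set C := a*ν+a+1 with hC
  set μ := ν*C+1 with hμ
  set H := p^μ with hH
  have hHμ : ν*C+1 < H := Nat.lt_pow_self hp.one_lt
  set κ := ν + ((H+1)/a+1) with hκ
  set l := ν*(H+1)+κ+ν+2 with hl
  set D0 := a*l + 2*a*ν + ν with hD0
  set D1 := ν*(s0+ω*(m+ν*m)) with hD1
  refine ⟨H*((ν-1)*D0 + D1 + ν*(ω*l+ω*(ν*l)) + 1), fun s hs => ⟨μ, κ, l, ?_, ?_, hl, ?_, ?_⟩⟩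
  · refine (Nat.pow_le_pow_iff_right hp.one_lt).mp ?_
    calc p^μ = H*1 := by simp [hH]
      _ ≤ _ := Nat.mul_le_mul_left _ (by omega)
      _ ≤ _ := hs
  all_goals
    have hμs : μ ≤ s := by
      refine (Nat.pow_le_pow_iff_right hp.one_lt).mp ?_
      calc p^μ = H*1 := by simp [hH]
        _ ≤ _ := Nat.mul_le_mul_left _ (by omega)
        _ ≤ _ := hs
    have hsp : p^s = H * p^(s-μ) := by rw [hH, ← pow_add]; congr 1; omega
    have hR := Nat.le_of_mul_le_mul_left (hsp ▸ hs) (by omega : 0 < H)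
    have hdm := Nat.div_add_mod (H+1) a
    have hml := Nat.mod_lt (H+1) ha0
  · rw [← mul_assoc, ← ha]
    have : κ - ν = (H+1)/a+1 := by rw [hκ]; exact Nat.add_sub_cancel_left _ _
    rw [this, mul_add, mul_one]; omega
  · omega
  · rw [hsp]
    set R := p^(s-μ)
    have h1 : ν*(ω*κ) ≤ H + C := by
      rw [← mul_assoc, ← ha, hκ, mul_add, mul_add, mul_one, hC]; omega
    have h2 : ν*(ω*(l+κ*R+2*ν)+1) ≤ D0 + (H+C)*R := by
      have := Nat.mul_le_mul_right R h1
      calc _ = D0 + ν*(ω*κ)*R := by rw [hD0, ha]; ring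
        _ ≤ _ := by omega
    have h3 : (ν-1)*(ν*(ω*(l+κ*R+2*ν)+1)) ≤ (ν-1)*(D0 + (H+C)*R) := Nat.mul_le_mul_left _ h2
    obtain ⟨ν', rfl⟩ : ∃ ν', ν = ν'+1 := ⟨ν-1, by omega⟩
    simp only [Nat.add_sub_cancel] at *
    have h4 : (ν'*C+1)*R ≤ H*R := Nat.mul_le_mul_right _ (by nlinarith)
    have e1 : ν'*(D0+(H+C)*R) = ν'*D0+ν'*(H*R)+ν'*C*R := by ring
    have e2 : (ν'+1)*(H*R) = ν'*(H*R)+H*R := by ring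
    have e3 : (ν'*C+1)*R = ν'*C*R+R := by ring
    rw [e1] at h3
    rw [e3] at h4
    rw [e2]
    clear_value D0 D1 R H C l κ a μ
    clear hs hsp h2 h1 hD0 hD1 hl hκ hHμ hμ hC e1 e2 e3 hml hdm
    omega

theorem fixedCard (k : Type*) [Field k] [IsAlgClosed k] (p : ℕ) (hp : p.Prime) [CharP k p] (s : ℕ) (hs : s ≠ 0) :
    ∃ T : Finset k, T.card = p^s ∧ ∀ x, x ∈ T ↔ x^(p^s) = x := by
  classical
  have hsep : (X^(p^s) - X : k[X]).Separable := galois_poly_separable p _ (dvd_pow_self p hs)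
  have h1 : 1 < p^s := Nat.one_lt_pow hs hp.one_lt
  have h0 : (X^(p^s) - X : k[X]) ≠ 0 := FiniteField.X_pow_card_sub_X_ne_zero k h1
  refine ⟨(X^(p^s) - X : k[X]).roots.toFinset, ?_, ?_⟩
  · rw [Multiset.toFinset_card_of_nodup (nodup_roots hsep),
      ← (IsAlgClosed.splits (X^(p^s) - X : k[X])).natDegree_eq_card_roots, FiniteField.X_pow_card_sub_X_natDegree_eq k h1]
  · intro x
    rw [Multiset.mem_toFinset, mem_roots h0]
    simp [sub_eq_zero]

section core
variable {k F M B G Γ₀ : Type*} [Field k] [Field M] [Field F] [CommRing B] [IsDomain B]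
  [Algebra k B] [Algebra k[X] B] [IsScalarTower k k[X] B] [Algebra B M]
  [Algebra k[X] M] [Algebra k M] [IsScalarTower k k[X] M] [IsScalarTower k[X] B M] [IsScalarTower k B M]
  [Algebra k[X] F] [IsFractionRing k[X] F] [Algebra F M] [IsScalarTower k[X] F M] [FiniteDimensional F M]
  [Group G] [Fintype G] [MulSemiringAction G B] [SMulCommClass G k[X] B] [Algebra.IsInvariant k[X] B G]
  [LinearOrderedCommGroupWithZero Γ₀] (v : Valuation M Γ₀)
  (hk : ∀ t : k, t ≠ 0 → v (algebraMap k M t) = 1) (hx : 1 < v (algebraMap k[X] M X))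
  (hBM : Function.Injective (algebraMap B M))
  (hXB : Function.Injective (algebraMap k[X] B))
  (U : Submodule k B) (hU1 : (1:B) ∈ U) (hfg : U.FG) (ω Λ : ℕ) (hω : 1 ≤ ω)
  (hUx : ∀ i ≤ ω, (algebraMap k[X] B X)^i ∈ U)
  (hUG : ∀ (g : G), ∀ u ∈ U, g • u ∈ U)
  (hUv : ∀ u ∈ U, v (algebraMap B M u) ≤ v (algebraMap k[X] M X)^ω)
  {ν : ℕ} (hν : ν = Fintype.card G) (hνF : ν = Module.finrank F M) (hν0 : 0 < ν)
  (β : Fin ν → B) (hβU : ∀ j, β j ∈ U^Λ) (hβ : LinearIndependent k[X] β)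
  (htr : ∀ r : B, (∀ j, ∑ g : G, g • (r * β j) = 0) → r = 0)

include hk hx hBM hXB hU1 hUG hUv hν in
theorem disc (R : Finset B) (hRU : ∀ b ∈ R, b ∈ U) (m : ℕ) (hm : R.offDiag.card ≤ m) :
    ∃ n : k[X], n ≠ 0 ∧ n.natDegree ≤ ω*(m+ν*m) ∧ ∀ (x₁ : k) (P : B →ₐ[k] k),
      (∀ f : k[X], P (algebraMap k[X] B f) = f.eval x₁) → n.eval x₁ ≠ 0 →
      ∀ b ∈ R, ∀ b' ∈ R, P b = P b' → b = b' := by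
  classical
  have hprod : ∀ s : Finset (B×B), (∀ y ∈ s, y.1 ∈ U ∧ y.2 ∈ U) → (∏ y ∈ s, (y.1-y.2)) ∈ U^s.card := by
    intro s
    induction s using Finset.induction_on with
    | empty => intro; simp only [Finset.prod_empty, Finset.card_empty, pow_zero]; exact Submodule.one_le.mp le_rfl
    | insert a s ha ih =>
      intro h
      rw [Finset.prod_insert ha, Finset.card_insert_of_notMem ha, add_comm, pow_add, pow_one]
      refine Submodule.mul_mem_mul ?_ (ih fun y hy => h y (Finset.mem_insert_of_mem hy))
      have := h a (Finset.mem_insert_self _ _)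
      exact U.sub_mem this.1 this.2
  have h1 := pow_mono_of_one U hU1 hm (hprod R.offDiag (fun y hy => by
    rw [Finset.mem_offDiag] at hy; exact ⟨hRU _ hy.1, hRU _ hy.2.1⟩))
  have h0 : (∏ y ∈ R.offDiag, (y.1-y.2)) ≠ 0 := by
    refine Finset.prod_ne_zero_iff.mpr fun y hy => ?_
    rw [Finset.mem_offDiag] at hy
    exact sub_ne_zero.mpr hy.2.2
  obtain ⟨n, u', hn, hu', h⟩ := normU (G := G) hXB U hU1 hUG hν m _ h1 h0
  refine ⟨n, hn, ?_, ?_⟩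
  · apply degU v hk hx hBM U ω hUv
    rw [h, pow_add]
    exact Submodule.mul_mem_mul h1 hu'
  · intro x₁ P hP hne b hb b' hb' hbb
    by_contra hne'
    apply hne
    rw [← hP, h, map_mul, map_prod, Finset.prod_eq_zero (i := (b,b')), zero_mul]
    · simp [hb, hb', hne']
    · simp [hbb]

include hk hx hBM hXB hU1 hfg hω hUx hUG hUv hν hνF hν0 hβU hβ htr in
theorem goodplace [IsAlgClosed k] [Algebra.IsIntegral k[X] B] (p : ℕ) [Fact p.Prime] [CharP k p] (s μ : ℕ) (hμ : μ ≤ s)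
    (φ : B →+* B)
    (hφ : ∀ t : k, φ (algebraMap k B t) = algebraMap k B (t^(p^s)))
    (hφx : φ (algebraMap k[X] B X) = algebraMap k[X] B X)
    (hφU : ∀ u ∈ U, φ u ∈ U) (l κ : ℕ) (hκ : p^μ + 1 ≤ ν*(ω*(κ-Λ)))
    (hl : l = Λ*(p^μ+1)+κ+Λ+2) (hs : ν*(ω*l+ω*(ν*l)) < p^(s-μ))
    (R : Finset B) (hRU : ∀ b ∈ R, b ∈ U) (m : ℕ) (hm : R.offDiag.card ≤ m)
    (hRG : ∀ (g : G), ∀ b ∈ R, g • b ∈ R) (hRf : ∀ g : G, (∀ b ∈ R, g • b = b) → g = 1)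
    (S : Finset k) (s0 : ℕ) (hS : S.card ≤ s0) 
    (hnum : (ν-1)*(ν*(ω*(l+κ*p^(s-μ)+2*Λ)+1)) + ν*(s0+ω*(m+ν*m)) < ν*p^s)
    (γ : G) : 
    ∃ (x₁ : k) (P : B →ₐ[k] k), x₁ ∉ S ∧ x₁^(p^s) = x₁ ∧ (∀ f : k[X], P (algebraMap k[X] B f) = f.eval x₁) ∧
      (∀ b ∈ R, ∀ b' ∈ R, P b = P b' → b = b') ∧ ∀ b, P (φ (γ • b)) = (P b)^(p^s) := by
  classical
  by_contra! hcon
  obtain ⟨n, hn0, hnd, hnP⟩ := disc (G := G) v hk hx hBM hXB U hU1 ω hUG hUv hν R hRU m hm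
  have hp : p.Prime := Fact.out
  have hs0 : s ≠ 0 := by
    rintro rfl
    have : μ = 0 := by omega
    subst this
    simp only [Nat.sub_self, pow_zero, Nat.lt_one_iff] at hs
    have h1 : 0 < ν*(ω*l) := Nat.mul_pos hν0 (Nat.mul_pos hω (by omega))
    rw [mul_add] at hs; omega
  obtain ⟨T, hT, hTm⟩ := fixedCard k p hp s hs0
  set Gd := (T \ S) \ n.roots.toFinset with hGd
  have hGdm : ∀ x ∈ Gd, x ∉ S ∧ x^(p^s) = x ∧ n.eval x ≠ 0 := by
    intro x hx'
    simp only [hGd, Finset.mem_sdiff, Multiset.mem_toFinset, mem_roots hn0, hTm, IsRoot.def] at hx'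
    exact ⟨hx'.1.2, hx'.1.1, hx'.2⟩
  have hGdc : p^s ≤ Gd.card + (s0 + ω*(m+ν*m)) := by
    have h1 := Finset.le_card_sdiff S T
    have h2 := Finset.le_card_sdiff n.roots.toFinset (T \ S)
    have h3 := (Multiset.toFinset_card_le n.roots).trans (card_roots' n)
    rw [← hGd] at h2
    omega
  choose Pl hPl using exists_place (B := B) hXB
  let PP : k → G → (B →ₐ[k] k) := fun x g =>
    (Pl x).comp ((MulSemiringAction.toAlgHom k[X] B g).restrictScalars k)
  have hPP : ∀ x g b, PP x g b = Pl x (g • b) := fun _ _ _ => rfl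
  have hPPf : ∀ x g f, PP x g (algebraMap k[X] B f) = f.eval x := by
    intro x g f
    rw [hPP, smul_algebraMap, hPl]
  have hδ : ∀ x ∈ Gd, ∀ g, ∃ δ : G, ∀ b, PP x g (φ (δ • b)) = (PP x g b)^(p^s) := by
    intro x hxG g
    have hx1 := (hGdm x hxG).2.1
    have : ExpChar k p := ExpChar.prime hp
    have : PerfectRing k p := inferInstance
    let e := iterateFrobeniusEquiv k p s
    have he : ∀ y, e y = y^(p^s) := fun y => iterateFrobeniusEquiv_def k p s y
    let P' : B →ₐ[k] k :=
      { (e.symm : k →+* k).comp (((PP x g) : B →+* k).comp φ) with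
        commutes' := by
          intro t
          change e.symm (PP x g (φ (algebraMap k B t))) = _
          rw [hφ, AlgHom.commutes, RingEquiv.symm_apply_eq, he]; rfl }
    have hP' : ∀ b, (P' b)^(p^s) = PP x g (φ b) := by
      intro b
      rw [← he]
      exact e.apply_symm_apply _
    obtain ⟨δ, h⟩ := place_trans (G := G) P' (PP x g) (by
      have h2 : P'.comp (IsScalarTower.toAlgHom k k[X] B) = (PP x g).comp (IsScalarTower.toAlgHom k k[X] B) := by
        apply Polynomial.algHom_ext
        change P' (algebraMap k[X] B X) = PP x g (algebraMap k[X] B X)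
        apply e.injective
        rw [he, hP', hφx, he, hPPf, eval_X, hx1]
      intro f
      exact DFunLike.congr_fun h2 f)
    exact ⟨δ, fun b => by rw [h b, hP']⟩
  let ι := Gd × G
  have hδ' : ∀ i : ι, ∃ δ : G, ∀ b, PP i.1 i.2 (φ (δ • b)) = (PP i.1 i.2 b)^(p^s) := fun i => hδ i.1 i.1.2 i.2
  choose δ hδ2 using hδ'
  have hinjR : ∀ x ∈ Gd, ∀ g, ∀ b ∈ R, ∀ b' ∈ R, PP x g b = PP x g b' → b = b' := by
    intro x hx' g
    exact hnP x (PP x g) (hPPf x g) (hGdm x hx').2.2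
  have hγ : ∀ i, δ i ≠ γ := by
    intro i hi
    obtain ⟨b, hb⟩ := hcon i.1 (PP i.1 i.2) (hGdm _ i.1.2).1 (hGdm _ i.1.2).2.1 (hPPf _ _) (hinjR _ i.1.2 _)
    exact hb (hi ▸ hδ2 i b)
  have hbound : ∀ d : G, (Finset.univ.filter (fun i : ι => δ i = d)).card ≤ ν*(ω*(l+κ*p^(s-μ)+2*Λ)+1) := by
    intro d
    rw [← Fintype.card_subtype]
    refine countU (G := G) v hk hx hBM hXB U hU1 hfg ω Λ hω hUx hUG hUv hν hνF hν0 β hβU hβ htr p s μ hμ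
      (φ.comp (MulSemiringAction.toRingHom G B d)) ?_ ?_ l κ hκ hl hs (fun i : {i : ι // δ i = d} => PP i.1.1 i.1.2) ?_ ?_
    · intro t
      change φ (d • algebraMap k B t) = _
      rw [IsScalarTower.algebraMap_apply k k[X] B, smul_algebraMap, ← IsScalarTower.algebraMap_apply, hφ]
    · intro u hu
      exact hφU _ (hUG d u hu)
    · rintro ⟨⟨⟨x, hxG⟩, g⟩, hi⟩ ⟨⟨⟨x', hxG'⟩, g'⟩, hj⟩ hne
      by_cases hxx : x = x'
      · subst hxx
        have hgg : g ≠ g' := by rintro rfl; exact hne rfl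
        by_contra! hall
        apply hgg
        have := hRf (g⁻¹ * g') (by
          intro b hb
          rw [mul_smul, inv_smul_eq_iff]
          have h1 := hall b (hRU b hb)
          simp only [hPP] at h1
          have h2 := hinjR x hxG 1 _ (hRG g b hb) _ (hRG g' b hb) (by rw [hPP, hPP, one_smul, one_smul, h1])
          exact h2.symm)
        exact inv_mul_eq_one.mp this
      · refine ⟨algebraMap k[X] B X, by simpa using hUx 1 hω, ?_⟩
        simp only [hPPf, eval_X]
        exact hxx
    · rintro ⟨i, rfl⟩ b
      exact hδ2 i b
  have hsum : Fintype.card ι ≤ (ν-1)*(ν*(ω*(l+κ*p^(s-μ)+2*Λ)+1)) := by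
    have h1 := Finset.card_eq_sum_card_fiberwise (s := (Finset.univ : Finset ι)) (t := Finset.univ.erase γ) (f := δ) (by
      intro i _; simp [hγ i])
    rw [← Finset.card_univ, h1]
    refine (Finset.sum_le_card_nsmul _ _ _ fun d _ => hbound d).trans ?_
    rw [Finset.card_erase_of_mem (Finset.mem_univ _), Finset.card_univ, ← hν, smul_eq_mul]
  have hc : Fintype.card ι = Gd.card * ν := by
    rw [Fintype.card_prod, Fintype.card_coe, hν]
  have := Nat.mul_le_mul_left ν hGdc
  rw [hc] at hsum
  nlinarith
end core
end part5

section part6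
set_option autoImplicit false
set_option linter.unusedSectionVars false
open Polynomial

section W
variable {k F M : Type*} [Field k] [Field F] [Field M] [Algebra k[X] F] [IsFractionRing k[X] F] [Algebra F M]
  [Algebra k[X] M] [Algebra k M] [IsScalarTower k k[X] M] [IsScalarTower k[X] F M]

theorem inv_galois [FiniteDimensional F M] [IsGalois F M] :
    Algebra.IsInvariant k[X] (integralClosure k[X] M) (M ≃ₐ[F] M) := by
  have h := ((IsGalois.tfae (F := F) (E := M)).out 0 1).mp ‹IsGalois F M›
  refine ⟨fun b hb ↦ ?_⟩
  replace hb : (b:M) ∈ IntermediateField.fixedField (⊤ : Subgroup (M ≃ₐ[F] M)) := by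
    rintro ⟨g, -⟩
    exact congrArg Subtype.val (hb g)
  rw [h, IntermediateField.mem_bot] at hb
  obtain ⟨y, hy⟩ := hb
  have hb : IsIntegral k[X] (b:M) := b.2
  rw [← hy, isIntegral_algebraMap_iff (FaithfulSMul.algebraMap_injective F M)] at hb
  obtain ⟨a, rfl⟩ := IsIntegrallyClosed.algebraMap_eq_of_integral hb
  refine ⟨a, Subtype.ext ?_⟩
  rw [← hy, ← IsScalarTower.algebraMap_apply]; rfl

theorem conj_frob [FiniteDimensional F M] [IsGalois F M] (EF : F[X]) (hE0 : EF ≠ 0) (e : F ≃+* F) (he : EF.map (e : F →+* F) = EF)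
    (φ : M →+* M) (hφ : ∀ a, φ (algebraMap F M a) = algebraMap F M (e a)) (g : F[X]) (hg : Irreducible g) (hgE : g ∣ EF)
    (hN : EF.natDegree < 2 * g.natDegree) (b : M) (hb : aeval b g = 0) : ∃ σ : M ≃ₐ[F] M, σ (φ b) = b := by
  suffices IsConjRoot F b (φ b) from isConjRoot_iff_exists_algEquiv.mp this
  have hg2 : Irreducible (g.map (e : F →+* F)) := (MulEquiv.irreducible_iff (mapEquiv e).toMulEquiv).mpr hg
  have hd : (g.map (e : F →+* F)).natDegree = g.natDegree := natDegree_map _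
  have hb2 : aeval (φ b) (g.map (e : F →+* F)) = 0 := by
    rw [aeval_def, eval₂_map]
    have : (algebraMap F M).comp (e : F →+* F) = φ.comp (algebraMap F M) := by
      ext a; exact (hφ a).symm
    rw [this, ← hom_eval₂, ← aeval_def, hb, map_zero]
  have hgE2 : g.map (e : F →+* F) ∣ EF := by
    rw [← he]; exact Polynomial.map_dvd _ hgE
  have ha : Associated g (g.map (e : F →+* F)) := by
    by_contra hna
    have hcop : IsCoprime g (g.map (e : F →+* F)) := by
      refine (Irreducible.coprime_iff_not_dvd hg).mpr fun h => hna ?_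
      exact hg.associated_of_dvd hg2 h
    have := natDegree_le_of_dvd (hcop.mul_dvd hgE hgE2) hE0
    rw [natDegree_mul hg.ne_zero hg2.ne_zero, hd] at this
    omega
  have h1 := minpoly.eq_of_irreducible hg hb
  have hb3 : aeval (φ b) g = 0 := by
    obtain ⟨y, hy⟩ := ha.symm.dvd
    rw [hy, map_mul, hb2, zero_mul]
  have h2 := minpoly.eq_of_irreducible hg hb3
  rw [IsConjRoot, ← h1, ← h2]

theorem thmW_core [IsAlgClosed k] (p : ℕ) [Fact p.Prime] [CharP k p] (N ω s0 : ℕ) (hω : 1 ≤ ω) (s : ℕ)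
    (E : k[X][X]) (hEm : E.Monic) (hEN : E.natDegree = N) (hEω : ∀ i, (E.coeff i).natDegree ≤ ω)
    (hsep : (E.map (algebraMap k[X] F)).Separable)
    (hEs : E.map (mapRingHom (iterateFrobenius k p s)) = E)
    [hSF : IsSplittingField F M (E.map (algebraMap k[X] F))]
    (hnum : ∀ ν, 0 < ν → ν ≤ N.factorial → ∃ μ κ l, μ ≤ s ∧ p^μ+1 ≤ ν*(ω*(κ-ν)) ∧ l = ν*(p^μ+1)+κ+ν+2 ∧
      ν*(ω*l+ω*(ν*l)) < p^(s-μ) ∧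
      (ν-1)*(ν*(ω*(l+κ*p^(s-μ)+2*ν)+1)) + ν*(s0+ω*(N*N+ν*(N*N))) < ν*p^s)
    (g : F[X]) (hg : Irreducible g) (hgE : g ∣ E.map (algebraMap k[X] F)) (hgN : N < 2 * g.natDegree)
    (hg2 : 2 ≤ g.natDegree) (S : Finset k) (hS : S.card ≤ s0) :
    ∃ x₁ ∉ S, ∃ X₁, x₁^(p^s) = x₁ ∧ X₁^(p^s) = X₁ ∧ eval X₁ (E.map (evalRingHom x₁)) = 0 ∧
      ∀ ρ : k[X], eval ρ E = 0 → eval x₁ ρ ≠ X₁ := by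
  classical
  have hp : p.Prime := Fact.out
  have : ExpChar k p := ExpChar.prime hp
  set EF := E.map (algebraMap k[X] F) with hEF
  have hEF0 : EF ≠ 0 := hsep.ne_zero
  have hEFN : EF.natDegree = N := by rw [hEF, hEm.natDegree_map, hEN]
  have hfin : FiniteDimensional F M := IsSplittingField.finiteDimensional M EF
  have hgal : IsGalois F M := IsGalois.of_separable_splitting_field hsep
  have hinv := inv_galois (k := k) (F := F) (M := M)
  have hXF : Function.Injective (algebraMap k[X] F) := IsFractionRing.injective k[X] F
  have hXM : Function.Injective (algebraMap k[X] M) := by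
    rw [IsScalarTower.algebraMap_eq k[X] F M]
    exact (algebraMap F M).injective.comp hXF
  set B := integralClosure k[X] M
  have hBM : Function.Injective (algebraMap B M) := Subtype.val_injective
  have hXB : Function.Injective (algebraMap k[X] B) := by
    intro a b hab
    exact hXM (congrArg Subtype.val hab)
  have : Module.IsTorsionFree k[X] B := (Module.isTorsionFree_iff_algebraMap_injective).mpr hXB
  obtain ⟨V, hk, hx⟩ := exists_val k M hXM
  set v := V.valuation
  set R : Finset B := (E.aroots B).toFinset with hR
  have hRm : ∀ b : B, b ∈ R ↔ aeval (b:M) E = 0 := by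
    intro b
    rw [hR, Multiset.mem_toFinset, mem_aroots]
    have : aeval (b:M) E = ((aeval b E : B) : M) := by
      rw [← Subalgebra.coe_val, Polynomial.aeval_algHom_apply]
    rw [this]
    simp [hEm.ne_zero]
  have hRc : R.card ≤ N := by
    rw [hR, ← hEN]
    refine (Multiset.toFinset_card_le _).trans ((card_roots' _).trans (natDegree_map_le))
  have hint : ∀ y : M, aeval y E = 0 → y ∈ B := fun y hy => ⟨E, hEm, hy⟩
  have haevF : ∀ y : M, aeval y EF = aeval y E := fun y => by rw [hEF, aeval_map_algebraMap]
  have hRG : ∀ (σ : M ≃ₐ[F] M), ∀ b ∈ R, σ • b ∈ R := by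
    intro σ b hb
    rw [hRm] at hb ⊢
    change aeval (σ (b:M)) E = 0
    rw [← haevF] at hb ⊢
    rw [← AlgEquiv.coe_toAlgHom, Polynomial.aeval_algHom_apply, hb, map_zero]
  have hadj := IsSplittingField.adjoin_rootSet M EF
  have hrs : EF.rootSet M ⊆ algebraMap B M '' R := by
    intro y hy
    have hy0 := (mem_rootSet.mp hy).2
    rw [haevF] at hy0
    exact ⟨⟨y, hint y hy0⟩, (hRm _).mpr hy0, rfl⟩
  have hRf : ∀ σ : M ≃ₐ[F] M, (∀ b ∈ R, σ • b = b) → σ = 1 := by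
    intro σ hσ
    have : (σ : M →ₐ[F] M) = AlgHom.id F M := by
      apply AlgHom.ext_of_adjoin_eq_top hadj
      intro y hy
      obtain ⟨b, hb, rfl⟩ := hrs hy
      exact congrArg Subtype.val (hσ b hb)
    ext y
    exact DFunLike.congr_fun this y
  set ν := Fintype.card (M ≃ₐ[F] M) with hν
  have hν0 : 0 < ν := Fintype.card_pos
  have hνF : ν = Module.finrank F M := by rw [hν, ← IsGalois.card_aut_eq_finrank F M, Nat.card_eq_fintype_card]
  have hνN : ν ≤ N.factorial := by
    let Φ : (M ≃ₐ[F] M) → Equiv.Perm R := fun σ =>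
      { toFun := fun b => ⟨σ • b.1, hRG σ _ b.2⟩
        invFun := fun b => ⟨σ⁻¹ • b.1, hRG _ _ b.2⟩
        left_inv := fun b => Subtype.ext (inv_smul_smul _ _)
        right_inv := fun b => Subtype.ext (smul_inv_smul _ _) }
    have hΦ : Function.Injective Φ := by
      intro σ τ h
      have := hRf (σ⁻¹ * τ) (by
        intro b hb
        rw [mul_smul, inv_smul_eq_iff]
        have := DFunLike.congr_fun h ⟨b, hb⟩
        exact (congrArg Subtype.val this).symm)
      exact inv_mul_eq_one.mp this
    have := Fintype.card_le_of_injective Φ hΦ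
    rw [Fintype.card_perm, Fintype.card_coe] at this
    exact this.trans (Nat.factorial_le hRc)
  obtain ⟨μ, κ, l, hμ, hκ, hl, hs, hnum'⟩ := hnum ν hν0 hνN
  set xB : B := algebraMap k[X] B X with hxB
  set gen : Set B := ((fun i => xB^i) '' {i | i ≤ ω}) ∪ R with hgen
  set U := Submodule.span k gen with hU
  have hgenfin : gen.Finite := ((Set.finite_le_nat ω).image _).union R.finite_toSet
  have hfg : U.FG := Submodule.fg_span hgenfin
  have hUx : ∀ i ≤ ω, xB^i ∈ U := fun i hi => Submodule.subset_span (Or.inl ⟨i, hi, rfl⟩)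
  have hU1 : (1:B) ∈ U := by simpa using hUx 0 (Nat.zero_le _)
  have hRU : ∀ b ∈ R, b ∈ U := fun b hb => Submodule.subset_span (Or.inr hb)
  have hkX : ∀ (σ : M ≃ₐ[F] M) (t : k), σ • (algebraMap k B t) = algebraMap k B t := by
    intro σ t
    rw [IsScalarTower.algebraMap_apply k k[X] B, smul_algebraMap]
  have hUG : ∀ (σ : M ≃ₐ[F] M), ∀ u ∈ U, σ • u ∈ U := by
    intro σ u hu
    induction hu using Submodule.span_induction with
    | mem u hu =>
      rcases hu with ⟨i, hi, rfl⟩ | hu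
      · simp only [smul_pow', hxB, smul_algebraMap]
        exact hUx i hi
      · exact hRU _ (hRG σ u hu)
    | zero => rw [smul_zero]; exact U.zero_mem
    | add a b _ _ ha hb => rw [smul_add]; exact U.add_mem ha hb
    | smul t a _ ha =>
      rw [Algebra.smul_def, smul_mul', hkX, ← Algebra.smul_def]
      exact U.smul_mem _ ha
  have hUv : ∀ u ∈ U, v (algebraMap B M u) ≤ v (algebraMap k[X] M X)^ω := by
    intro u hu
    induction hu using Submodule.span_induction with
    | mem u hu =>
      rcases hu with ⟨i, hi, rfl⟩ | hu
      · simp only [map_pow, hxB, ← IsScalarTower.algebraMap_apply]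
        exact pow_le_pow_right₀ hx.le hi
      · exact root_val v hk hx E hEm ω hEω _ ((hRm u).mp hu)
    | zero => simp
    | add a b _ _ ha hb => rw [map_add]; exact (v.map_add _ _).trans (max_le ha hb)
    | smul t a _ ha =>
      rw [Algebra.smul_def, map_mul, map_mul, ← IsScalarTower.algebraMap_apply]
      exact (mul_le_mul' (valk v hk t) ha).trans (by rw [one_mul])
  have hUadj : Algebra.adjoin F (algebraMap B M '' U) = ⊤ := by
    rw [eq_top_iff, ← hadj]
    exact Algebra.adjoin_mono (hrs.trans (Set.image_mono hRU))
  have hbas := exists_basis_pow (F := F) U hU1 hUadj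
  rw [← hνF] at hbas
  obtain ⟨β, hβU, hβ, hβs⟩ := hbas
  have hβ' : LinearIndependent k[X] β := by
    have h1 := (LinearIndependent.iff_fractionRing k[X] F).mpr hβ
    exact LinearIndependent.of_comp B.val.toLinearMap h1
  have htr : ∀ r : B, (∀ j, ∑ σ : M ≃ₐ[F] M, σ • (r * β j) = 0) → r = 0 := by
    intro r hr
    apply hBM
    rw [map_zero]
    refine (traceForm_nondegenerate F M).1 _ fun y => ?_
    have hy : y ∈ Submodule.span F (Set.range (fun j => algebraMap B M (β j))) := by rw [hβs]; trivial
    induction hy using Submodule.span_induction with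
    | mem y hy =>
      obtain ⟨j, rfl⟩ := hy
      apply (algebraMap F M).injective
      rw [Algebra.traceForm_apply, trace_eq_sum_automorphisms, map_zero]
      have := congrArg (algebraMap B M) (hr j)
      rw [map_sum, map_zero] at this
      exact this
    | zero => simp
    | add a b _ _ ha hb => rw [map_add, ha, hb, add_zero]
    | smul t a _ ha => rw [map_smul, ha, smul_zero]
  -- Frobenius
  let fr := iterateFrobeniusEquiv k p s
  have hfr : ∀ y, fr y = y^(p^s) := fun y => iterateFrobeniusEquiv_def k p s y
  have hfr' : (fr : k →+* k) = iterateFrobenius k p s := by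
    ext y; exact (hfr y).trans (iterateFrobenius_def p s y).symm
  let e : F ≃+* F := IsFractionRing.ringEquivOfRingEquiv (mapEquiv fr)
  have he : ∀ f : k[X], e (algebraMap k[X] F f) = algebraMap k[X] F (f.map (iterateFrobenius k p s)) := by
    intro f
    rw [← hfr']
    exact IsFractionRing.ringEquivOfRingEquiv_algebraMap (mapEquiv fr) f
  have hEe : EF.map (e : F →+* F) = EF := by
    conv_rhs => rw [hEF, ← hEs]
    rw [hEF, Polynomial.map_map, Polynomial.map_map]
    congr 1
    exact RingHom.ext he
  obtain ⟨φM, hφM⟩ := extend_hom (M := M) EF ((algebraMap F M).comp (e : F →+* F)) (by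
    rw [← Polynomial.map_map, hEe]; exact IsSplittingField.splits M EF)
  have hφX : ∀ f : k[X], φM (algebraMap k[X] M f) = algebraMap k[X] M (f.map (iterateFrobenius k p s)) := by
    intro f
    rw [IsScalarTower.algebraMap_apply k[X] F M, hφM]
    change algebraMap F M (e _) = _
    rw [he, ← IsScalarTower.algebraMap_apply]
  have hφaev : ∀ (y : M) (f : k[X][X]), φM (aeval y f) = aeval (φM y) (f.map (mapRingHom (iterateFrobenius k p s))) := by
    intro y f
    rw [aeval_def, aeval_def, eval₂_map, hom_eval₂]
    congr 1
    exact RingHom.ext hφX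
  let φ : B →+* B := (φM.comp (algebraMap B M)).codRestrict B.toSubring (by
    rintro ⟨b, f, hf, hb⟩
    refine ⟨f.map (mapRingHom (iterateFrobenius k p s)), hf.map _, ?_⟩
    rw [← aeval_def] at hb ⊢
    change aeval (φM b) _ = 0
    rw [← hφaev, hb, map_zero])
  have hφc : ∀ b, ((φ b : B) : M) = φM b := fun b => rfl
  have hφR : ∀ b ∈ R, φ b ∈ R := by
    intro b hb
    rw [hRm] at hb ⊢
    rw [hφc, ← hEs, ← hφaev, hb, map_zero]
  have hφXB : ∀ f : k[X], φ (algebraMap k[X] B f) = algebraMap k[X] B (f.map (iterateFrobenius k p s)) :=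
    fun f => Subtype.ext (hφX f)
  have hφk : ∀ t : k, φ (algebraMap k B t) = algebraMap k B (t^(p^s)) := by
    intro t
    rw [IsScalarTower.algebraMap_apply k k[X] B, hφXB, IsScalarTower.algebraMap_apply k k[X] B]
    simp [Polynomial.algebraMap_eq, iterateFrobenius_def]
  have hφx : φ (algebraMap k[X] B X) = algebraMap k[X] B X := by rw [hφXB, Polynomial.map_X]
  have hφU : ∀ u ∈ U, φ u ∈ U := by
    intro u hu
    induction hu using Submodule.span_induction with
    | mem u hu =>
      rcases hu with ⟨i, hi, rfl⟩ | hu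
      · simp only [map_pow, hxB, hφx]
        exact hUx i hi
      · exact hRU _ (hφR u hu)
    | zero => rw [map_zero]; exact U.zero_mem
    | add a b _ _ ha hb => rw [map_add]; exact U.add_mem ha hb
    | smul t a _ ha =>
      rw [Algebra.smul_def, map_mul, hφk, ← Algebra.smul_def]
      exact U.smul_mem _ ha
  obtain ⟨b0, hb0⟩ : ∃ b0 : M, aeval b0 g = 0 := by
    have h1 : (g.map (algebraMap F M)).Splits := by
      refine (IsSplittingField.splits M EF).of_dvd ?_ (Polynomial.map_dvd _ hgE)
      exact (Polynomial.map_ne_zero_iff (algebraMap F M).injective).mpr hEF0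
    obtain ⟨y, hy⟩ := h1.exists_eval_eq_zero (by
      rw [degree_map]; exact (natDegree_pos_iff_degree_pos.mp (by omega)).ne')
    exact ⟨y, by rw [aeval_def, ← eval_map]; exact hy⟩
  have hb0E : aeval b0 E = 0 := by
    rw [← haevF]
    obtain ⟨y, hy⟩ := hgE
    rw [hy, map_mul, hb0, zero_mul]
  obtain ⟨γ, hγ⟩ := conj_frob EF hEF0 e hEe φM hφM g hg hgE (by omega) b0 hb0
  set bB : B := ⟨b0, hint b0 hb0E⟩
  have hbR : bB ∈ R := (hRm _).mpr hb0E
  set b1 := φ bB with hb1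
  have hb1R : b1 ∈ R := hφR _ hbR
  have hγ1 : γ • b1 = bB := Subtype.ext hγ
  have : Algebra.IsIntegral k[X] B := inferInstance
  obtain ⟨x₁, P, hxS, hxQ, hPf, hPR, hPφ⟩ := goodplace (G := M ≃ₐ[F] M) v hk hx hBM hXB U hU1 hfg ω ν hω hUx hUG hUv hν hνF hν0
    β hβU hβ' htr p s μ hμ φ hφk hφx hφU l κ hκ hl hs R hRU (N*N) (by
      rw [Finset.offDiag_card]; exact (Nat.sub_le _ _).trans (Nat.mul_le_mul hRc hRc)) hRG hRf S s0 hS hnum' γ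
  refine ⟨x₁, hxS, P b1, hxQ, ?_, ?_, ?_⟩
  · rw [← hPφ, hγ1]
  · have h1 : aeval b1 E = 0 := (mem_aroots.mp (Multiset.mem_toFinset.mp hb1R)).2
    have h2 := congrArg (P : B →+* k) h1
    rw [aeval_def, hom_eval₂, map_zero] at h2
    rw [eval_map, ← h2]
    congr 1
    exact (RingHom.ext fun f => hPf f).symm
  · intro ρ hρ hcon
    have hρR : algebraMap k[X] B ρ ∈ R := by
      rw [hRm]
      change aeval (algebraMap k[X] M ρ) E = 0
      rw [aeval_algebraMap_apply, coe_aeval_eq_eval, hρ, map_zero]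
    have h1 := hPR _ hρR _ hb1R (by rw [hPf, hcon])
    have h2 : b0 = algebraMap F M (algebraMap k[X] F ρ) := by
      have : bB = algebraMap k[X] B ρ := by rw [← hγ1, ← h1, smul_algebraMap]
      rw [← IsScalarTower.algebraMap_apply]
      exact congrArg Subtype.val this
    rw [h2, aeval_algebraMap_apply, coe_aeval_eq_eval] at hb0
    have h3 := (map_eq_zero_iff _ (algebraMap F M).injective).mp hb0
    have h4 : g.natDegree = 1 := natDegree_eq_of_degree_eq_some (degree_eq_one_of_irreducible_of_root hg h3)
    omega
end W

theorem thmW (k : Type*) [Field k] [IsAlgClosed k] (p : ℕ) [Fact p.Prime] [CharP k p] (N ω s0 : ℕ) (hω : 1 ≤ ω) :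
    ∃ Q0, ∀ s, Q0 ≤ p^s → ∀ (E : k[X][X]), E.Monic → E.natDegree = N → (∀ i, (E.coeff i).natDegree ≤ ω) →
    (E.map (algebraMap k[X] (FractionRing k[X]))).Separable →
    E.map (mapRingHom (iterateFrobenius k p s)) = E →
    ∀ g : (FractionRing k[X])[X], Irreducible g → g ∣ E.map (algebraMap k[X] (FractionRing k[X])) →
    N < 2 * g.natDegree → 2 ≤ g.natDegree → ∀ S : Finset k, S.card ≤ s0 →
    ∃ x₁ ∉ S, ∃ X₁, x₁^(p^s) = x₁ ∧ X₁^(p^s) = X₁ ∧ eval X₁ (E.map (evalRingHom x₁)) = 0 ∧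
      ∀ ρ : k[X], eval ρ E = 0 → eval x₁ ρ ≠ X₁ := by
  have h := fun ν => numW p Fact.out (ν+1) ω (N*N) s0 (Nat.succ_pos _) hω
  choose Q hQ using h
  refine ⟨∑ ν ∈ Finset.range (N.factorial+1), Q ν, ?_⟩
  intro s hs E hE1 hE2 hE3 hE4 hE5 g hg1 hg2 hg3 hg4 S hS
  obtain ⟨M, _, _, hSF⟩ : ∃ (M : Type _) (_ : Field M) (_ : Algebra (FractionRing k[X]) M),
      IsSplittingField (FractionRing k[X]) M (E.map (algebraMap k[X] (FractionRing k[X]))) :=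
    ⟨SplittingField (E.map (algebraMap k[X] (FractionRing k[X]))), inferInstance, inferInstance, inferInstance⟩
  let i1 : Algebra k[X] M := ((algebraMap (FractionRing k[X]) M).comp (algebraMap k[X] (FractionRing k[X]))).toAlgebra
  let i2 : Algebra k M := ((algebraMap k[X] M).comp (algebraMap k k[X])).toAlgebra
  have i3 : IsScalarTower k k[X] M := IsScalarTower.of_algebraMap_eq (fun _ => rfl)
  have i4 : IsScalarTower k[X] (FractionRing k[X]) M := IsScalarTower.of_algebraMap_eq (fun _ => rfl)
  refine thmW_core (F := FractionRing k[X]) (M := M)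
    p N ω s0 hω s E hE1 hE2 hE3 hE4 hE5 ?_ g hg1 hg2 hg3 hg4 S hS
  intro ν hν hνN
  obtain ⟨ν, rfl⟩ : ∃ ν', ν = ν'+1 := ⟨ν-1, by omega⟩
  exact hQ ν s ((Finset.single_le_sum (f := Q) (fun _ _ => Nat.zero_le _) (Finset.mem_range.mpr (by omega))).trans hs)
end part6

section part7
set_option autoImplicit false
set_option linter.unusedSectionVars false
open Polynomial

section eis
variable {k : Type*} [Field k]

def Phi (u : k) (δ : ℕ) (f : k[X][X]) : Prop :=
  f.map (evalRingHom u) ≠ 0 ∧ (f.map (evalRingHom u)).natDegree + δ = f.natDegree ∧ ¬ (X - C u)^2 ∣ f.leadingCoeff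

theorem Phi_mul (u : k) (δ : ℕ) (a b : k[X][X]) (h : Phi u δ (a*b)) : Phi u δ a ∨ Phi u δ b := by
  obtain ⟨h1, h2, h3⟩ := h
  rw [Polynomial.map_mul] at h1 h2
  have ha := left_ne_zero_of_mul h1
  have hb := right_ne_zero_of_mul h1
  have ha0 : a ≠ 0 := by rintro rfl; simp at ha
  have hb0 : b ≠ 0 := by rintro rfl; simp at hb
  rw [natDegree_mul ha hb, natDegree_mul ha0 hb0] at h2
  rw [leadingCoeff_mul] at h3
  have key : (evalRingHom u) a.leadingCoeff ≠ 0 ∨ (evalRingHom u) b.leadingCoeff ≠ 0 := by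
    by_contra! hh
    apply h3
    rw [pow_two]
    exact mul_dvd_mul (dvd_iff_isRoot.mpr hh.1) (dvd_iff_isRoot.mpr hh.2)
  rcases key with hk | hk
  · right
    rw [natDegree_map_of_leadingCoeff_ne_zero _ hk] at h2
    exact ⟨hb, by omega, fun h => h3 (h.mul_left _)⟩
  · left
    rw [natDegree_map_of_leadingCoeff_ne_zero _ hk] at h2
    exact ⟨ha, by omega, fun h => h3 (h.mul_right _)⟩

theorem Phi_pos (u : k) (δ : ℕ) (hδ : 0 < δ) (f : k[X][X]) (h : Phi u δ f) : ¬ IsUnit f := by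
  intro hu
  have := natDegree_eq_zero_of_isUnit hu
  have := h.2.1
  omega

theorem Phi_irr (u : k) (δ : ℕ) (hδ : 0 < δ) (f : k[X][X]) (hf : f ≠ 0) (h : Phi u δ f) :
    ∃ g : (FractionRing k[X])[X], Irreducible g ∧ g ∣ f.map (algebraMap k[X] (FractionRing k[X])) ∧ δ ≤ g.natDegree := by
  obtain ⟨s, hs, w, hw⟩ := WfDvdMonoid.exists_factors f hf
  have key : ∀ s : Multiset k[X][X], Phi u δ s.prod → ∃ a ∈ s, Phi u δ a := by
    intro s
    induction s using Multiset.induction_on with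
    | empty => intro h; exact absurd isUnit_one (Phi_pos u δ hδ _ (by simpa using h))
    | cons a s ih =>
      intro h
      rw [Multiset.prod_cons] at h
      rcases Phi_mul u δ _ _ h with h | h
      · exact ⟨a, Multiset.mem_cons_self _ _, h⟩
      · obtain ⟨b, hb, hb'⟩ := ih h
        exact ⟨b, Multiset.mem_cons_of_mem hb, hb'⟩
  have h1 : Phi u δ s.prod := by
    rw [← hw] at h
    exact (Phi_mul u δ _ _ h).resolve_right fun h => Phi_pos u δ hδ _ h w.isUnit
  obtain ⟨a, has, ha⟩ := key s h1
  have hai := hs a has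
  have had : δ ≤ a.natDegree := by have := ha.2.1; omega
  have haf : a ∣ f := (Multiset.dvd_prod has).trans (Dvd.intro _ hw)
  refine ⟨a.map (algebraMap k[X] (FractionRing k[X])), ?_, Polynomial.map_dvd _ haf, ?_⟩
  · exact ((hai.isPrimitive (by omega)).irreducible_iff_irreducible_map_fraction_map).mp hai
  · rwa [natDegree_map_eq_of_injective (IsFractionRing.injective _ _)]

/-- transfer an irreducible factor to the integral normalization -/
theorem irr_norm {F : Type*} [Field F] (f : F[X]) (hf : 1 ≤ f.natDegree) (g : F[X]) (hg : Irreducible g) (hgf : g ∣ f) :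
    ∃ g' : F[X], Irreducible g' ∧ g' ∣ integralNormalization f ∧ g'.natDegree = g.natDegree := by
  have hD : f.leadingCoeff ≠ 0 := by
    rw [Ne, leadingCoeff_eq_zero]; rintro rfl; simp at hf
  set D := f.leadingCoeff
  let _ : Invertible D⁻¹ := invertibleOfNonzero (inv_ne_zero hD)
  let e := algEquivCMulXAddC D⁻¹ (0:F)
  have he : ∀ y : F[X], e y = y.comp (C D⁻¹ * X) := by
    intro y
    simp [e, algEquivCMulXAddC, comp, aeval_def, eval₂_eq_eval_map]
  refine ⟨e g, (MulEquiv.irreducible_iff e.toMulEquiv).mpr hg, ?_, ?_⟩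
  · have h1 : integralNormalization f = C (D^(f.natDegree-1)) * e f := by
      ext i
      rw [he, coeff_C_mul, comp_C_mul_X_coeff]
      by_cases hi : i = f.natDegree
      · subst hi
        rw [integralNormalization_coeff_natDegree (by rintro rfl; simp at hf), coeff_natDegree]
        change 1 = D^(f.natDegree-1) * (D * D⁻¹^f.natDegree)
        rw [← mul_assoc, ← pow_succ, Nat.sub_add_cancel hf, ← mul_pow, mul_inv_cancel₀ hD, one_pow]
      · rw [integralNormalization_coeff_ne_natDegree hi]
        by_cases hi2 : f.natDegree < i
        · rw [coeff_eq_zero_of_natDegree_lt hi2]; simp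
        · have : D^(f.natDegree-1) = D^(f.natDegree-1-i) * D^i := by rw [← pow_add]; congr 1; omega
          rw [this]
          change f.coeff i * D^(f.natDegree-1-i) = _
          rw [inv_pow]; field_simp
    rw [h1]
    exact (map_dvd e hgf).mul_left _
  · rw [he, natDegree_comp, natDegree_C_mul_X _ (inv_ne_zero hD), mul_one]
end eis
end part7

section part8
set_option autoImplicit false
set_option linter.unusedSectionVars false
open Polynomial

section pencil
noncomputable def LTp {R : Type*} [CommRing R] (q : ℕ) (a : ℕ → R) (d : ℕ) : R[X] :=
  ∑ i ∈ Finset.range (d+1), C (a i) * X^(q^i-1)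

def lin {R : Type*} [CommRing R] (q : ℕ) (a : ℕ → R) (d : ℕ) (x : R) : R :=
  ∑ i ∈ Finset.range (d+1), a i * x^(q^i)

theorem LT_map {R R' : Type*} [CommRing R] [CommRing R'] (f : R →+* R') (q : ℕ) (a : ℕ → R) (d : ℕ) :
    (LTp q a d).map f = LTp q (fun i => f (a i)) d := by
  simp [LTp, Polynomial.map_sum]

theorem lin_map {R R' : Type*} [CommRing R] [CommRing R'] (f : R →+* R') (q : ℕ) (a : ℕ → R) (d : ℕ) (x : R) :
    f (lin q a d x) = lin q (fun i => f (a i)) d (f x) := by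
  simp [lin]

theorem LT_eval {R : Type*} [CommRing R] (q : ℕ) (hq : 1 ≤ q) (a : ℕ → R) (d : ℕ) (x : R) :
    x * (LTp q a d).eval x = lin q a d x := by
  simp only [LTp, lin, eval_finsetSum, Finset.mul_sum, eval_mul, eval_C, eval_pow, eval_X]
  refine Finset.sum_congr rfl fun i _ => ?_
  have : q^i = q^i-1+1 := (Nat.sub_add_cancel (Nat.one_le_pow _ _ hq)).symm
  conv_rhs => rw [this, pow_succ]
  ring

theorem LT_trunc {R : Type*} [CommRing R] (q : ℕ) (a : ℕ → R) (d e : ℕ) (he : e ≤ d) (ha : ∀ i, e < i → a i = 0) :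
    LTp q a d = LTp q a e := by
  refine (Finset.sum_subset (Finset.range_mono (by omega)) fun i _ hi => ?_).symm
  rw [ha i (by simpa using hi)]; simp

theorem lin_trunc {R : Type*} [CommRing R] (q : ℕ) (a : ℕ → R) (d e : ℕ) (he : e ≤ d) (ha : ∀ i, e < i → a i = 0) (x : R) :
    lin q a d x = lin q a e x := by
  refine (Finset.sum_subset (Finset.range_mono (by omega)) fun i _ hi => ?_).symm
  rw [ha i (by simpa using hi)]; simp

theorem LT_natDegree_le {R : Type*} [CommRing R] (q : ℕ) (hq : 1 ≤ q) (a : ℕ → R) (d : ℕ) :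
    (LTp q a d).natDegree ≤ q^d-1 := by
  refine natDegree_sum_le_of_forall_le _ _ fun i hi => (natDegree_C_mul_X_pow_le _ _).trans ?_
  exact Nat.sub_le_sub_right (Nat.pow_le_pow_right hq (by simpa [Nat.lt_succ_iff] using hi)) _

theorem LT_coeff {R : Type*} [CommRing R] (q : ℕ) (hq : 2 ≤ q) (a : ℕ → R) (d : ℕ) :
    (LTp q a d).coeff (q^d-1) = a d := by
  rw [LTp, finsetSum_coeff, Finset.sum_eq_single d]
  · simp
  · intro i hi hid
    rw [coeff_C_mul_X_pow, if_neg]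
    have : i < d := by simp at hi; omega
    have := Nat.pow_lt_pow_right (by omega : 1 < q) this
    have := Nat.one_le_pow i q (by omega)
    omega
  · simp

theorem LT_natDegree {R : Type*} [CommRing R] (q : ℕ) (hq : 2 ≤ q) (a : ℕ → R) (d : ℕ) (ha : a d ≠ 0) :
    (LTp q a d).natDegree = q^d-1 := by
  refine le_antisymm (LT_natDegree_le q (by omega) a d) (le_natDegree_of_ne_zero ?_)
  rwa [LT_coeff q hq]

theorem LT_lead {R : Type*} [CommRing R] (q : ℕ) (hq : 2 ≤ q) (a : ℕ → R) (d : ℕ) (ha : a d ≠ 0) :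
    (LTp q a d).leadingCoeff = a d := by
  rw [leadingCoeff, LT_natDegree q hq a d ha, LT_coeff q hq]

theorem LT_coeff_deg {k : Type*} [Field k] (q : ℕ) (a : ℕ → k[X]) (d A : ℕ) (h : ∀ i, (a i).natDegree ≤ A) (j : ℕ) :
    ((LTp q a d).coeff j).natDegree ≤ A := by
  rw [LTp, finsetSum_coeff]
  refine natDegree_sum_le_of_forall_le _ _ fun i hi => ?_
  rw [coeff_C_mul_X_pow]
  split_ifs
  · exact h i
  · simp

theorem LT_sep {F : Type*} [Field F] (p e : ℕ) [CharP F p] (he : 0 < e) (hp : 1 ≤ p) (a : ℕ → F) (d : ℕ) (h0 : a 0 ≠ 0) :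
    (LTp (p^e) a d).Separable := by
  have h1 : X * LTp (p^e) a d = ∑ i ∈ Finset.range (d+1), C (a i) * X^((p^e)^i) := by
    rw [LTp, Finset.mul_sum]
    refine Finset.sum_congr rfl fun i _ => ?_
    have : (p^e)^i = (p^e)^i-1+1 := (Nat.sub_add_cancel (Nat.one_le_pow _ _ (Nat.one_le_pow _ _ hp))).symm
    conv_rhs => rw [this, pow_succ]
    ring
  have h2 : derivative (X * LTp (p^e) a d) = C (a 0) := by
    rw [h1, derivative_sum, Finset.sum_eq_single 0]
    · simp
    · intro i _ hi
      rw [derivative_C_mul_X_pow, ← pow_mul, Nat.cast_pow, CharP.cast_eq_zero F p, zero_pow (by positivity)]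
      simp
    · simp
  have : (X * LTp (p^e) a d).Separable := by
    rw [separable_def, h2]
    exact ⟨0, C (a 0)⁻¹, by rw [zero_mul, zero_add, ← C_mul, inv_mul_cancel₀ h0, C_1]⟩
  exact this.of_mul_right

theorem lin_add {R : Type*} [CommRing R] (p e : ℕ) [Fact p.Prime] [CharP R p] (a : ℕ → R) (d : ℕ) (x y : R) :
    lin (p^e) a d (x+y) = lin (p^e) a d x + lin (p^e) a d y := by
  simp only [lin, ← Finset.sum_add_distrib]
  refine Finset.sum_congr rfl fun i _ => ?_
  rw [← pow_mul, add_pow_char_pow, mul_add]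

theorem lin_smul {R : Type*} [CommRing R] (q : ℕ) (a : ℕ → R) (d : ℕ) (α x : R) (hα : α^q = α) :
    lin q a d (α*x) = α * lin q a d x := by
  simp only [lin, Finset.mul_sum]
  refine Finset.sum_congr rfl fun i _ => ?_
  have : ∀ i : ℕ, α^(q^i) = α := by
    intro i
    induction i with
    | zero => simp
    | succ i ih => rw [pow_succ, pow_mul, ih, hα]
  rw [mul_pow, this i]; ring
end pencil
end part8

section part9
set_option autoImplicit false
set_option linter.unusedSectionVars false
open Polynomial

section pencil2

theorem LT_eval_zero {R : Type*} [CommRing R] (q : ℕ) (hq : 2 ≤ q) (a : ℕ → R) (d : ℕ) :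
    (LTp q a d).eval 0 = a 0 := by
  rw [LTp, eval_finsetSum, Finset.sum_eq_single 0]
  · simp
  · intro i _ hi
    have : q^i - 1 ≠ 0 := by
      have := Nat.one_lt_pow hi (by omega : 1 < q)
      omega
    simp [this]
  · simp

theorem LT_intNorm {R : Type*} [CommRing R] [IsDomain R] (q : ℕ) (hq : 2 ≤ q) (a : ℕ → R) (d : ℕ) (ha : a d ≠ 0) :
    (LTp q a d).integralNormalization =
      LTp q (fun i => if i = d then 1 else a i * a d^(q^d-1-1-(q^i-1))) d := by
  have h0 : LTp q a d ≠ 0 := by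
    intro h
    have := LT_coeff q hq a d
    rw [h, coeff_zero] at this
    exact ha this.symm
  ext j
  by_cases hj : j = (LTp q a d).natDegree
  · rw [hj, integralNormalization_coeff_natDegree h0, LT_natDegree q hq a d ha, LT_coeff q hq]
    simp
  · rw [integralNormalization_coeff_ne_natDegree hj, LT_lead q hq a d ha, LT_natDegree q hq a d ha]
    rw [LT_natDegree q hq a d ha] at hj
    simp only [LTp, finsetSum_coeff, coeff_C_mul_X_pow, Finset.sum_mul]
    refine Finset.sum_congr rfl fun i _ => ?_
    split_ifs with h1 h2 h2
    · rw [h2] at h1; exact absurd h1 hj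
    · rw [h1]
    · simp

theorem lin_deg {k : Type*} [Field k] (q : ℕ) (hq : 1 ≤ q) (c : ℕ → k) (d : ℕ) :
    (lin q (fun i => C (c i)) d (X : k[X])).natDegree ≤ q^d := by
  refine natDegree_sum_le_of_forall_le _ _ fun i hi => (natDegree_C_mul_X_pow_le _ _).trans ?_
  exact Nat.pow_le_pow_right hq (by simpa [Nat.lt_succ_iff] using hi)

theorem lin_eval {k : Type*} [Field k] (q : ℕ) (c : ℕ → k) (d : ℕ) (x : k) :
    (lin q (fun i => C (c i)) d (X : k[X])).eval x = lin q c d x := by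
  have := lin_map (evalRingHom x) q (fun i => C (c i)) d X
  simpa using this

theorem lin_deriv {k : Type*} [Field k] (p e : ℕ) [CharP k p] (he : 0 < e) (c : ℕ → k) (d : ℕ) :
    derivative (lin (p^e) (fun i => C (c i)) d (X : k[X])) = C (c 0) := by
  rw [lin, derivative_sum, Finset.sum_eq_single 0]
  · simp
  · intro i _ hi
    rw [derivative_C_mul_X_pow, ← pow_mul, Nat.cast_pow, CharP.cast_eq_zero k p, zero_pow (by positivity)]
    simp
  · simp

theorem thmP (k : Type*) [Field k] [IsAlgClosed k] (p e d : ℕ) [Fact p.Prime] [CharP k p] (he : 0 < e) :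
    ∃ Q0, ∀ s, Q0 ≤ p^s → ∀ (c g : ℕ → k) (e' : ℕ), e' < d → c e' ≠ 0 → (∀ i, e' < i → c i = 0) →
      g d ≠ 0 → c 0 ≠ 0 → g 0 = 0 → (∀ i, c i^(p^s) = c i) → (∀ i, g i^(p^s) = g i) →
      ∀ u : k, lin (p^e) c d u = 0 → lin (p^e) g d u ≠ 0 →
      ∃ x z : k, x^(p^s) = x ∧ z^(p^s) = z ∧ lin (p^e) c d x ≠ 0 ∧
        lin (p^e) c d x * lin (p^e) g d z - lin (p^e) g d x * lin (p^e) c d z = 0 ∧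
        ∀ α w : k, α^(p^e) = α → lin (p^e) c d w = 0 → lin (p^e) g d w = 0 → z ≠ α * x + w := by
  classical
  have hp : p.Prime := Fact.out
  have hq2 : 2 ≤ p^e := by
    calc 2 ≤ p := hp.two_le
      _ = p^1 := (pow_one p).symm
      _ ≤ p^e := Nat.pow_le_pow_right hp.pos he
  set q := p^e with hq
  have hqd : 1 ≤ q^d := Nat.one_le_pow _ _ (by omega)
  obtain ⟨Q0, hQ0⟩ := thmW k p (q^d-1) (q^d*q^d) (2*q^d) (by nlinarith)
  refine ⟨Q0, fun s hs c g e' hed hce hctop hgd hc0 hg0 hcr hgr u hcu hgu => ?_⟩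
  have hu0 : u ≠ 0 := by
    rintro rfl
    apply hgu
    rw [lin]
    refine Finset.sum_eq_zero fun i _ => ?_
    rw [zero_pow (by positivity), mul_zero]
  have he1 : 1 ≤ e' := by
    by_contra hlt
    have : e' = 0 := by omega
    subst this
    rw [lin_trunc q c d 0 (by omega) hctop] at hcu
    simp [lin, hc0, hu0] at hcu
  have hcd : c d = 0 := hctop d hed
  set cX : k[X] := lin q (fun i => C (c i)) d X with hcX
  set gX : k[X] := lin q (fun i => C (g i)) d X with hgX
  set a : ℕ → k[X] := fun i => cX * C (g i) - gX * C (c i) with ha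
  have hcX0 : cX ≠ 0 := by
    intro h
    have := lin_deriv p e he c d
    rw [← hq, ← hcX, h, derivative_zero] at this
    exact hc0 (C_eq_zero.mp this.symm)
  have hgX0 : gX ≠ 0 := by
    intro h
    have := lin_eval q g d u
    rw [← hgX, h, eval_zero] at this
    exact hgu this.symm
  have had : a d = cX * C (g d) := by simp [ha, hcd]
  have had0 : a d ≠ 0 := by rw [had]; exact mul_ne_zero hcX0 (C_ne_zero.mpr hgd)
  have ha0 : a 0 ≠ 0 := by simp [ha, hg0, hgX0, hc0]
  set E' : k[X][X] := LTp q a d with hE'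
  have hE'deg : E'.natDegree = q^d-1 := LT_natDegree q hq2 a d had0
  have hE'lead : E'.leadingCoeff = a d := LT_lead q hq2 a d had0
  have hE'0 : E' ≠ 0 := by intro h; rw [h, leadingCoeff_zero] at hE'lead; exact had0 hE'lead.symm
  have hqe : q^1 ≤ q^e' := Nat.pow_le_pow_right (by omega) he1
  have hqde : q^e' * q ≤ q^d := by
    rw [← pow_succ]; exact Nat.pow_le_pow_right (by omega) hed
  rw [pow_one] at hqe
  have h2e : 2 * q^e' ≤ q^d := by nlinarith
  have hN1 : 1 ≤ E'.natDegree := by rw [hE'deg]; omega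
  have hadeg : ∀ i, (a i).natDegree ≤ q^d := by
    intro i
    refine (natDegree_sub_le _ _).trans (max_le ?_ ?_)
    · exact (natDegree_mul_C_le _ _).trans (lin_deg q (by omega) c d)
    · exact (natDegree_mul_C_le _ _).trans (lin_deg q (by omega) g d)
  -- Phi
  have hPhi : Phi u (q^d - q^e') E' := by
    have hm : E'.map (evalRingHom u) = LTp q (fun i => - lin q g d u * c i) e' := by
      rw [hE', LT_map]
      rw [← LT_trunc q (fun i => - lin q g d u * c i) d e' hed.le (fun i hi => by simp [hctop i hi])]
      congr 1
      funext i
      simp [ha, hcX, hgX, lin_eval, hcu]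
    have hne : (fun i => - lin q g d u * c i) e' ≠ 0 := by simp [hgu, hce]
    have hdd := LT_natDegree q hq2 (fun i => - lin q g d u * c i) e' hne
    refine ⟨?_, ?_, ?_⟩
    · rw [hm]
      intro h
      rw [h, natDegree_zero] at hdd
      omega
    · rw [hm, hdd, hE'deg]; omega
    · rw [hE'lead, had]
      rintro ⟨b, hb⟩
      have h1 : derivative (cX * C (g d)) = C (c 0) * C (g d) := by
        rw [derivative_mul, derivative_C, mul_zero, add_zero, lin_deriv p e he c d]
      have h2 := congrArg (fun P => eval u (derivative P)) hb
      simp [h1, derivative_mul, derivative_pow, hc0, hgd] at h2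
  obtain ⟨G, hGi, hGd, hGdeg⟩ := Phi_irr u (q^d - q^e') (by omega) E' hE'0 hPhi
  have hinj : Function.Injective (algebraMap k[X] (FractionRing k[X])) := IsFractionRing.injective _ _
  have hlead0 : algebraMap k[X] (FractionRing k[X]) E'.leadingCoeff ≠ 0 := by
    rw [hE'lead]; exact (map_ne_zero_iff _ hinj).mpr had0
  obtain ⟨G', hG'i, hG'd, hG'deg⟩ := irr_norm (E'.map (algebraMap k[X] (FractionRing k[X])))
    (by rwa [natDegree_map_of_leadingCoeff_ne_zero _ hlead0]) G hGi hGd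
  rw [integralNormalization_map _ _ hlead0] at hG'd
  set b : ℕ → k[X] := fun i => if i = d then 1 else a i * a d^(q^d-1-1-(q^i-1)) with hb
  have hEb : E'.integralNormalization = LTp q b d := LT_intNorm q hq2 a d had0
  set E := E'.integralNormalization with hE
  have hEm : E.Monic := monic_integralNormalization hE'0
  have hb0 : b 0 ≠ 0 := by
    rw [hb]; simp only
    rw [if_neg (by omega)]
    exact mul_ne_zero ha0 (pow_ne_zero _ had0)
  have hfr : ∀ i, mapRingHom (iterateFrobenius k p s) (a i) = a i := by
    intro i
    have h1 : ∀ c : ℕ → k, (∀ i, c i^(p^s) = c i) → mapRingHom (iterateFrobenius k p s) (lin q (fun i => C (c i)) d X) = lin q (fun i => C (c i)) d X := by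
      intro c hc
      rw [lin_map]
      congr 1
      · funext i
        simp [iterateFrobenius_def, hc]
      · simp
    rw [ha]; simp only
    rw [map_sub, map_mul, map_mul, h1 c hcr, h1 g hgr]
    simp only [coe_mapRingHom, map_C, iterateFrobenius_def, hcr, hgr]
    rw [hcX, hgX]
  let S : Finset k := cX.roots.toFinset ∪ gX.roots.toFinset
  have hScard : S.card ≤ 2*q^d := by
    refine (Finset.card_union_le _ _).trans ?_
    have h1 := (Multiset.toFinset_card_le cX.roots).trans ((card_roots' cX).trans (lin_deg q (by omega) c d))
    have h2 := (Multiset.toFinset_card_le gX.roots).trans ((card_roots' gX).trans (lin_deg q (by omega) g d))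
    omega
  obtain ⟨x, hxS, X₁, hx, hX₁, hEx, hρ⟩ := hQ0 s hs E hEm
    (by rw [hE, natDegree_integralNormalization, hE'deg])
    (by
      rw [hEb]
      apply LT_coeff_deg
      intro i
      rw [hb]; simp only
      split_ifs
      · simp
      · refine natDegree_mul_le.trans ?_
        have h1 := natDegree_pow_le (p := a d) (n := q^d-1-1-(q^i-1))
        have h2 := hadeg d
        have h3 := hadeg i
        calc (a i).natDegree + (a d^(q^d-1-1-(q^i-1))).natDegree
            ≤ q^d + (q^d-1-1-(q^i-1)) * q^d := by
              refine add_le_add h3 (h1.trans (Nat.mul_le_mul_left _ h2))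
          _ = (1 + (q^d-1-1-(q^i-1))) * q^d := by ring
          _ ≤ q^d*q^d := Nat.mul_le_mul_right _ (by omega))
    (by
      rw [hEb, LT_map]
      haveI : CharP (FractionRing k[X]) p := charP_of_injective_algebraMap hinj p
      apply LT_sep p e he hp.one_le
      exact (map_ne_zero_iff _ hinj).mpr hb0)
    (by
      rw [hEb, LT_map]
      congr 1
      funext i
      rw [hb]; simp only
      split_ifs
      · exact map_one _
      · rw [map_mul, map_pow, hfr, hfr])
    G' hG'i hG'd (by omega) (by omega) S hScard
  have hcx : lin q c d x ≠ 0 := by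
    intro h
    apply hxS
    refine Finset.mem_union_left _ ?_
    rw [Multiset.mem_toFinset, mem_roots hcX0, IsRoot, lin_eval, h]
  have hgx : lin q g d x ≠ 0 := by
    intro h
    apply hxS
    refine Finset.mem_union_right _ ?_
    rw [Multiset.mem_toFinset, mem_roots hgX0, IsRoot, lin_eval, h]
  set D1 : k := lin q c d x * g d with hD1
  have hD10 : D1 ≠ 0 := mul_ne_zero hcx hgd
  have hevlead : evalRingHom x E'.leadingCoeff = D1 := by
    rw [hE'lead, had]; simp [hcX, lin_eval, hD1]
  set E1 := E'.map (evalRingHom x) with hE1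
  have hE1L : E1 = LTp q (fun i => lin q c d x * g i - lin q g d x * c i) d := by
    rw [hE1, hE', LT_map]
    congr 1
    funext i
    simp [ha, hcX, hgX, lin_eval]
  have hE1z : E1.eval (X₁/D1) = 0 := by
    have h1 := integralNormalization_eval₂_leadingCoeff_mul hN1 (evalRingHom x) (X₁/D1)
    rw [hevlead, mul_div_cancel₀ _ hD10, ← hE, eval₂_eq_eval_map, hEx, eval₂_eq_eval_map] at h1
    exact (mul_eq_zero.mp h1.symm).resolve_left (pow_ne_zero _ hD10)
  have hlinz := LT_eval q (by omega) (fun i => lin q c d x * g i - lin q g d x * c i) d (X₁/D1)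
  rw [← hE1L, hE1z, mul_zero] at hlinz
  have hsplit : ∀ {R : Type _} [CommRing R] (A B : R) (g c : ℕ → R) (y : R),
      lin q (fun i => A * g i - B * c i) d y = A * lin q g d y - B * lin q c d y := by
    intro R _ A B g c y
    simp only [lin, Finset.mul_sum, ← Finset.sum_sub_distrib]
    exact Finset.sum_congr rfl fun i _ => by ring
  have hlinQ : lin q c d x ^ (p^s) = lin q c d x := by
    have := lin_map (iterateFrobenius k p s) q c d x
    simpa [iterateFrobenius_def, hcr, hx] using this
  refine ⟨x, X₁/D1, hx, ?_, hcx, ?_, ?_⟩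
  · rw [div_pow, hX₁, hD1, mul_pow, hlinQ, hgr]
  · rw [← hsplit]; exact hlinz.symm
  · intro α w hα hcw hgw hz
    have hlinZ : ∀ c : ℕ → k, lin q c d w = 0 → lin q (fun i => C (c i)) d (C α * X + C w) = C α * lin q (fun i => C (c i)) d X := by
      intro c hc
      rw [hq, lin_add p e, lin_smul, ← hq]
      · have := lin_map (C : k →+* k[X]) q c d w
        rw [← this, hc, map_zero, add_zero]
      · rw [← C_pow, ← hq, hα]
    have hZ0 := LT_eval q (by omega) a d (C α * X + C w)
    rw [ha, hsplit, hlinZ c hcw, hlinZ g hgw, ← hcX, ← hgX] at hZ0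
    rw [show cX * (C α * gX) - gX * (C α * cX) = 0 by ring] at hZ0
    rcases mul_eq_zero.mp hZ0 with hZ | hZ
    · have h1 : X₁/D1 = 0 := by
        rw [hz]
        have := congrArg (eval x) hZ
        simpa using this
      rw [h1, hE1L, LT_eval_zero q hq2, hg0] at hE1z
      simp [hgx, hc0] at hE1z
    · refine hρ (E'.leadingCoeff * (C α * X + C w)) ?_ ?_
      · have h1 := integralNormalization_eval₂_leadingCoeff_mul hN1 (RingHom.id k[X]) (C α * X + C w)
        rw [eval₂_id, eval₂_id, RingHom.id_apply] at h1
        rw [hE, h1]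
        change _ * eval _ (LTp q a d) = 0
        rw [hZ, mul_zero]
      · have : eval x E'.leadingCoeff = D1 := hevlead
        rw [eval_mul, this]
        simp only [eval_add, eval_mul, eval_C, eval_X]
        rw [← hz, mul_div_cancel₀ _ hD10]
end pencil2
end part9

section part10
set_option autoImplicit false
set_option linter.unusedSectionVars false
open Polynomial

section skew
variable {k : Type*} [Field k] (p e : ℕ) [Fact p.Prime] [CharP k p]

noncomputable def yy (i : ℕ) (c : k[X]) : k[X] := X^i * c.map (iterateFrobenius k p (e*i))

theorem yy_add (i : ℕ) (c c' : k[X]) : yy p e i (c+c') = yy p e i c + yy p e i c' := by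
  simp [yy, mul_add]

theorem yy_zero (i : ℕ) : yy p e i (0:k[X]) = 0 := by simp [yy]

theorem yy_smul (i : ℕ) (a : k) (c : k[X]) : yy p e i (a • c) = a^((p^e)^i) • yy p e i c := by
  simp only [yy, smul_eq_C_mul, Polynomial.map_mul, map_C, iterateFrobenius_def, pow_mul]
  ring

theorem yy_yy (i j : ℕ) (c : k[X]) : yy p e i (yy p e j c) = yy p e (i+j) c := by
  simp only [yy, Polynomial.map_mul, Polynomial.map_pow, map_X, Polynomial.map_map]
  rw [← mul_assoc, ← pow_add]
  congr 2
  ext x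
  simp only [RingHom.comp_apply, iterateFrobenius_def]
  rw [← pow_mul, ← pow_add]; congr 2; ring

theorem yy_zero_idx (c : k[X]) : yy p e 0 c = c := by
  simp only [yy, pow_zero, one_mul, mul_zero]
  ext n
  simp [iterateFrobenius_def]

theorem yy_coeff (i n : ℕ) (c : k[X]) : (yy p e i c).coeff n = if i ≤ n then c.coeff (n-i)^((p^e)^i) else 0 := by
  simp [yy, coeff_X_pow_mul', iterateFrobenius_def, pow_mul]

theorem yy_natDegree (i : ℕ) (c : k[X]) (hc : c ≠ 0) : (yy p e i c).natDegree = i + c.natDegree := by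
  rw [yy, natDegree_mul (by simp) ((Polynomial.map_ne_zero_iff (RingHom.injective _)).mpr hc), natDegree_X_pow, natDegree_map]

noncomputable def qcmp (c : k[X]) : k[X] →ₗ[k] k[X] :=
  Polynomial.lsum (fun i => LinearMap.toSpanSingleton k k[X] (yy p e i c))

theorem cmp_monomial (c : k[X]) (i : ℕ) (a : k) : qcmp p e c (monomial i a) = a • yy p e i c := by
  simp [qcmp, lsum_apply, sum_monomial_index]

theorem cmp_eq (c ρ : k[X]) : qcmp p e c ρ = ∑ i ∈ Finset.range (ρ.natDegree+1), ρ.coeff i • yy p e i c := by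
  conv_lhs => rw [ρ.as_sum_range]
  rw [map_sum]
  exact Finset.sum_congr rfl fun i _ => cmp_monomial p e c i _

theorem cmp_coeff_zero (c ρ : k[X]) : (qcmp p e c ρ).coeff 0 = ρ.coeff 0 * c.coeff 0 := by
  rw [cmp_eq, finsetSum_coeff, Finset.sum_eq_single 0]
  · simp [yy_coeff]
  · intro i _ hi
    simp [yy_coeff, hi]
  · simp

theorem cmp_natDegree_le (c ρ : k[X]) : (qcmp p e c ρ).natDegree ≤ ρ.natDegree + c.natDegree := by
  rw [cmp_eq]
  refine natDegree_sum_le_of_forall_le _ _ fun i hi => (natDegree_smul_le _ _).trans ?_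
  by_cases hc : c = 0
  · simp [hc, yy_zero]
  · rw [yy_natDegree p e i c hc]
    simp at hi; omega

theorem cmp_coeff_top (c ρ : k[X]) :
    (qcmp p e c ρ).coeff (ρ.natDegree + c.natDegree) = ρ.leadingCoeff * c.leadingCoeff^((p^e)^ρ.natDegree) := by
  have hp : p.Prime := Fact.out
  rw [cmp_eq, finsetSum_coeff, Finset.sum_eq_single ρ.natDegree]
  · rw [coeff_smul, yy_coeff, if_pos (by omega), Nat.add_sub_cancel_left, smul_eq_mul]; rfl
  · intro i hi hne
    have : i < ρ.natDegree := by simp at hi; omega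
    rw [coeff_smul, yy_coeff, if_pos (by omega), coeff_eq_zero_of_natDegree_lt (p := c) (by omega), zero_pow (pow_ne_zero _ (pow_ne_zero _ hp.ne_zero)), smul_zero]
  · simp

theorem cmp_natDegree (c ρ : k[X]) (hc : c ≠ 0) (hρ : ρ ≠ 0) :
    (qcmp p e c ρ).natDegree = ρ.natDegree + c.natDegree := by
  refine le_antisymm (cmp_natDegree_le p e c ρ) (le_natDegree_of_ne_zero ?_)
  rw [cmp_coeff_top]
  exact mul_ne_zero (leadingCoeff_ne_zero.mpr hρ) (pow_ne_zero _ (leadingCoeff_ne_zero.mpr hc))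

theorem cmp_ne_zero (c ρ : k[X]) (hc : c ≠ 0) (hρ : ρ ≠ 0) : qcmp p e c ρ ≠ 0 := by
  intro h
  have := cmp_coeff_top p e c ρ
  rw [h, coeff_zero] at this
  exact mul_ne_zero (leadingCoeff_ne_zero.mpr hρ) (pow_ne_zero _ (leadingCoeff_ne_zero.mpr hc)) this.symm

theorem cmp_assoc (c σ ρ : k[X]) : ∃ τ, qcmp p e (qcmp p e c σ) ρ = qcmp p e c τ := by
  suffices h : qcmp p e (qcmp p e c σ) ρ ∈ LinearMap.range (qcmp p e c) by
    obtain ⟨τ, hτ⟩ := h; exact ⟨τ, hτ.symm⟩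
  rw [cmp_eq]
  refine Submodule.sum_mem _ fun i _ => Submodule.smul_mem _ _ ?_
  induction σ using Polynomial.induction_on' with
  | add a b ha hb => rw [map_add, yy_add]; exact Submodule.add_mem _ ha hb
  | monomial n a =>
    rw [cmp_monomial, yy_smul, yy_yy]
    refine Submodule.smul_mem _ _ ⟨monomial (i+n) 1, ?_⟩
    rw [cmp_monomial, one_smul]

/-- linearized evaluation -/
noncomputable def ev (q : ℕ) (x : k) : k[X] →ₗ[k] k :=
  Polynomial.lsum (fun i => LinearMap.toSpanSingleton k k (x^(q^i)))

theorem ev_monomial (q : ℕ) (x : k) (i : ℕ) (a : k) : ev q x (monomial i a) = a * x^(q^i) := by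
  simp [ev, lsum_apply, sum_monomial_index]

theorem ev_eq_lin (q : ℕ) (x : k) (c : k[X]) (d : ℕ) (hd : c.natDegree ≤ d) : ev q x c = lin q c.coeff d x := by
  conv_lhs => rw [c.as_sum_range' (d+1) (by omega)]
  rw [map_sum]
  exact Finset.sum_congr rfl fun i _ => ev_monomial q x i _

theorem ev_add (c : k[X]) (x y : k) : ev (p^e) (x+y) c = ev (p^e) x c + ev (p^e) y c := by
  rw [ev_eq_lin _ _ _ _ le_rfl, ev_eq_lin _ _ _ _ le_rfl, ev_eq_lin _ _ _ _ le_rfl, lin_add]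

theorem ev_smul (q : ℕ) (c : k[X]) (α x : k) (hα : α^q = α) : ev q (α*x) c = α * ev q x c := by
  rw [ev_eq_lin _ _ _ _ le_rfl, ev_eq_lin _ _ _ _ le_rfl, lin_smul _ _ _ _ _ hα]

theorem ev_sum (c : k[X]) {ι : Type*} (s : Finset ι) (f : ι → k) :
    ev (p^e) (∑ i ∈ s, f i) c = ∑ i ∈ s, ev (p^e) (f i) c := by
  have hp : p.Prime := Fact.out
  classical
  induction s using Finset.induction_on with
  | empty =>
    rw [Finset.sum_empty, Finset.sum_empty]
    have := ev_smul (p^e) c 0 0 (zero_pow (pow_ne_zero _ hp.ne_zero))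
    simpa using this
  | insert a s ha ih => rw [Finset.sum_insert ha, Finset.sum_insert ha, ev_add, ih]

theorem ev_yy (x : k) (i : ℕ) (c : k[X]) : ev (p^e) x (yy p e i c) = (ev (p^e) x c)^((p^e)^i) := by
  induction c using Polynomial.induction_on' with
  | add a b ha hb => rw [yy_add, map_add, map_add, ha, hb, ← pow_mul, add_pow_char_pow]
  | monomial n a =>
    have : yy p e i (monomial n a) = monomial (i+n) (a^((p^e)^i)) := by
      ext m
      rw [yy_coeff, coeff_monomial, coeff_monomial]
      have hp : p.Prime := Fact.out
      have h0 : (p^e)^i ≠ 0 := pow_ne_zero _ (pow_ne_zero _ hp.ne_zero)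
      split_ifs
      · rfl
      · omega
      · omega
      · exact zero_pow h0
      · omega
      · rfl
    rw [this, ev_monomial, ev_monomial, mul_pow, pow_add, mul_comm ((p^e)^i), pow_mul]

theorem ev_cmp_zero (x : k) (c ρ : k[X]) (h : ev (p^e) x c = 0) : ev (p^e) x (qcmp p e c ρ) = 0 := by
  have hp : p.Prime := Fact.out
  rw [cmp_eq, map_sum]
  refine Finset.sum_eq_zero fun i _ => ?_
  rw [map_smul, ev_yy, h, zero_pow (pow_ne_zero _ (pow_ne_zero _ hp.ne_zero)), smul_zero]

theorem cmp_div (c : k[X]) (hc : c ≠ 0) (c' : k[X]) : ∃ ρ r, c' = qcmp p e c ρ + r ∧ (r = 0 ∨ r.natDegree < c.natDegree) := by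
  induction hn : c'.natDegree using Nat.strong_induction_on generalizing c' with
  | _ n ih =>
  by_cases hlt : n < c.natDegree
  · exact ⟨0, c', by simp, Or.inr (hn ▸ hlt)⟩
  · by_cases h0 : c' = 0
    · exact ⟨0, 0, by simp [h0], Or.inl rfl⟩
    push Not at hlt
    set i := n - c.natDegree with hi
    have hL : c.leadingCoeff ^ ((p^e)^i) ≠ 0 := pow_ne_zero _ (leadingCoeff_ne_zero.mpr hc)
    set a := c'.leadingCoeff / c.leadingCoeff^((p^e)^i) with ha
    have ha0 : a ≠ 0 := div_ne_zero (leadingCoeff_ne_zero.mpr h0) hL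
    have h1 : (qcmp p e c (monomial i a)).natDegree = n := by
      rw [cmp_natDegree p e c _ hc (by simpa using ha0), natDegree_monomial_eq _ ha0]; omega
    have h2 : (qcmp p e c (monomial i a)).leadingCoeff = c'.leadingCoeff := by
      have := cmp_coeff_top p e c (monomial i a)
      rw [← cmp_natDegree p e c _ hc (by simpa using ha0), leadingCoeff_monomial, natDegree_monomial_eq _ ha0] at this
      rw [leadingCoeff, this, ha, div_mul_cancel₀ _ hL]
    by_cases h3 : c' - qcmp p e c (monomial i a) = 0
    · exact ⟨monomial i a, 0, by rw [add_zero]; exact sub_eq_zero.mp h3, Or.inl rfl⟩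
    · have hd : (c' - qcmp p e c (monomial i a)).natDegree < n ∨ n = 0 := by
        by_cases hn0 : n = 0
        · exact Or.inr hn0
        left
        have := degree_sub_lt_left (p := c') (q := qcmp p e c (monomial i a))
          (by rw [degree_eq_natDegree h0, degree_eq_natDegree (cmp_ne_zero p e c _ hc (by simpa using ha0)), hn, h1]) h0 h2.symm
        rw [← hn]
        exact natDegree_lt_natDegree h3 this
      rcases hd with hd | hd
      · obtain ⟨ρ, r, hr, hr'⟩ := ih _ hd _ rfl
        refine ⟨ρ + monomial i a, r, ?_, hr'⟩
        rw [map_add, add_right_comm, ← hr]; ring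
      · exfalso
        apply h3
        have e1 := eq_C_of_natDegree_eq_zero (hn.trans hd)
        have e2 := eq_C_of_natDegree_eq_zero (h1.trans hd)
        rw [leadingCoeff, leadingCoeff, h1, hn, hd] at h2
        rw [e1, e2, h2, sub_self]

theorem ev_eval (q : ℕ) (x : k) (c : k[X]) (d : ℕ) (hd : c.natDegree ≤ d) :
    (lin q (fun i => C (c.coeff i)) d (X:k[X])).eval x = ev q x c := by
  rw [lin_eval, ev_eq_lin _ _ _ _ hd]

theorem ker_card [IsAlgClosed k] (he : 0 < e) (c : k[X]) (h0 : c.coeff 0 ≠ 0) :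
    ∃ T : Finset k, T.card = (p^e)^c.natDegree ∧ ∀ x ∈ T, ev (p^e) x c = 0 := by
  classical
  have hp : p.Prime := Fact.out
  have hq1 : 1 < p^e := Nat.one_lt_pow he.ne' hp.one_lt
  set P := lin (p^e) (fun i => C (c.coeff i)) c.natDegree (X:k[X]) with hP
  have hd : P.derivative = C (c.coeff 0) := lin_deriv p e he _ _
  have hsep : P.Separable := by
    rw [separable_def, hd]
    exact ⟨0, C (c.coeff 0)⁻¹, by rw [zero_mul, zero_add, ← C_mul, inv_mul_cancel₀ h0, C_1]⟩
  have hc0 : c ≠ 0 := by rintro rfl; simp at h0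
  have hPd : P.natDegree = (p^e)^c.natDegree := by
    refine le_antisymm (lin_deg _ (by omega) _ _) (le_natDegree_of_ne_zero ?_)
    rw [hP, lin, finsetSum_coeff, Finset.sum_eq_single c.natDegree]
    · rw [coeff_C_mul_X_pow, if_pos rfl]; simpa using hc0
    · intro i hi hne
      rw [coeff_C_mul_X_pow, if_neg]
      intro h
      exact hne (Nat.pow_right_injective hq1 h).symm
    · simp
  refine ⟨P.roots.toFinset, ?_, ?_⟩
  · rw [Multiset.toFinset_card_of_nodup (nodup_roots hsep), ← (IsAlgClosed.splits P).natDegree_eq_card_roots, hPd]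
  · intro x hx
    rw [Multiset.mem_toFinset, mem_roots hsep.ne_zero, IsRoot, hP, ev_eval _ _ _ _ le_rfl] at hx
    exact hx

theorem ev_zero_of_many (he : 0 < e) (r : k[X]) (T : Finset k) (hT : (p^e)^r.natDegree < T.card) (h : ∀ x ∈ T, ev (p^e) x r = 0) : r = 0 := by
  classical
  have hp : p.Prime := Fact.out
  have hq1 : 1 < p^e := Nat.one_lt_pow he.ne' hp.one_lt
  set P := lin (p^e) (fun i => C (r.coeff i)) r.natDegree (X:k[X]) with hP
  have hP0 : P = 0 := by
    refine eq_zero_of_natDegree_lt_card_of_eval_eq_zero' P T ?_ ((lin_deg _ (by omega) _ _).trans_lt hT)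
    intro x hx
    rw [hP, ev_eval _ _ _ _ le_rfl, h x hx]
  by_contra hr
  have : P.coeff ((p^e)^r.natDegree) = r.leadingCoeff := by
    rw [hP, lin, finsetSum_coeff, Finset.sum_eq_single r.natDegree]
    · rw [coeff_C_mul_X_pow, if_pos rfl]; rfl
    · intro i hi hne
      rw [coeff_C_mul_X_pow, if_neg]
      intro h
      exact hne (Nat.pow_right_injective hq1 h).symm
    · simp
  rw [hP0, coeff_zero] at this
  exact hr (leadingCoeff_eq_zero.mp this.symm)

theorem division [IsAlgClosed k] (he : 0 < e) (c c' : k[X]) (h0 : c.coeff 0 ≠ 0)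
    (h : ∀ x, ev (p^e) x c = 0 → ev (p^e) x c' = 0) : ∃ ρ, c' = qcmp p e c ρ := by
  have hp : p.Prime := Fact.out
  have hq1 : 1 < p^e := Nat.one_lt_pow he.ne' hp.one_lt
  have hc0 : c ≠ 0 := by rintro rfl; simp at h0
  obtain ⟨ρ, r, hr, hr'⟩ := cmp_div p e c hc0 c'
  refine ⟨ρ, ?_⟩
  rcases hr' with hr' | hr'
  · rw [hr, hr', add_zero]
  · obtain ⟨T, hT, hT'⟩ := ker_card p e he c h0
    have : r = 0 := by
      refine ev_zero_of_many p e he r T (by rw [hT]; exact Nat.pow_lt_pow_right hq1 hr') fun x hx => ?_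
      have h1 := h x (hT' x hx)
      rw [hr, map_add, ev_cmp_zero p e x c ρ (hT' x hx), zero_add] at h1
      exact h1
    rw [hr, this, add_zero]
end skew
end part10

section part11
set_option autoImplicit false
set_option linter.unusedSectionVars false
open Polynomial

section chain
variable {k : Type*} [Field k] (p e : ℕ) [Fact p.Prime] [CharP k p]

theorem yy_sum {ι : Type*} (s : Finset ι) (f : ι → k[X]) (i : ℕ) :
    yy p e i (∑ j ∈ s, f j) = ∑ j ∈ s, yy p e i (f j) := by
  classical
  induction s using Finset.induction_on with
  | empty => simp [yy_zero]
  | insert a s ha ih => rw [Finset.sum_insert ha, Finset.sum_insert ha, yy_add, ih]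

theorem qcmp_eq_fin (c ρ : k[X]) (Δ : ℕ) (h0 : ρ.coeff 0 = 0) (hΔ : ρ.natDegree ≤ Δ) :
    qcmp p e c ρ = ∑ b : Fin Δ, ρ.coeff (b+1) • yy p e (b+1) c := by
  conv_lhs => rw [ρ.as_sum_range' (Δ+1) (by omega)]
  rw [map_sum, Finset.sum_range_succ']
  rw [h0, map_zero, map_zero, add_zero, Finset.sum_range]
  exact Finset.sum_congr rfl fun i _ => cmp_monomial p e c _ _

theorem openness (C0 : Submodule k k[X]) (Δ : ℕ) {ι : Type*} [Fintype ι] {A : Type*} [CommRing A] [Algebra k A]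
    (d : ι → A) (ee : ι → k[X]) (φ₀ : A →ₐ[k] k)
    (h : ∀ ρ : k[X], ρ.coeff 0 = 0 → ρ.natDegree ≤ Δ → qcmp p e (∑ j, φ₀ (d j) • ee j) ρ ∈ C0 → ρ = 0) :
    ∃ P : A, φ₀ P ≠ 0 ∧ ∀ φ : A →ₐ[k] k, φ P ≠ 0 →
      ∀ ρ : k[X], ρ.coeff 0 = 0 → ρ.natDegree ≤ Δ → qcmp p e (∑ j, φ (d j) • ee j) ρ ∈ C0 → ρ = 0 := by
  classical
  set c0 := ∑ j, φ₀ (d j) • ee j with hc0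
  let M : (Fin Δ → k) →ₗ[k] (k[X] ⧸ C0) := C0.mkQ ∘ₗ (Fintype.linearCombination k (fun b : Fin Δ => yy p e (b+1) c0))
  have hM : LinearMap.ker M = ⊥ := by
    rw [LinearMap.ker_eq_bot']
    intro v hv
    let ρ : k[X] := ∑ b : Fin Δ, monomial (b+1) (v b)
    have hco : ∀ b : Fin Δ, ρ.coeff (b+1) = v b := by
      intro b
      rw [show ρ = ∑ b : Fin Δ, monomial (b+1) (v b) from rfl, finsetSum_coeff, Finset.sum_eq_single b]
      · simp
      · intro b' _ hb
        rw [coeff_monomial, if_neg]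
        intro h; apply hb; ext; omega
      · simp
    have h00 : ρ.coeff 0 = 0 := by
      rw [show ρ = ∑ b : Fin Δ, monomial (b+1) (v b) from rfl, finsetSum_coeff]
      refine Finset.sum_eq_zero fun b _ => ?_
      rw [coeff_monomial, if_neg (by omega)]
    have hdeg : ρ.natDegree ≤ Δ := by
      refine natDegree_sum_le_of_forall_le _ _ fun b _ => (natDegree_monomial_le _).trans (by omega)
    have hz := h ρ h00 hdeg (by
      rw [qcmp_eq_fin p e c0 ρ Δ h00 hdeg]
      simp only [hco]
      have := (Submodule.Quotient.mk_eq_zero C0).mp hv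
      simpa [Fintype.linearCombination_apply] using this)
    funext b
    rw [← hco b, hz]; simp
  obtain ⟨l, hl⟩ := LinearMap.exists_leftInverse_of_injective M hM
  let Mat : Matrix (Fin Δ) (Fin Δ) A := fun a b => ∑ j, d j^((p^e)^((b:ℕ)+1)) * algebraMap k A (l (C0.mkQ (yy p e (b+1) (ee j))) a)
  have hMat : ∀ φ : A →ₐ[k] k, ∀ a b : Fin Δ, φ (Mat a b) = l (C0.mkQ (yy p e ((b:ℕ)+1) (∑ j, φ (d j) • ee j))) a := by
    intro φ a b
    simp only [Mat, map_sum, map_mul, map_pow, AlgHom.commutes, yy_sum, yy_smul, map_smul, Finset.sum_apply, Pi.smul_apply, smul_eq_mul]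
    rfl
  have hdet : ∀ φ : A →ₐ[k] k, φ Mat.det = Matrix.det (fun a b : Fin Δ => l (C0.mkQ (yy p e ((b:ℕ)+1) (∑ j, φ (d j) • ee j))) a) := by
    intro φ
    rw [AlgHom.map_det]
    congr 1
    ext a b
    exact hMat φ a b
  refine ⟨Mat.det, ?_, ?_⟩
  · rw [hdet]
    have : (fun (a b : Fin Δ) => l (C0.mkQ (yy p e ((b:ℕ)+1) (∑ j, φ₀ (d j) • ee j))) a) = (1 : Matrix (Fin Δ) (Fin Δ) k) := by
      ext a b
      have h1 : C0.mkQ (yy p e ((b:ℕ)+1) c0) = M (Pi.single b 1) := by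
        simp [M, Fintype.linearCombination_apply_single]
      rw [← hc0, h1, ← LinearMap.comp_apply, hl, LinearMap.id_apply, Matrix.one_apply, Pi.single_apply]
    rw [this, Matrix.det_one]
    exact one_ne_zero
  · intro φ hφ ρ h00 hdeg hρ
    rw [hdet] at hφ
    have hv : (fun b : Fin Δ => ρ.coeff (b+1)) = 0 := by
      apply Matrix.eq_zero_of_mulVec_eq_zero hφ
      funext a
      rw [qcmp_eq_fin p e _ ρ Δ h00 hdeg] at hρ
      have h1 := (Submodule.Quotient.mk_eq_zero C0).mpr hρ
      have h2 := congrArg (fun y => l y a) h1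
      simp only [← Submodule.mkQ_apply, map_sum, map_smul, map_zero, Finset.sum_apply, Pi.smul_apply, smul_eq_mul, Pi.zero_apply] at h2
      simp only [Matrix.mulVec, dotProduct, Pi.zero_apply]
      rw [← h2]
      refine Finset.sum_congr rfl fun b _ => ?_
      rw [mul_comm]
    ext n
    rcases n with _ | n
    · simpa using h00
    · by_cases hn : n < Δ
      · simpa using congrFun hv ⟨n, hn⟩
      · rw [coeff_eq_zero_of_natDegree_lt (by omega), coeff_zero]

theorem closedness [Infinite k] (C0 : Submodule k k[X]) (Δ : ℕ) (c c' : k[X])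
    (h : ∀ S : Finset k, ∃ ε ∉ S, ∃ ρ : k[X], ρ ≠ 0 ∧ ρ.coeff 0 = 0 ∧ ρ.natDegree ≤ Δ ∧ qcmp p e (c + ε • c') ρ ∈ C0) :
    ∃ ρ : k[X], ρ ≠ 0 ∧ ρ.coeff 0 = 0 ∧ ρ.natDegree ≤ Δ ∧ qcmp p e c ρ ∈ C0 := by
  classical
  by_contra hcon
  push Not at hcon
  obtain ⟨P, hP0, hP⟩ := openness p e C0 Δ (ι := Fin 2) (A := k[X]) ![1, X] ![c, c'] (aeval (0:k)) (by
    intro ρ h0 hd hm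
    by_contra hne
    apply hcon ρ hne h0 hd
    simpa using hm)
  have hPne : P ≠ 0 := by rintro rfl; simp at hP0
  obtain ⟨ε, hε, ρ, hρ, h1, h2, h3⟩ := h P.roots.toFinset
  apply hρ
  refine hP (aeval ε) ?_ ρ h1 h2 ?_
  · intro hz
    apply hε
    rw [Multiset.mem_toFinset, mem_roots hPne]
    simpa [aeval_def] using hz
  · simpa using h3
end chain
end part11

section part12
set_option autoImplicit false
set_option linter.unusedSectionVars false
open Polynomial

section chain2
variable {k : Type*} [Field k] (p e : ℕ) [Fact p.Prime] [CharP k p]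

theorem exists_eps [Infinite k] (S : Finset k) (c b : k[X]) (D1 : ℕ) (hc : c.natDegree ≤ D1) (hb : b.natDegree = D1) (hb0 : b ≠ 0) :
    ∃ ε ∉ S, (c + ε • b).natDegree = D1 ∧ (b.coeff 0 ≠ 0 → (c + ε • b).coeff 0 ≠ 0) ∧ c + ε • b ≠ 0 := by
  classical
  have hbD : b.coeff D1 ≠ 0 := by rw [← hb]; exact leadingCoeff_ne_zero.mpr hb0
  obtain ⟨ε, hε⟩ := Infinite.exists_notMem_finset (S ∪ {-(c.coeff D1)/b.coeff D1, -(c.coeff 0)/b.coeff 0})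
  simp only [Finset.mem_union, Finset.mem_insert, Finset.mem_singleton, not_or] at hε
  obtain ⟨h1, h2, h3⟩ := hε
  have h4 : (c + ε • b).coeff D1 ≠ 0 := by
    intro h
    apply h2
    rw [coeff_add, coeff_smul, smul_eq_mul] at h
    rw [eq_div_iff hbD]; linear_combination h
  refine ⟨ε, h1, ?_, ?_, ?_⟩
  · refine le_antisymm ?_ (le_natDegree_of_ne_zero h4)
    refine (natDegree_add_le _ _).trans (max_le hc ((natDegree_smul_le _ _).trans hb.le))
  · intro hb00 h
    apply h3
    rw [coeff_add, coeff_smul, smul_eq_mul] at h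
    rw [eq_div_iff hb00]; linear_combination h
  · intro h; rw [h] at h4; simp at h4

theorem claimA [Infinite k] (C0 : Submodule k k[X]) (D : ℕ) (hD : ∀ c ∈ C0, c.natDegree ≤ D)
    (f : k[X]) (hf : f ∈ C0) (hf0 : f.coeff 0 ≠ 0) (hfD : f.natDegree < D)
    (hcon : ∀ c ∈ C0, c.coeff 0 ≠ 0 → c.natDegree < D → ∃ ρ : k[X], ρ.coeff 0 = 0 ∧ qcmp p e c ρ ∈ C0 ∧ ρ ≠ 0) :
    ∀ D1, D1 < D → (∃ c ∈ C0, c ≠ 0 ∧ c.natDegree = D1) →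
      ∃ D2, D1 < D2 ∧ (∀ m, D1 < m → m < D2 → ¬ ∃ c ∈ C0, c ≠ 0 ∧ c.natDegree = m) ∧
        ∀ c ∈ C0, c.natDegree ≤ D1 → ∃ ρ : k[X], ρ ≠ 0 ∧ ρ.coeff 0 = 0 ∧ ρ.natDegree ≤ D2 - D1 ∧ qcmp p e c ρ ∈ C0 := by
  classical
  have hfne : f ≠ 0 := by rintro rfl; simp at hf0
  intro D1
  induction hn : D - D1 using Nat.strong_induction_on generalizing D1 with
  | _ n ih =>
  rintro hD1 ⟨b, hbC, hb0, hbD⟩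
  by_cases hex : ∃ m, D1 < m ∧ m < D ∧ ∃ c ∈ C0, c ≠ 0 ∧ c.natDegree = m
  · set m := Nat.find hex with hm
    obtain ⟨hm1, hm2, hm3⟩ := Nat.find_spec hex
    obtain ⟨D2, hD2, hno, hT⟩ := ih (D - m) (by omega) m rfl hm2 hm3
    have hno' : ∀ m', D1 < m' → m' < m → ¬ ∃ c ∈ C0, c ≠ 0 ∧ c.natDegree = m' := by
      intro m' h1 h2 h3
      exact Nat.find_min hex h2 ⟨h1, by omega, h3⟩
    refine ⟨m, hm1, hno', fun c hc hcD => ?_⟩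
    refine closedness p e C0 _ c b fun S => ?_
    obtain ⟨ε, hε, hdeg, -, hne⟩ := exists_eps S c b D1 hcD hbD hb0
    have hmem : c + ε • b ∈ C0 := C0.add_mem hc (C0.smul_mem _ hbC)
    obtain ⟨ρ, hρ, hρ0, hρd, hρC⟩ := hT _ hmem (by omega)
    refine ⟨ε, hε, ρ, hρ, hρ0, ?_, hρC⟩
    have hd := cmp_natDegree p e _ ρ hne hρ
    rw [hdeg] at hd
    by_contra hlt
    exact hno (ρ.natDegree + D1) (by omega) (by omega) ⟨_, hρC, cmp_ne_zero p e _ ρ hne hρ, hd⟩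
  · push Not at hex
    have hno : ∀ m', D1 < m' → m' < D → ¬ ∃ c ∈ C0, c ≠ 0 ∧ c.natDegree = m' := by
      rintro m' h1 h2 ⟨c, hc, hc0, hcm⟩
      exact hex m' h1 h2 c hc hc0 hcm
    have hfD1 : f.natDegree ≤ D1 := by
      by_contra hlt
      exact hno _ (by omega) hfD ⟨f, hf, hfne, rfl⟩
    obtain ⟨b', hb'C, hb'0, hb'D⟩ : ∃ b' ∈ C0, b'.coeff 0 ≠ 0 ∧ b'.natDegree = D1 := by
      by_cases h1 : b.coeff 0 ≠ 0
      · exact ⟨b, hbC, h1, hbD⟩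
      push Not at h1
      rcases hfD1.lt_or_eq with h2 | h2
      · refine ⟨f + b, C0.add_mem hf hbC, by simpa [h1] using hf0, ?_⟩
        rw [natDegree_add_eq_right_of_natDegree_lt (by omega), hbD]
      · exact ⟨f, hf, hf0, h2⟩
    have hb'ne : b' ≠ 0 := by rintro rfl; simp at hb'0
    refine ⟨D, hD1, hno, fun c hc hcD => ?_⟩
    refine closedness p e C0 _ c b' fun S => ?_
    obtain ⟨ε, hε, hdeg, h0, hne⟩ := exists_eps S c b' D1 hcD hb'D hb'ne
    have hmem : c + ε • b' ∈ C0 := C0.add_mem hc (C0.smul_mem _ hb'C)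
    obtain ⟨ρ, hρ0, hρC, hρ⟩ := hcon _ hmem (h0 hb'0) (by omega)
    refine ⟨ε, hε, ρ, hρ, hρ0, ?_, hρC⟩
    have hd := cmp_natDegree p e _ ρ hne hρ
    have := hD _ hρC
    omega

theorem claimP [IsAlgClosed k] (he : 0 < e) (C0 : Submodule k k[X]) (D : ℕ) (hD : ∀ c ∈ C0, c.natDegree ≤ D)
    (f : k[X]) (hf : f ∈ C0) (hf0 : f.coeff 0 ≠ 0) (hfD : f.natDegree < D) (t : ℕ) (ht : (X:k[X])^t ∈ C0)
    (h1 : (1 : k[X]) ∉ C0) :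
    ∃ c ∈ C0, c.coeff 0 ≠ 0 ∧ c.natDegree < D ∧ ∀ ρ : k[X], ρ.coeff 0 = 0 → qcmp p e c ρ ∈ C0 → ρ = 0 := by
  classical
  have hp : p.Prime := Fact.out
  have hq1 : 1 < p^e := Nat.one_lt_pow he.ne' hp.one_lt
  haveI : Infinite k := IsAlgClosed.instInfinite
  by_contra hcon
  push Not at hcon
  have hA := claimA p e C0 D hD f hf hf0 hfD hcon
  have hfne : f ≠ 0 := by rintro rfl; simp at hf0
  -- minimal degree element
  have hex : ∃ m, ∃ c ∈ C0, c ≠ 0 ∧ c.natDegree = m := ⟨_, f, hf, hfne, rfl⟩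
  obtain ⟨c1, hc1, hc10, hc1d⟩ := Nat.find_spec hex
  have hmin : ∀ c ∈ C0, c ≠ 0 → c1.natDegree ≤ c.natDegree := by
    intro c hc hc0
    rw [hc1d]
    exact Nat.find_min' hex ⟨c, hc, hc0, rfl⟩
  have hN : ∃ c ∈ C0, c ∉ LinearMap.range (qcmp p e c1) := by
    by_contra hall
    push Not at hall
    by_cases h0 : c1.coeff 0 = 0
    · obtain ⟨ρ, hρ⟩ := hall f hf
      have := cmp_coeff_zero p e c1 ρ
      rw [hρ, h0, mul_zero] at this
      exact hf0 this
    · by_cases hd0 : c1.natDegree = 0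
      · apply h1
        have := C0.smul_mem (c1.coeff 0)⁻¹ hc1
        rw [eq_C_of_natDegree_eq_zero hd0] at this
        simpa [smul_C, h0] using this
      · obtain ⟨T, hT, hT'⟩ := ker_card p e he c1 h0
        have : 1 < T.card := by rw [hT]; exact Nat.one_lt_pow hd0 hq1
        obtain ⟨x, hx, hx0⟩ := Finset.exists_mem_ne this 0
        obtain ⟨ρ, hρ⟩ := hall _ ht
        have h2 := ev_cmp_zero p e x c1 ρ (hT' x hx)
        rw [hρ, X_pow_eq_monomial, ev_monomial, one_mul] at h2
        exact hx0 (pow_eq_zero_iff (pow_ne_zero _ (by omega)) |>.mp h2)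
  have hex2 : ∃ m, ∃ c ∈ C0, c ∉ LinearMap.range (qcmp p e c1) ∧ c.natDegree = m := by
    obtain ⟨c, hc, hcN⟩ := hN
    exact ⟨_, c, hc, hcN, rfl⟩
  obtain ⟨b, hb, hbN, hbd⟩ := Nat.find_spec hex2
  have hbmin : ∀ c ∈ C0, c.natDegree < b.natDegree → c ∈ LinearMap.range (qcmp p e c1) := by
    intro c hc hcd
    by_contra hcN
    rw [hbd] at hcd
    exact Nat.find_min hex2 hcd ⟨c, hc, hcN, rfl⟩
  have hb0 : b ≠ 0 := by rintro rfl; exact hbN (Submodule.zero_mem _)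
  have hc1N : c1 ∈ LinearMap.range (qcmp p e c1) := ⟨monomial 0 1, by rw [cmp_monomial, one_smul, yy_zero_idx]⟩
  -- key: no nonzero element of N∩C of the same degree as b
  have key : ∀ g ∈ C0, g ≠ 0 → g.natDegree = b.natDegree → g ∈ LinearMap.range (qcmp p e c1) → False := by
    intro g hg hg0 hgd hgN
    apply hbN
    set a := b.leadingCoeff / g.leadingCoeff with ha
    have ha0 : a ≠ 0 := div_ne_zero (leadingCoeff_ne_zero.mpr hb0) (leadingCoeff_ne_zero.mpr hg0)
    have hsub : b - a • g ∈ C0 := C0.sub_mem hb (C0.smul_mem _ hg)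
    have : b - a • g ∈ LinearMap.range (qcmp p e c1) := by
      by_cases hz : b - a • g = 0
      · rw [hz]; exact Submodule.zero_mem _
      · apply hbmin _ hsub
        have hag : a • g ≠ 0 := smul_ne_zero ha0 hg0
        refine natDegree_lt_natDegree hz (degree_sub_lt_left ?_ hb0 ?_)
        · rw [degree_eq_natDegree hb0, degree_eq_natDegree hag, natDegree_smul _ ha0, hgd]
        · rw [smul_eq_C_mul, leadingCoeff_C_mul_of_isUnit (isUnit_iff_ne_zero.mpr ha0), ha,
            div_mul_cancel₀ _ (leadingCoeff_ne_zero.mpr hg0)]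
    have h2 := Submodule.add_mem _ this (Submodule.smul_mem _ a hgN)
    simpa using h2
  have hlt : c1.natDegree < b.natDegree := by
    rcases (hmin b hb hb0).lt_or_eq with h | h
    · exact h
    · exact (key c1 hc1 hc10 h hc1N).elim
  -- maximal degree below b
  obtain ⟨D1, hD1, hD1max⟩ : ∃ D1, (D1 < b.natDegree ∧ ∃ c ∈ C0, c ≠ 0 ∧ c.natDegree = D1) ∧
      ∀ m, D1 < m → m < b.natDegree → ¬ ∃ c ∈ C0, c ≠ 0 ∧ c.natDegree = m := by
    let P : ℕ → Prop := fun m => m < b.natDegree ∧ ∃ c ∈ C0, c ≠ 0 ∧ c.natDegree = m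
    have hP : P c1.natDegree := ⟨hlt, c1, hc1, hc10, rfl⟩
    refine ⟨Nat.findGreatest P b.natDegree, Nat.findGreatest_spec (P := P) hlt.le hP, ?_⟩
    intro m h2 h3 h4
    exact Nat.findGreatest_is_greatest h2 h3.le ⟨h3, h4⟩
  obtain ⟨hD1b, c, hc, hc0, hcd⟩ := hD1
  have hcN := hbmin c hc (by omega)
  obtain ⟨D2, hD12, hno, hT⟩ := hA D1 (by have := hD b hb; omega) ⟨c, hc, hc0, hcd⟩
  obtain ⟨ρ, hρ, hρ0, hρd, hρC⟩ := hT c hc hcd.le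
  have hD2b : D2 ≤ b.natDegree := by
    by_contra h
    exact hno b.natDegree hD1b (by omega) ⟨b, hb, hb0, rfl⟩
  have hρ1 : 1 ≤ ρ.natDegree := by
    by_contra h
    apply hρ
    rw [eq_C_of_natDegree_eq_zero (by omega : ρ.natDegree = 0), hρ0, C_0]
  have hdd := cmp_natDegree p e c ρ hc0 hρ
  have hne := cmp_ne_zero p e c ρ hc0 hρ
  refine key _ hρC hne ?_ ?_
  · by_contra h
    exact hD1max _ (by omega) (by omega) ⟨_, hρC, hne, hdd⟩
  · obtain ⟨σ, hσ⟩ := hcN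
    obtain ⟨τ, hτ⟩ := cmp_assoc p e c1 σ ρ
    exact ⟨τ, by rw [← hτ, hσ]⟩
end chain2
end part12

section part13
set_option autoImplicit false
set_option linter.unusedSectionVars false
open Polynomial

section sel
theorem selVec {k : Type*} [Field k] {ι : Type*} [Fintype ι] [DecidableEq ι] (S : Set (ι → k)) (c0 : ι → k) (ds : ι → k)
    (hds : ds ≠ 0) (hdS : ∀ s ∈ S, ∑ j, ds j * s j = 0)
    (hker : ∀ d : ι → k, (∀ s ∈ S, ∑ j, d j * s j = 0) → ∑ j, d j * c0 j = 0 → d = 0) (j1 : ι) :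
    ∃ v : ι → (ι → k), (∀ a, a ≠ j1 → v a ∈ S) ∧
      ∀ d : ι → k, (∀ a, a ≠ j1 → ∑ j, d j * v a j = 0) → ∀ s ∈ S, ∑ j, d j * s j = 0 := by
  classical
  obtain ⟨b, hbS, hspan, hli⟩ := exists_linearIndependent k S
  haveI : Fintype b := hli.setFinite.fintype
  let dot : (ι → k) → ((ι → k) →ₗ[k] k) := fun d => Fintype.linearCombination k d
  have hdot : ∀ d s, dot d s = ∑ j, d j * s j := by
    intro d s
    simp only [dot, Fintype.linearCombination_apply, smul_eq_mul]
    exact Finset.sum_congr rfl fun _ _ => mul_comm _ _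
  have hbspan : ∀ d : ι → k, (∀ s ∈ b, ∑ j, d j * s j = 0) → ∀ s ∈ S, ∑ j, d j * s j = 0 := by
    intro d hd s hs
    have h1 : Submodule.span k S ≤ LinearMap.ker (dot d) := by
      rw [← hspan, Submodule.span_le]
      intro y hy
      simp only [SetLike.mem_coe, LinearMap.mem_ker, hdot]
      exact hd y hy
    have := h1 (Submodule.subset_span hs)
    rwa [LinearMap.mem_ker, hdot] at this
  have hlt : Fintype.card b < Fintype.card ι := by
    have h1 : Submodule.span k b ≠ ⊤ := by
      intro htop
      apply hds
      have h2 : Submodule.span k b ≤ LinearMap.ker (dot ds) := by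
        rw [Submodule.span_le]
        intro y hy
        simp only [SetLike.mem_coe, LinearMap.mem_ker, hdot]
        exact hdS y (hbS hy)
      rw [htop] at h2
      funext j
      have := h2 (Submodule.mem_top (x := Pi.single j (1:k)))
      rw [LinearMap.mem_ker, hdot] at this
      simpa [Pi.single_apply] using this
    have h3 := Submodule.finrank_lt h1
    rw [Module.finrank_fintype_fun_eq_card] at h3
    rwa [finrank_span_set_eq_card hli, Set.toFinset_card] at h3
  have hge : Fintype.card ι ≤ Fintype.card b + 1 := by
    let Φ : (ι → k) →ₗ[k] (Option b → k) :=
      LinearMap.pi (fun o => Fintype.linearCombination k (fun j => match o with | none => c0 j | some s => s.1 j))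
    have hinj : Function.Injective Φ := by
      rw [← LinearMap.ker_eq_bot, LinearMap.ker_eq_bot']
      intro d hd
      refine hker d (hbspan d fun s hs => ?_) ?_
      · have := congrFun hd (some ⟨s, hs⟩)
        simpa [Φ, Fintype.linearCombination_apply] using this
      · have := congrFun hd none
        simpa [Φ, Fintype.linearCombination_apply] using this
    have := LinearMap.finrank_le_finrank_of_injective hinj
    rwa [Module.finrank_fintype_fun_eq_card, Module.finrank_fintype_fun_eq_card, Fintype.card_option] at this
  have hcard : Fintype.card {j // ¬ j = j1} = Fintype.card b := by
    rw [Fintype.card_subtype_compl, Fintype.card_subtype_eq]; omega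
  let σ := Fintype.equivOfCardEq hcard
  refine ⟨fun a => if h : ¬ a = j1 then (σ ⟨a, h⟩).1 else 0, ?_, ?_⟩
  · intro a ha
    simp only [ha, not_false_eq_true, dif_pos]
    exact hbS (σ ⟨a, ha⟩).2
  · intro d hd
    apply hbspan
    intro s hs
    have h1 := hd (σ.symm ⟨s, hs⟩).1 (σ.symm ⟨s, hs⟩).2
    have h2 : ¬ (σ.symm ⟨s, hs⟩).1 = j1 := (σ.symm ⟨s, hs⟩).2
    simpa [h2] using h1
end sel

section main4
variable {k : Type*} [Field k] (p e : ℕ) [Fact p.Prime] [CharP k p]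

theorem span_mem {ι : Type*} [Fintype ι] (ee : ι → k[X]) (b : k[X]) (c : k[X])
    (hc : c ∈ Submodule.span k (Set.range ee) ⊔ Submodule.span k {b}) : ∃ (d : ι → k) (β : k), c = ∑ j, d j • ee j + β • b := by
  rw [Submodule.mem_sup] at hc
  obtain ⟨y, hy, z, hz, rfl⟩ := hc
  rw [← Fintype.range_linearCombination] at hy
  obtain ⟨d, rfl⟩ := hy
  obtain ⟨β, rfl⟩ := Submodule.mem_span_singleton.mp hz
  exact ⟨d, β, by rw [Fintype.linearCombination_apply]⟩

theorem mem_span {ι : Type*} [Fintype ι] (ee : ι → k[X]) (b : k[X]) (d : ι → k) (β : k) :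
    ∑ j, d j • ee j + β • b ∈ Submodule.span k (Set.range ee) ⊔ Submodule.span k {b} := by
  refine Submodule.add_mem_sup ?_ (Submodule.smul_mem _ _ (Submodule.mem_span_singleton_self b))
  exact Submodule.sum_mem _ fun j _ => Submodule.smul_mem _ _ (Submodule.subset_span ⟨j, rfl⟩)

/-- step 1: a generic parametrisation. -/
theorem param [IsAlgClosed k] (he : 0 < e) {ι : Type*} [Fintype ι] [DecidableEq ι] (ee : ι → k[X]) (b : k[X]) (D : ℕ)
    (hbD : b.natDegree = D) (hee : ∀ j, (ee j).natDegree < D) (hli : LinearIndependent k ee)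
    (f : k[X]) (hf : f ∈ Submodule.span k (Set.range ee)) (hf0 : f.coeff 0 ≠ 0) (t : ℕ) 
    (ht : (X:k[X])^t ∈ Submodule.span k (Set.range ee))
    (h1 : (1:k[X]) ∉ Submodule.span k (Set.range ee) ⊔ Submodule.span k {b}) (j1 : ι) :
    ∃ (P : MvPolynomial ι k) (a : k), a ≠ 0 ∧ P ≠ 0 ∧ ∀ w : ι → k, MvPolynomial.eval w P ≠ 0 →
      ∀ B : Matrix ι ι k, B = (Matrix.of fun x j => if x = j1 then (ee j).coeff 0 else ev (p^e) (w x) (ee j)) →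
      B.det ≠ 0 ∧ ∀ ρ : k[X], ρ.coeff 0 = 0 → ρ.natDegree ≤ D →
        qcmp p e (a • ∑ j, B.adjugate j j1 • ee j) ρ ∈ Submodule.span k (Set.range ee) ⊔ Submodule.span k {b} → ρ = 0 := by
  classical
  set E0 := Submodule.span k (Set.range ee) with hE0
  set C0 := E0 ⊔ Submodule.span k {b} with hC0
  have hD0 : 0 < D := lt_of_le_of_lt (Nat.zero_le _) (hee j1)
  have hb0 : b.coeff D ≠ 0 := by
    rw [← hbD]; refine leadingCoeff_ne_zero.mpr ?_
    rintro rfl; simp at hbD; omega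
  have hdegE : ∀ d : ι → k, (∑ j, d j • ee j).natDegree < D := by
    intro d
    have : (∑ j, d j • ee j).natDegree ≤ D - 1 :=
      natDegree_sum_le_of_forall_le _ _ fun j _ => (natDegree_smul_le _ _).trans (by have := hee j; omega)
    omega
  have hmemE : ∀ c ∈ E0, ∃ d : ι → k, c = ∑ j, d j • ee j := by
    intro c hc
    rw [hE0, ← Fintype.range_linearCombination] at hc
    obtain ⟨d, rfl⟩ := hc
    exact ⟨d, by rw [Fintype.linearCombination_apply]⟩
  have hinj : ∀ d d' : ι → k, ∑ j, d j • ee j = ∑ j, d' j • ee j → d = d' := by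
    intro d d' h
    have := Fintype.linearIndependent_iff.mp hli (d - d') (by simp [sub_smul, h])
    funext j
    exact sub_eq_zero.mp (this j)
  obtain ⟨cs, hcs, hcs0, hcsD, hcsP⟩ := claimP p e he C0 D
    (by
      intro c hc
      obtain ⟨d, β, rfl⟩ := span_mem ee b c hc
      refine (natDegree_add_le _ _).trans (max_le (hdegE d).le ((natDegree_smul_le _ _).trans hbD.le)))
    f (le_sup_left (a := E0) hf) hf0 (by obtain ⟨d, rfl⟩ := hmemE f hf; exact hdegE d) t (le_sup_left (a := E0) ht) h1
  obtain ⟨ds, hds⟩ : ∃ d : ι → k, cs = ∑ j, d j • ee j := by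
    obtain ⟨d, β, hd⟩ := span_mem ee b cs hcs
    have h2 := congrArg (fun P => coeff P D) hd
    simp only [coeff_add, coeff_smul, smul_eq_mul] at h2
    rw [coeff_eq_zero_of_natDegree_lt hcsD, coeff_eq_zero_of_natDegree_lt (hdegE d), zero_add] at h2
    have hβ : β = 0 := (mul_eq_zero.mp h2.symm).resolve_right hb0
    exact ⟨d, by rw [hd, hβ, zero_smul, add_zero]⟩
  have hevs : ∀ (u : k) (d : ι → k), ev (p^e) u (∑ j, d j • ee j) = ∑ j, d j * ev (p^e) u (ee j) := by
    intro u d; simp [map_sum]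
  have hco : ∀ (d : ι → k), (∑ j, d j • ee j).coeff 0 = ∑ j, d j * (ee j).coeff 0 := by
    intro d; simp [finsetSum_coeff]
  have hkerc : ∀ d : ι → k, (∀ u, ev (p^e) u cs = 0 → ev (p^e) u (∑ j, d j • ee j) = 0) → ∃ a : k, d = a • ds := by
    intro d hd
    obtain ⟨ρ, hρ⟩ := division p e he cs _ hcs0 hd
    have h3 : ρ - monomial 0 (ρ.coeff 0) = 0 := by
      apply hcsP
      · simp
      · rw [map_sub, ← hρ, cmp_monomial, yy_zero_idx]
        refine Submodule.sub_mem _ ?_ (Submodule.smul_mem _ _ hcs)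
        have := mem_span ee b d 0
        rwa [zero_smul, add_zero] at this
    refine ⟨ρ.coeff 0, hinj _ _ ?_⟩
    rw [hρ, sub_eq_zero.mp h3, cmp_monomial, yy_zero_idx]
    simp [hds, Finset.smul_sum, mul_smul]
  have hdsne : ds ≠ 0 := by
    rintro rfl
    rw [hds] at hcs0; simp at hcs0
  obtain ⟨v, hvS, hv⟩ := selVec {s : ι → k | ∃ u, ev (p^e) u cs = 0 ∧ s = fun j => ev (p^e) u (ee j)}
    (fun j => (ee j).coeff 0) ds hdsne
    (by rintro s ⟨u, hu, rfl⟩; rw [← hevs, ← hds, hu])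
    (by
      intro d hd hd0
      obtain ⟨a, rfl⟩ := hkerc d (fun u hu => by rw [hevs]; exact hd _ ⟨u, hu, rfl⟩)
      rw [← hco] at hd0
      have : (∑ j, (a • ds) j • ee j) = a • cs := by simp [hds, Finset.smul_sum, mul_smul]
      rw [this, coeff_smul, smul_eq_mul] at hd0
      rw [(mul_eq_zero.mp hd0).resolve_right hcs0, zero_smul]) j1
  choose! ws hws0 hws using hvS
  have hkerw : ∀ d : ι → k, (∀ x, x ≠ j1 → ev (p^e) (ws x) (∑ j, d j • ee j) = 0) → ∃ a : k, d = a • ds := by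
    intro d hd
    apply hkerc
    intro u hu
    rw [hevs]
    refine hv d ?_ _ ⟨u, hu, rfl⟩
    intro x hx
    rw [hws x hx, ← hevs]
    exact hd x hx
  let BA : Matrix ι ι (MvPolynomial ι k) := Matrix.of fun x j =>
    if x = j1 then MvPolynomial.C ((ee j).coeff 0) else lin (p^e) (fun i => MvPolynomial.C ((ee j).coeff i)) D (MvPolynomial.X x)
  let Bw : (ι → k) → Matrix ι ι k := fun w => Matrix.of fun x j => if x = j1 then (ee j).coeff 0 else ev (p^e) (w x) (ee j)
  have hBA : ∀ w : ι → k, (MvPolynomial.aeval w : MvPolynomial ι k →ₐ[k] k).mapMatrix BA = Bw w := by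
    intro w
    ext x j
    simp only [AlgHom.mapMatrix_apply, Matrix.map_apply, BA, Bw, Matrix.of_apply]
    split_ifs
    · simp
    · rw [ev_eq_lin _ _ _ D (hee j).le]
      have := lin_map (MvPolynomial.aeval w : MvPolynomial ι k →ₐ[k] k).toRingHom (p^e) (fun i => MvPolynomial.C ((ee j).coeff i)) D (MvPolynomial.X x)
      simpa using this
  have hadj : ∀ (w : ι → k) j, (MvPolynomial.aeval w : MvPolynomial ι k →ₐ[k] k) (BA.adjugate j j1) = (Bw w).adjugate j j1 := by
    intro w j
    rw [← hBA, ← AlgHom.map_adjugate]; rfl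
  have hdetw : ∀ (w : ι → k), (MvPolynomial.aeval w : MvPolynomial ι k →ₐ[k] k) BA.det = (Bw w).det := by
    intro w
    rw [← hBA, ← AlgHom.map_det]
  have hmul : ∀ (w : ι → k) x, ∑ j, (Bw w).adjugate j j1 * Bw w x j = if x = j1 then (Bw w).det else 0 := by
    intro w x
    have := congrFun (congrFun (Matrix.mul_adjugate (Bw w)) x) j1
    rw [Matrix.mul_apply, Matrix.smul_apply, Matrix.one_apply] at this
    simp only [smul_eq_mul, mul_ite, mul_one, mul_zero] at this
    rw [← this]
    exact Finset.sum_congr rfl fun _ _ => mul_comm _ _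
  have hdets : (Bw ws).det ≠ 0 := by
    intro h
    obtain ⟨d, hd0, hd⟩ := Matrix.exists_mulVec_eq_zero_iff.mpr h
    apply hd0
    have hdx : ∀ x, ∑ j, d j * Bw ws x j = 0 := by
      intro x
      rw [← Pi.zero_apply (M := fun _ => k) x, ← hd]
      simp only [Matrix.mulVec, dotProduct]
      exact Finset.sum_congr rfl fun _ _ => mul_comm _ _
    obtain ⟨a, rfl⟩ := hkerw d (by
      intro x hx
      rw [hevs]
      have := hdx x
      simpa [Bw, hx] using this)
    have h0 := hdx j1
    simp only [Bw, Matrix.of_apply, if_true] at h0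
    rw [← hco] at h0
    have : (∑ j, (a • ds) j • ee j) = a • cs := by simp [hds, Finset.smul_sum, mul_smul]
    rw [this, coeff_smul, smul_eq_mul] at h0
    rw [(mul_eq_zero.mp h0).resolve_right hcs0, zero_smul]
  obtain ⟨a, ha⟩ := hkerw (fun j => (Bw ws).adjugate j j1) (by
    intro x hx
    rw [hevs]
    have := hmul ws x
    simpa [Bw, hx] using this)
  have ha0 : a ≠ 0 := by
    rintro rfl
    have := hmul ws j1
    rw [if_pos rfl] at this
    apply hdets
    rw [← this]
    refine Finset.sum_eq_zero fun j _ => ?_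
    have := congrFun ha j
    simp only [zero_smul, Pi.zero_apply] at this
    rw [this, zero_mul]
  have hexp : ∀ w : ι → k, ∑ j, (MvPolynomial.aeval w : MvPolynomial ι k →ₐ[k] k) (MvPolynomial.C a⁻¹ * BA.adjugate j j1) • ee j
      = a⁻¹ • ∑ j, (Bw w).adjugate j j1 • ee j := by
    intro w
    rw [Finset.smul_sum]
    refine Finset.sum_congr rfl fun j _ => ?_
    rw [map_mul, hadj, mul_smul]
    simp
  obtain ⟨P, hP0, hP⟩ := openness p e C0 D (A := MvPolynomial ι k) (fun j => MvPolynomial.C a⁻¹ * BA.adjugate j j1) ee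
    (MvPolynomial.aeval ws) (by
      intro ρ h0 _ hm
      apply hcsP ρ h0
      rw [hexp] at hm
      have : a⁻¹ • ∑ j, (Bw ws).adjugate j j1 • ee j = cs := by
        have h2 : ∀ j, (Bw ws).adjugate j j1 = a * ds j := fun j => congrFun ha j
        simp only [h2, mul_smul]
        rw [← Finset.smul_sum, ← hds, smul_smul, inv_mul_cancel₀ ha0, one_smul]
      rwa [this] at hm)
  refine ⟨P * BA.det, a⁻¹, inv_ne_zero ha0, ?_, ?_⟩
  · intro h
    have := congrArg (MvPolynomial.aeval ws : MvPolynomial ι k →ₐ[k] k) h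
    rw [map_mul, hdetw, map_zero] at this
    exact mul_ne_zero hP0 hdets this
  · rintro w hw B rfl
    have hw' : (MvPolynomial.aeval w : MvPolynomial ι k →ₐ[k] k) (P * BA.det) ≠ 0 := by
      rwa [MvPolynomial.aeval_eq_eval]
    rw [map_mul, hdetw] at hw'
    refine ⟨right_ne_zero_of_mul hw', fun ρ h0 hd hm => ?_⟩
    refine hP (MvPolynomial.aeval w) (left_ne_zero_of_mul hw') ρ h0 hd ?_
    rw [hexp]
    exact hm
end main4
end part13

section part14
set_option autoImplicit false
set_option linter.unusedSectionVars false
open Polynomial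

section main4b
variable {k : Type*} [Field k] (p e : ℕ) [Fact p.Prime] [CharP k p]

theorem inj_zeros [IsAlgClosed k] (he : 0 < e) {ι : Type*} [Fintype ι] [DecidableEq ι] (ee : ι → k[X])
    (B : Matrix ι ι k) (w : ι → k) (j1 : ι)
    (hB : B = (Matrix.of fun x j => if x = j1 then (ee j).coeff 0 else ev (p^e) (w x) (ee j)))
    (hdet : B.det ≠ 0) (c g : k[X]) (x z : k)
    (hcx : ev (p^e) x c ≠ 0) (hcg : ev (p^e) x c * ev (p^e) z g - ev (p^e) x g * ev (p^e) z c = 0)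
    (hcw : ∀ a, a ≠ j1 → ev (p^e) (w a) c = 0) (hgw : ∀ a, a ≠ j1 → ev (p^e) (w a) g = 0)
    (hz : ∀ α v, α^(p^e) = α → ev (p^e) v c = 0 → ev (p^e) v g = 0 → z ≠ α*x+v) (s : ℕ)
    (hqs : ∀ α : k, α^(p^e) = α → α^(p^s) = α) (hx : x^(p^s) = x) (hzs : z^(p^s) = z)
    (hw : ∀ a, (w a)^(p^s) = w a) :
    ∃ Z : Finset k, Z.card = (p^e)^(Fintype.card ι+1) ∧ ∀ y ∈ Z, y^(p^s) = y ∧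
      ev (p^e) y (ev (p^e) x c • g - ev (p^e) x g • c) = 0 := by
  classical
  have hp : p.Prime := Fact.out
  obtain ⟨T, hT, hTm⟩ := fixedCard k p hp e he.ne'
  let Θ : k × (ι → k) → k := fun v => v.1 * z + (v.2 j1 * x + ∑ a, (if a = j1 then 0 else v.2 a) * w a)
  have hev : ∀ (v : k × (ι → k)), v.1^(p^e) = v.1 → (∀ a, v.2 a^(p^e) = v.2 a) → ∀ h : k[X],
      ev (p^e) (Θ v) h = v.1 * ev (p^e) z h + (v.2 j1 * ev (p^e) x h + ∑ a, (if a = j1 then 0 else v.2 a) * ev (p^e) (w a) h) := by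
    intro v h1 h2 h
    simp only [Θ]
    rw [ev_add, ev_add, ev_sum, ev_smul _ _ _ _ h1, ev_smul _ _ _ _ (h2 j1)]
    congr 2
    refine Finset.sum_congr rfl fun a _ => ?_
    apply ev_smul
    split_ifs
    · exact zero_pow (pow_ne_zero _ hp.ne_zero)
    · exact h2 a
  have hsumc : ∀ (β : ι → k) (h : k[X]), (∀ a, a ≠ j1 → ev (p^e) (w a) h = 0) → 
     ∑ a, (if a = j1 then 0 else β a) * ev (p^e) (w a) h = 0 := by
    intro β h hh
    refine Finset.sum_eq_zero fun a _ => ?_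
    split_ifs with h1
    · simp
    · rw [hh a h1, mul_zero]
  have hker : ∀ v : k × (ι → k), v.1^(p^e) = v.1 → (∀ a, v.2 a^(p^e) = v.2 a) → Θ v = 0 → v = 0 := by
    intro v h1 h2 h3
    have hev' := hev v h1 h2
    rw [h3] at hev'
    have hev0 : ∀ h : k[X], ev (p^e) 0 h = 0 := by
      intro h
      have := ev_smul (p^e) h 0 0 (zero_pow (pow_ne_zero _ hp.ne_zero))
      simpa using this
    have hv1 : v.1 = 0 := by
      by_contra hne
      refine hz (-(v.1⁻¹ * v.2 j1)) (-(v.1⁻¹) * ∑ a, (if a = j1 then 0 else v.2 a) * w a) ?_ ?_ ?_ ?_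
      · have : (-(v.1⁻¹ * v.2 j1)) = 0 - v.1⁻¹ * v.2 j1 := by ring
        rw [this, sub_pow_char_pow, mul_pow, inv_pow, h1, h2, zero_pow (pow_ne_zero _ hp.ne_zero)]
      all_goals try
        rw [ev_smul, ev_sum]
        · convert mul_zero _
          refine Finset.sum_eq_zero fun a _ => ?_
          split_ifs with h5
          · rw [zero_mul, hev0]
          · rw [ev_smul _ _ _ _ (h2 a)]
            first | rw [hcw a h5, mul_zero] | rw [hgw a h5, mul_zero]
        · have : (-(v.1⁻¹)) = 0 - v.1⁻¹ := by ring
          rw [this, sub_pow_char_pow, inv_pow, h1, zero_pow (pow_ne_zero _ hp.ne_zero)]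
      · simp only [Θ] at h3
        field_simp
        linear_combination h3
    have hc' := hev' c
    rw [hev0, hv1, hsumc _ _ hcw] at hc'
    have hb1 : v.2 j1 = 0 := by
      have : v.2 j1 * ev (p^e) x c = 0 := by linear_combination -hc'
      exact (mul_eq_zero.mp this).resolve_right hcx
    have hv2 : v.2 = 0 := by
      apply Matrix.eq_zero_of_vecMul_eq_zero hdet
      ext j
      have h6 := hev' (ee j)
      rw [hev0, hv1, hb1] at h6
      simp only [Matrix.vecMul, dotProduct, Pi.zero_apply, hB, Matrix.of_apply]
      rw [zero_mul, zero_mul, zero_add, zero_add] at h6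
      rw [h6]
      refine Finset.sum_congr rfl fun a _ => ?_
      split_ifs with h7
      · subst h7; rw [hb1]; simp
      · rfl
    exact Prod.ext hv1 hv2
  let S : Finset (k × (ι → k)) := T ×ˢ Fintype.piFinset (fun _ => T)
  have hSm : ∀ v, v ∈ S → v.1^(p^e) = v.1 ∧ ∀ a, v.2 a^(p^e) = v.2 a := by
    intro v hv
    simp only [S, Finset.mem_product, Fintype.mem_piFinset, hTm] at hv
    exact hv
  refine ⟨S.image Θ, ?_, ?_⟩
  · rw [Finset.card_image_of_injOn]
    · simp only [S, Finset.card_product, Fintype.card_piFinset, hT, Finset.prod_const, Finset.card_univ]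
      ring
    · intro v hv v' hv' h
      have h1 := hSm v hv
      have h2 := hSm v' hv'
      rw [← sub_eq_zero]
      apply hker
      · simp only [Prod.fst_sub]; rw [sub_pow_char_pow, h1.1, h2.1]
      · intro a
        simp only [Prod.snd_sub, Pi.sub_apply]; rw [sub_pow_char_pow, h1.2, h2.2]
      · have h3 : Θ (v - v') = Θ v - Θ v' := by
          simp only [Θ, Prod.fst_sub, Prod.snd_sub, Pi.sub_apply]
          have : ∑ a, (if a = j1 then 0 else v.2 a - v'.2 a) * w a = ∑ a, (if a = j1 then 0 else v.2 a) * w a - ∑ a, (if a = j1 then 0 else v'.2 a) * w a := by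
            rw [← Finset.sum_sub_distrib]
            refine Finset.sum_congr rfl fun a _ => ?_
            split_ifs <;> ring
          rw [this]; ring
        rw [h3, h, sub_self]
  · intro y hy
    obtain ⟨v, hv, rfl⟩ := Finset.mem_image.mp hy
    obtain ⟨h1, h2⟩ := hSm v hv
    constructor
    · have : ∀ y : k, y^(p^s) = iterateFrobenius k p s y := fun y => (iterateFrobenius_def p s y).symm
      rw [this]
      simp only [Θ, map_add, map_mul, map_sum, apply_ite (iterateFrobenius k p s), map_zero]
      simp only [← this, hqs _ h1, hqs _ (h2 _), hx, hzs, hw]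
    · rw [map_sub, map_smul, map_smul, hev v h1 h2, hev v h1 h2, hsumc _ _ hcw, hsumc _ _ hgw]
      simp only [smul_eq_mul]
      linear_combination v.1 * hcg

theorem main4 [IsAlgClosed k] (he : 0 < e) {ι : Type*} [Fintype ι] [DecidableEq ι] (ee : ι → k[X]) (b : k[X]) (D : ℕ)
    (hbD : b.natDegree = D) (hee : ∀ j, (ee j).natDegree < D) (hli : LinearIndependent k ee)
    (f : k[X]) (hf : f ∈ Submodule.span k (Set.range ee)) (hf0 : f.coeff 0 ≠ 0) (t : ℕ) 
    (ht : (X:k[X])^t ∈ Submodule.span k (Set.range ee))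
    (h1 : (1:k[X]) ∉ Submodule.span k (Set.range ee) ⊔ Submodule.span k {b}) (j1 : ι) :
    ∃ Q0 : ℕ, ∀ s, Q0 ≤ p^s → (∀ α : k, α^(p^e) = α → α^(p^s) = α) →
      (∀ j i, ((ee j).coeff i)^(p^s) = (ee j).coeff i) → (∀ i, (b.coeff i)^(p^s) = b.coeff i) →
      ∃ (d : ι → k) (β : k), (∀ j, (d j)^(p^s) = d j) ∧ β^(p^s) = β ∧ β ≠ 0 ∧
        ∃ Z : Finset k, Z.card = (p^e)^(Fintype.card ι+1) ∧ ∀ x ∈ Z, x^(p^s) = x ∧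
          ev (p^e) x (∑ j, d j • ee j + β • b) = 0 := by
  classical
  have hp : p.Prime := Fact.out
  obtain ⟨P, a, ha, hP0, hP⟩ := param p e he ee b D hbD hee hli f hf hf0 t ht h1 j1
  obtain ⟨Q1, hQ1⟩ := thmP k p e D he
  refine ⟨max Q1 (P.totalDegree+2), fun s hs hqs hre hrb => ?_⟩
  have hs0 : s ≠ 0 := by
    rintro rfl
    have := le_trans (le_max_right _ _) hs
    simp at this
  obtain ⟨T, hT, hTm⟩ := fixedCard k p hp s hs0
  obtain ⟨w, hwT, hwP⟩ : ∃ w : ι → k, (∀ i, w i ∈ T) ∧ MvPolynomial.eval w P ≠ 0 := by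
    by_contra hcon
    push Not at hcon
    apply hP0
    refine MvPolynomial.eq_zero_of_eval_zero_at_prod_finset P (fun _ => T) (fun i => ?_) hcon
    have := le_trans (le_max_right _ _) hs
    have h2 := MvPolynomial.degreeOf_le_totalDegree P i
    rw [hT]; omega
  have hw : ∀ i, (w i)^(p^s) = w i := fun i => (hTm _).mp (hwT i)
  set φ := iterateFrobenius k p s with hφ
  have hφd : ∀ y : k, φ y = y^(p^s) := fun y => iterateFrobenius_def p s y
  have hevφ : ∀ (h : k[X]) (y : k), (∀ i, φ (h.coeff i) = h.coeff i) → φ y = y → φ (ev (p^e) y h) = ev (p^e) y h := by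
    intro h y h1 h2
    rw [ev_eq_lin _ _ _ _ le_rfl, lin_map]
    simp only [h1, h2]
  have hre' : ∀ j i, φ ((ee j).coeff i) = (ee j).coeff i := fun j i => by rw [hφd]; exact hre j i
  have hrb' : ∀ i, φ (b.coeff i) = b.coeff i := fun i => by rw [hφd]; exact hrb i
  have hw' : ∀ i, φ (w i) = w i := fun i => by rw [hφd]; exact hw i
  obtain ⟨B, hB⟩ : ∃ B : Matrix ι ι k, B = (Matrix.of fun x j => if x = j1 then (ee j).coeff 0 else ev (p^e) (w x) (ee j)) := ⟨_, rfl⟩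
  obtain ⟨hdet, hρ⟩ := hP w hwP B hB
  have hBφ : φ.mapMatrix B = B := by
    ext x j
    simp only [RingHom.mapMatrix_apply, Matrix.map_apply, hB, Matrix.of_apply]
    split_ifs
    · exact hre' _ _
    · exact hevφ _ _ (hre' j) (hw' x)
  have hdetφ : φ B.det = B.det := by rw [RingHom.map_det, hBφ]
  have hadjφ : ∀ i j, φ (B.adjugate i j) = B.adjugate i j := by
    intro i j
    have := RingHom.map_adjugate φ B
    rw [hBφ] at this
    exact congrFun (congrFun this i) j
  -- functional
  let Λ : ι → (k[X] →ₗ[k] k) := fun x => if x = j1 then Polynomial.lcoeff k 0 else ev (p^e) (w x)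
  have hΛ1 : ∀ h, Λ j1 h = h.coeff 0 := by intro h; simp [Λ]
  have hΛ2 : ∀ x, x ≠ j1 → ∀ h, Λ x h = ev (p^e) (w x) h := by intro x hx h; simp [Λ, hx]
  have hΛB : ∀ x j, Λ x (ee j) = B x j := by
    intro x j
    rw [hB, Matrix.of_apply]
    split_ifs with h
    · rw [h, hΛ1]
    · rw [hΛ2 x h]
  have hΛφ : ∀ x h, (∀ i, φ (h.coeff i) = h.coeff i) → φ (Λ x h) = Λ x h := by
    intro x h hh
    by_cases hx : x = j1
    · rw [hx, hΛ1, hh]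
    · rw [hΛ2 x hx]; exact hevφ _ _ hh (hw' x)
  have hΛs : ∀ x (v : ι → k), Λ x (∑ j, v j • ee j) = (B.mulVec v) x := by
    intro x v
    rw [map_sum]
    simp only [map_smul, smul_eq_mul, hΛB, Matrix.mulVec, dotProduct]
    exact Finset.sum_congr rfl fun _ _ => mul_comm _ _
  set c : k[X] := ∑ j, B.adjugate j j1 • ee j with hc
  have hΛc : ∀ x, Λ x c = B.det * (if x = j1 then 1 else 0) := by
    intro x
    rw [hc, hΛs]
    have := congrFun (congrFun (Matrix.mul_adjugate B) x) j1
    rw [Matrix.mul_apply] at this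
    simp only [Matrix.smul_apply, Matrix.one_apply, smul_eq_mul] at this
    simpa [Matrix.mulVec, dotProduct] using this
  let y : ι → k := fun x => Λ x b
  let xv : ι → k := B.adjugate.mulVec y
  have hxv : B.mulVec xv = B.det • y := by
    simp only [xv]
    rw [Matrix.mulVec_mulVec, Matrix.mul_adjugate, Matrix.smul_mulVec, Matrix.one_mulVec]
  set g : k[X] := B.det • b - ∑ j, xv j • ee j with hg
  have hΛg : ∀ x, Λ x g = 0 := by
    intro x
    rw [hg, map_sub, map_smul, hΛs, hxv]
    simp [y]
  have hxvφ : ∀ j, φ (xv j) = xv j := by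
    intro j
    simp only [xv, Matrix.mulVec, dotProduct, map_sum, map_mul, hadjφ, y, hΛφ _ b hrb']
  have hcφ : ∀ i, φ (c.coeff i) = c.coeff i := by
    intro i
    simp only [hc, finsetSum_coeff, coeff_smul, smul_eq_mul, map_sum, map_mul, hadjφ, hre']
  have hgφ : ∀ i, φ (g.coeff i) = g.coeff i := by
    intro i
    simp only [hg, finsetSum_coeff, coeff_sub, coeff_smul, smul_eq_mul, map_sub, map_sum, map_mul, hxvφ, hre', hrb', hdetφ]
  have hc0 : c.coeff 0 ≠ 0 := by
    rw [← hΛ1, hΛc]; simpa using hdet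
  have hg0 : g.coeff 0 = 0 := by rw [← hΛ1, hΛg]
  have hcw : ∀ x, x ≠ j1 → ev (p^e) (w x) c = 0 := by
    intro x hx; rw [← hΛ2 x hx, hΛc]; simp [hx]
  have hgw : ∀ x, x ≠ j1 → ev (p^e) (w x) g = 0 := by
    intro x hx; rw [← hΛ2 x hx, hΛg]
  have hD0 : 0 < D := lt_of_le_of_lt (Nat.zero_le _) (hee j1)
  have hsumd : ∀ v : ι → k, (∑ j, v j • ee j).natDegree < D := by
    intro v
    refine lt_of_le_of_lt (natDegree_sum_le_of_forall_le (n := D-1) _ _ fun j _ => ?_) (by omega)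
    have := natDegree_smul_le (v j) (ee j)
    have := hee j
    omega
  have hcd : c.natDegree < D := hsumd _
  have hgD : g.coeff D ≠ 0 := by
    rw [hg, coeff_sub, coeff_eq_zero_of_natDegree_lt (hsumd _), sub_zero, coeff_smul, smul_eq_mul]
    refine mul_ne_zero hdet ?_
    rw [← hbD, coeff_natDegree, leadingCoeff_ne_zero]
    rintro rfl
    simp at hbD; omega
  have hgd : g.natDegree ≤ D := by
    rw [hg]
    refine (natDegree_sub_le _ _).trans (max_le ((natDegree_smul_le _ _).trans hbD.le) (hsumd _).le)
  have hgC : g ∈ Submodule.span k (Set.range ee) ⊔ Submodule.span k {b} := by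
    have := mem_span ee b (fun j => - xv j) B.det
    convert this using 1
    rw [hg]; simp only [neg_smul, Finset.sum_neg_distrib]; ring
  obtain ⟨u, hu1, hu2⟩ : ∃ u, ev (p^e) u c = 0 ∧ ev (p^e) u g ≠ 0 := by
    by_contra hcon
    push Not at hcon
    obtain ⟨ρ, hρe⟩ := division p e he (a • c) g (by rw [coeff_smul, smul_eq_mul]; exact mul_ne_zero ha hc0) (by
      intro x hx
      rw [map_smul, smul_eq_mul] at hx
      exact hcon x ((mul_eq_zero.mp hx).resolve_left ha))
    have hac : (a • c).coeff 0 ≠ 0 := by rw [coeff_smul, smul_eq_mul]; exact mul_ne_zero ha hc0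
    have hac0 : a • c ≠ 0 := by intro h; rw [h] at hac; simp at hac
    have hρ0 : ρ = 0 := by
      by_contra hne
      apply hne
      apply hρ
      · have := cmp_coeff_zero p e (a • c) ρ
        rw [← hρe, hg0] at this
        exact (mul_eq_zero.mp this.symm).resolve_right hac
      · have := cmp_natDegree p e (a • c) ρ hac0 hne
        rw [← hρe] at this
        omega
      · rw [← hρe]; exact hgC
    rw [hρ0, map_zero] at hρe
    rw [hρe] at hgD
    simp at hgD
  have hcl : ∀ x, lin (p^e) c.coeff D x = ev (p^e) x c := fun x => (ev_eq_lin _ _ _ _ hcd.le).symm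
  have hgl : ∀ x, lin (p^e) g.coeff D x = ev (p^e) x g := fun x => (ev_eq_lin _ _ _ _ hgd).symm
  have hcne : c ≠ 0 := by intro h; rw [h] at hc0; simp at hc0
  obtain ⟨x, z, hx, hz, hcx, hcg, hzn⟩ := hQ1 s (le_trans (le_max_left _ _) hs) c.coeff g.coeff c.natDegree hcd
    (by rw [coeff_natDegree]; exact leadingCoeff_ne_zero.mpr hcne)
    (fun i hi => coeff_eq_zero_of_natDegree_lt hi) hgD hc0 hg0 (fun i => by rw [← hφd]; exact hcφ i)
    (fun i => by rw [← hφd]; exact hgφ i) u (by rw [hcl]; exact hu1) (by rw [hgl]; exact hu2)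
  simp only [hcl, hgl] at hcx hcg hzn
  obtain ⟨Z, hZ, hZm⟩ := inj_zeros p e he ee B w j1 hB hdet c g x z hcx hcg hcw hgw hzn s hqs hx hz hw
  have hx' : φ x = x := by rw [hφd]; exact hx
  have hφc := hevφ c x hcφ hx'
  have hφg := hevφ g x hgφ hx'
  refine ⟨fun j => - (ev (p^e) x c * xv j) - ev (p^e) x g * B.adjugate j j1, ev (p^e) x c * B.det, ?_, ?_, mul_ne_zero hcx hdet, Z, hZ, ?_⟩
  · intro j
    rw [← hφd]
    simp only [map_sub, map_neg, map_mul, hφc, hφg, hxvφ, hadjφ]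
  · rw [← hφd, map_mul, hφc, hdetφ]
  · intro v hv
    refine ⟨(hZm v hv).1, ?_⟩
    have := (hZm v hv).2
    convert this using 2
    generalize ev (p^e) x c = A1
    generalize ev (p^e) x g = A2
    rw [hg, hc]
    simp only [smul_sub, Finset.smul_sum, smul_smul, sub_smul, neg_smul, Finset.sum_sub_distrib, Finset.sum_neg_distrib]
    ring
end main4b
end part14

section part15
set_option autoImplicit false
set_option linter.unusedSectionVars false
open Polynomial

section assembly

theorem pow_fix {k : Type*} [Field k] (q : ℕ) (α : k) (h : α^q = α) (N : ℕ) : α^(q^N) = α := by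
  induction N with
  | zero => simp
  | succ N ih => rw [pow_succ, pow_mul, ih, h]

theorem descend0 {K k : Type*} [Field K] [Field k] [Algebra K k] {r : ℕ} (h : Fin r → ℕ → K)
    (hind : ∀ d : Fin r → K, (∀ i, ∑ j : Fin r, d j * h j i = 0) → d = 0)
    (d : Fin r → k) (hd : ∀ i, ∑ j, d j * algebraMap K k (h j i) = 0) : d = 0 := by
  ext j
  rw [Pi.zero_apply, ← Module.forall_dual_apply_eq_zero_iff K]
  intro l
  have := hind (fun j => l (d j)) (fun i => by
    have := congrArg l (hd i)
    rw [map_sum, map_zero] at this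
    rw [← this]
    refine Finset.sum_congr rfl fun j _ => ?_
    rw [mul_comm (d j), ← Algebra.smul_def, map_smul, smul_eq_mul, mul_comm])
  exact congrFun this j

theorem descend1 {K k : Type*} [Field K] [Field k] [Algebra K k] {r : ℕ} (h : Fin r → ℕ → K) (s : ℕ)
    (d : Fin r → k) (hd : ∀ i, (if i = s then (1:k) else 0) = ∑ j, d j * algebraMap K k (h j i)) : 
    ∃ d : Fin r → K, ∀ i, (if i = s then (1 : K) else 0) = ∑ j : Fin r, d j * h j i := by
  obtain ⟨l, hl⟩ : ∃ l : Module.Dual K k, l 1 ≠ 0 := by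
    by_contra hcon
    push Not at hcon
    exact one_ne_zero ((Module.forall_dual_apply_eq_zero_iff K (1:k)).mp hcon)
  refine ⟨fun j => (l 1)⁻¹ * l (d j), fun i => ?_⟩
  have := congrArg l (hd i)
  rw [map_sum] at this
  have h2 : ∀ j, l (d j * algebraMap K k (h j i)) = l (d j) * h j i := by
    intro j
    rw [mul_comm (d j), ← Algebra.smul_def, map_smul, smul_eq_mul, mul_comm]
  simp only [h2] at this
  simp only [mul_assoc]
  rw [← Finset.mul_sum, ← this]
  split_ifs
  · rw [inv_mul_cancel₀ hl]
  · simp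

theorem contra3 (p e n r t : ℕ) [Fact p.Prime] (he : 0 < e) (hr : 2 ≤ r) (hr3 : 3 ≤ r) (ht : 0 < t)
    (K : Type) [Field K] [Fintype K] [CharP K p] (hK : Fintype.card K = (p^e) ^ n) (hn : 1 ≤ n)
    (h : Fin r → ℕ → K)
    (hdegn : ∀ j i, n ≤ i → h j i = 0)
    (hh0 : ∀ i, h ⟨0, by omega⟩ i = if i = t then 1 else 0)
    (hsep : h ⟨1, hr⟩ 0 ≠ 0)
    (Ndeg : Fin r → ℕ)
    (hNdeg : ∀ j, h j (Ndeg j) ≠ 0 ∧ ∀ i, Ndeg j < i → h j i = 0)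
    (hgdeg : ∀ j : Fin r, 2 ≤ (j : ℕ) → max t (Ndeg ⟨1, hr⟩) < Ndeg j)
    (hind : ∀ d : Fin r → K, (∀ i, ∑ j : Fin r, d j * h j i = 0) → d = 0)
    (hmin : ∀ s : ℕ,
      (∃ d : Fin r → K, ∀ i, (if i = s then (1 : K) else 0) = ∑ j : Fin r, d j * h j i) →
      t ≤ s)
    (hexc : {m : ℕ | 0 < m ∧
        ∀ (L : Type) [Field L] [Algebra K L] [Fintype L],
          Fintype.card L = (p^e) ^ (n * m) →
          ∀ d : Fin r → L, d ≠ 0 →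
            Set.ncard {x : L |
                ∑ j : Fin r, d j *
                  (∑ i ∈ Finset.range n, algebraMap K L (h j i) * x ^ (p^e) ^ i) = 0}
              ≤ (p^e) ^ (r - 1)}.Infinite) : False := by
  classical
  have hp : p.Prime := Fact.out
  let k := AlgebraicClosure K
  haveI : CharP k p := charP_of_injective_algebraMap (algebraMap K k).injective p
  haveI : Nonempty (Fin r) := ⟨⟨0, by omega⟩⟩
  obtain ⟨j0, hj0⟩ := Finite.exists_max Ndeg
  obtain ⟨D, hD⟩ : ∃ D, D = Ndeg j0 := ⟨_, rfl⟩
  have hmaxD : max t (Ndeg ⟨1, hr⟩) < D := by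
    rw [hD]
    exact lt_of_lt_of_le (hgdeg ⟨2, by omega⟩ le_rfl) (hj0 _)
  have htD : t < D := lt_of_le_of_lt (le_max_left _ _) hmaxD
  have h1D : Ndeg ⟨1, hr⟩ < D := lt_of_le_of_lt (le_max_right _ _) hmaxD
  have hN0 : Ndeg ⟨0, by omega⟩ = t := by
    have := (hNdeg ⟨0, by omega⟩).1
    rw [hh0] at this
    by_contra hne
    rw [if_neg hne] at this
    exact this rfl
  have hj00 : (⟨0, by omega⟩ : Fin r) ≠ j0 := by
    intro hh; rw [← hh, hN0] at hD; omega
  have hj01 : (⟨1, hr⟩ : Fin r) ≠ j0 := by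
    intro hh; rw [← hh] at hD; omega
  have hbD0 : h j0 D ≠ 0 := by rw [hD]; exact (hNdeg j0).1
  let hp' : Fin r → k[X] := fun j => ∑ i ∈ Finset.range n, monomial i (algebraMap K k (h j i))
  have hpc : ∀ j i, (hp' j).coeff i = algebraMap K k (h j i) := by
    intro j i
    simp only [hp', finsetSum_coeff, coeff_monomial]
    rw [Finset.sum_ite_eq']
    split_ifs with hi
    · rfl
    · rw [hdegn j i (by simpa using hi), map_zero]
  have hpev : ∀ j x, ev (p^e) x (hp' j) = ∑ i ∈ Finset.range n, algebraMap K k (h j i) * x^(p^e)^i := by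
    intro j x
    simp only [hp', map_sum, ev_monomial]
  let κ : Fin r → K := fun j => h j D / h j0 D
  let ee : {j // j ≠ j0} → k[X] := fun j => hp' j - algebraMap K k (κ j) • hp' j0
  have heec : ∀ j i, (ee j).coeff i = algebraMap K k (h j i - κ j * h j0 i) := by
    intro j i
    simp only [ee, coeff_sub, coeff_smul, hpc, smul_eq_mul, map_sub, map_mul]
  have habove : ∀ j i, D < i → h j i = 0 := fun j i hi => (hNdeg j).2 i (lt_of_le_of_lt (hj0 j) (hD ▸ hi))
  have hbD : (hp' j0).natDegree = D := by
    apply natDegree_eq_of_le_of_coeff_ne_zero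
    · rw [natDegree_le_iff_coeff_eq_zero]
      intro N hN
      rw [hpc, habove _ _ hN, map_zero]
    · rw [hpc]; simpa using hbD0
  have heed : ∀ j, (ee j).natDegree < D := by
    intro j
    have : (ee j).natDegree ≤ D - 1 := by
      rw [natDegree_le_iff_coeff_eq_zero]
      intro N hN
      rw [heec]
      rcases (show D ≤ N by omega).eq_or_lt with hh | hh
      · subst hh
        simp only [κ]
        rw [div_mul_cancel₀ _ hbD0, sub_self, map_zero]
      · rw [habove _ _ hh, habove _ _ hh]; simp
    omega
  let ext : ({j // j ≠ j0} → k) → k → Fin r → k := fun g β j =>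
    if hj : j ≠ j0 then g ⟨j, hj⟩ else β - ∑ i, g i * algebraMap K k (κ i)
  have hext1 : ∀ g β (j : {j // j ≠ j0}), ext g β j = g j := by
    intro g β j; simp only [ext, dif_pos j.2]
  have hext0 : ∀ g β, ext g β j0 = β - ∑ i, g i * algebraMap K k (κ i) := by
    intro g β; simp [ext]
  have hexts : ∀ g β, ∑ j, g j • ee j + β • hp' j0 = ∑ j, ext g β j • hp' j := by
    intro g β
    rw [Fintype.sum_eq_add_sum_subtype_ne _ j0, hext0]
    simp only [hext1, ee, smul_sub, smul_smul, sub_smul, Finset.sum_smul, Finset.sum_sub_distrib]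
    ring
  have hextz : ∀ g β, ext g β = 0 → g = 0 ∧ β = 0 := by
    intro g β hz
    have h1 : g = 0 := by
      ext j
      rw [← hext1 g β j, hz]; rfl
    refine ⟨h1, ?_⟩
    have := hext0 g β
    rw [hz, h1] at this
    simpa using this.symm
  have hsc : ∀ (d : Fin r → k) i, (∑ j, d j • hp' j).coeff i = ∑ j, d j * algebraMap K k (h j i) := by
    intro d i
    simp only [finsetSum_coeff, coeff_smul, smul_eq_mul, hpc]
  have hli : LinearIndependent k ee := by
    rw [Fintype.linearIndependent_iff]
    intro g hg
    have h1 := hexts g 0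
    rw [hg, zero_smul, add_zero] at h1
    have h2 := descend0 h hind (ext g 0) (fun i => by rw [← hsc, ← h1, coeff_zero])
    exact congrFun (hextz _ _ h2).1
  have hk0 : ∀ j, j ≠ j0 → Ndeg j < D → hp' j ∈ Submodule.span k (Set.range ee) := by
    intro j hj hjd
    refine Submodule.subset_span ⟨⟨j, hj⟩, ?_⟩
    simp only [ee, κ]
    rw [(hNdeg j).2 D hjd]
    simp
  have hX : hp' ⟨0, by omega⟩ = (X:k[X])^t := by
    ext i
    rw [hpc, hh0, coeff_X_pow]
    split_ifs <;> simp
  have h1n : (1:k[X]) ∉ Submodule.span k (Set.range ee) ⊔ Submodule.span k {hp' j0} := by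
    intro hm
    obtain ⟨d, β, hd⟩ := span_mem ee (hp' j0) 1 hm
    rw [hexts] at hd
    have := hmin 0 (descend1 (k := k) h 0 (ext d β) (fun i => by
      rw [← hsc, ← hd, coeff_one]))
    omega
  obtain ⟨Q0, hQ0⟩ := main4 (k := k) p e he ee (hp' j0) D hbD heed hli (hp' ⟨1, hr⟩) (hk0 _ hj01 h1D)
    (by rw [hpc]; simpa using hsep) t (by rw [← hX]; exact hk0 _ hj00 (by rw [hN0]; exact htD)) h1n ⟨_, hj00⟩
  obtain ⟨m, ⟨hm0, hm⟩, hmQ⟩ := hexc.exists_gt Q0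
  obtain ⟨s, hs⟩ : ∃ s, s = e * (n * m) := ⟨_, rfl⟩
  have hps : p^s = (p^e)^(n*m) := by rw [hs, pow_mul]
  have hs0 : s ≠ 0 := by rw [hs]; positivity
  have hKfix : ∀ y : K, (algebraMap K k y)^(p^s) = algebraMap K k y := by
    intro y
    rw [← map_pow, hps, pow_mul, ← hK, pow_fix _ y (FiniteField.pow_card y)]
  obtain ⟨g, β, hg, hβ, hβ0, Z, hZc, hZ⟩ := hQ0 s (by
      have h1 : s < p^s := Nat.lt_pow_self hp.one_lt
      have h2 : m ≤ s := by
        rw [hs]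
        calc m = 1 * (1 * m) := by ring
          _ ≤ e * (n * m) := Nat.mul_le_mul he (Nat.mul_le_mul_right _ hn)
      omega) (fun α hα => by rw [hps]; exact pow_fix _ α hα _)
    (fun j i => by rw [heec]; exact hKfix _) (fun i => by rw [hpc]; exact hKfix _)
  let L : Subfield k := RingHom.eqLocusField (iterateFrobenius k p s) (RingHom.id k)
  have hL : ∀ x, x ∈ L ↔ x^(p^s) = x := by
    intro x
    rw [← iterateFrobenius_def]; rfl
  obtain ⟨T, hT, hTm⟩ := fixedCard k p hp s hs0
  letI : Fintype L := Fintype.subtype T (fun x => by rw [hTm, ← hL])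
  have hLc : Fintype.card L = (p^e)^(n*m) := by
    rw [← hps, ← hT]
    exact Fintype.card_of_subtype T (fun x => by rw [hTm, ← hL])
  letI : Algebra K L := ((algebraMap K k).codRestrict L (fun y => (hL _).mpr (hKfix y))).toAlgebra
  have hLa : ∀ y : K, ((algebraMap K L y : L) : k) = algebraMap K k y := fun y => rfl
  have hdL : ∀ j, ext g β j ∈ L := by
    intro j
    by_cases hj : j = j0
    · rw [hj, hext0]
      exact L.sub_mem ((hL _).mpr hβ) (L.sum_mem fun i _ => L.mul_mem ((hL _).mpr (hg i)) ((hL _).mpr (hKfix _)))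
    · have := hext1 g β ⟨j, hj⟩
      simp only at this
      rw [this]; exact (hL _).mpr (hg _)
  have hmain := hm L hLc (fun j => ⟨ext g β j, hdL j⟩) (by
    intro hz
    apply hβ0
    refine (hextz g β ?_).2
    ext j
    exact congrArg Subtype.val (congrFun hz j))
  have hcard : Fintype.card {j // j ≠ j0} + 1 = r := by
    have h1 : Fintype.card {j // j ≠ j0} = Fintype.card (Fin r) - Fintype.card {j // j = j0} := Fintype.card_subtype_compl _
    rw [h1, Fintype.card_fin, Fintype.card_subtype_eq]; omega
  rw [hcard] at hZc
  rw [← Set.ncard_image_of_injective _ Subtype.val_injective] at hmain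
  have hsub : (↑Z : Set k) ⊆ Subtype.val '' {x : L | ∑ j : Fin r, (⟨ext g β j, hdL j⟩ : L) *
                  (∑ i ∈ Finset.range n, algebraMap K L (h j i) * x ^ (p^e) ^ i) = 0} := by
    intro z hz
    obtain ⟨h1, h2⟩ := hZ z hz
    refine ⟨⟨z, (hL z).mpr h1⟩, ?_, rfl⟩
    rw [Set.mem_setOf_eq]
    apply Subtype.val_injective
    rw [hexts, map_sum] at h2
    simp only [map_smul, smul_eq_mul, hpev] at h2
    push_cast
    simp only [hLa]
    exact h2
  have := Set.ncard_le_ncard hsub (Set.toFinite _)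
  rw [Set.ncard_coe_finset, hZc] at this
  have h3 : (p^e)^(r-1) < (p^e)^r := Nat.pow_lt_pow_right (Nat.one_lt_pow he.ne' hp.one_lt) (by omega)
  omega
end assembly
end part15


/-- **Main Theorem of Bartoli–Zini–Zullo.** Let
`C = ⟨x^(q^t), f, g_3, …, g_r⟩ ⊆ L_(n,q)` be an exceptional `r`-dimensional
`F_(q^n)`-linear MRD code (generators given by coefficient functions `h j`, `h 0`
the monomial `x^(q^t)`, `h 1` the separable polynomial `f`), with `q > 5` when `r > 3`,
where `t > 0` is the minimum integer with `x^(q^t) ∈ C` and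
`deg(g_i) > max{q^t, deg f}` for `i = 3, …, r`. Then `f` is exceptional scattered of
index `t`: for infinitely many `m`, `dim_(F_q) ker(f(x) − m'x^(q^t)) ≤ 1` (kernel of
cardinality at most `q`) on `F_(q^(nm))` for every `m' ∈ F_(q^(nm))`. -/
theorem stmt_14 (q n r t : ℕ) (hq : ∃ p e : ℕ, p.Prime ∧ 0 < e ∧ q = p ^ e)
    (hn : 1 ≤ n) (hr : 2 ≤ r) (hq5 : 3 < r → 5 < q) (ht : 0 < t)
    (K : Type) [Field K] [Fintype K] (hK : Fintype.card K = q ^ n)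
    (h : Fin r → ℕ → K)
    (hdegn : ∀ j i, n ≤ i → h j i = 0)
    -- the first generator is the monomial x^{q^t}
    (hh0 : ∀ i, h ⟨0, by omega⟩ i = if i = t then 1 else 0)
    -- the second generator f is separable
    (hsep : h ⟨1, hr⟩ 0 ≠ 0)
    -- q-degrees of the generators
    (Ndeg : Fin r → ℕ)
    (hNdeg : ∀ j, h j (Ndeg j) ≠ 0 ∧ ∀ i, Ndeg j < i → h j i = 0)
    -- deg g_i > max {q^t, deg f} for the remaining generators
    (hgdeg : ∀ j : Fin r, 2 ≤ (j : ℕ) → max t (Ndeg ⟨1, hr⟩) < Ndeg j)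
    -- the generators are F_{q^n}-linearly independent
    (hind : ∀ d : Fin r → K, (∀ i, ∑ j : Fin r, d j * h j i = 0) → d = 0)
    -- t is the minimum integer s with x^{q^s} ∈ C
    (hmin : ∀ s : ℕ,
      (∃ d : Fin r → K, ∀ i, (if i = s then (1 : K) else 0) = ∑ j : Fin r, d j * h j i) →
      t ≤ s)
    -- C is an exceptional r-dimensional MRD code
    (hexc : {m : ℕ | 0 < m ∧
        ∀ (L : Type) [Field L] [Algebra K L] [Fintype L],
          Fintype.card L = q ^ (n * m) →
          ∀ d : Fin r → L, d ≠ 0 →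
            Set.ncard {x : L |
                ∑ j : Fin r, d j *
                  (∑ i ∈ Finset.range n, algebraMap K L (h j i) * x ^ q ^ i) = 0}
              ≤ q ^ (r - 1)}.Infinite) :
    -- f is exceptional scattered of index t
    {m : ℕ | 0 < m ∧
        ∀ (L : Type) [Field L] [Algebra K L] [Fintype L],
          Fintype.card L = q ^ (n * m) →
          ∀ m' : L,
            Set.ncard {x : L |
                (∑ i ∈ Finset.range n, algebraMap K L (h ⟨1, hr⟩ i) * x ^ q ^ i)
                  - m' * x ^ q ^ t = 0} ≤ q}.Infinite := by
  obtain ⟨p, e, hp, he, rfl⟩ := hq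
  haveI : Fact p.Prime := ⟨hp⟩
  rcases hr.eq_or_lt with hr2 | hr3
  · subst hr2
    refine hexc.mono ?_
    rintro m ⟨hm0, hm⟩
    refine ⟨hm0, ?_⟩
    intro L _ _ _ hL m'
    have h1 := hm L hL ![-m', 1] (by
      intro hz
      have := congrFun hz 1
      simp at this)
    have htn : t < n := by
      by_contra hcon
      have h2 := hdegn ⟨0, by omega⟩ t (by omega)
      rw [hh0] at h2
      simp at h2
    simp only [Nat.add_one_sub_one, pow_one] at h1
    convert h1 using 3
    ext x
    rw [Fin.sum_univ_two]
    have h3 : ∑ i ∈ Finset.range n, algebraMap K L (h 0 i) * x ^ (p^e) ^ i = x^(p^e)^t := by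
      rw [Finset.sum_eq_single t]
      · have := hh0 t
        rw [if_pos rfl] at this
        erw [this]; simp
      · intro i _ hi
        have := hh0 i
        rw [if_neg hi] at this
        erw [this]; simp
      · intro hh; simp at hh; omega
    rw [h3]
    simp only [Matrix.cons_val_zero, Matrix.cons_val_one]
    rw [one_mul, neg_mul, neg_add_eq_sub]
    rfl
  · exfalso
    haveI : CharP K p := by
      obtain ⟨p', hp'⟩ := CharP.exists K
      obtain ⟨N, hN1, hN2⟩ := FiniteField.card K p'
      have hdvd : p' ∣ (p^e)^n := by
        rw [← hK, hN2]; exact dvd_pow_self _ N.ne_zero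
      have := (Nat.prime_dvd_prime_iff_eq hN1 hp).mp (hN1.dvd_of_dvd_pow (hN1.dvd_of_dvd_pow hdvd))
      exact this ▸ hp'
    exact contra3 p e n r t he hr hr3 ht K hK hn h hdegn hh0 hsep Ndeg hNdeg hgdeg hind hmin hexc
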